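/- Let p = 3 or p = 5 and let n ≥ 3. Then there is a surjective group homomorphism from the group cohomology H^{n(n−1)/2 − 1}(Γ_n(p); ℤ) with trivial coefficients ℤ onto a free abelian group of rank p^{binom(n−2,2)} · g · ((p−1)/2)^{n−2}, where g denotes the number of 2-dimensional F_p-linear subspaces of F_p^n. -/

import Mathlib

/-- The level-`p` principal congruence subgroup `Γ_n(p)` of `SL_n(ℤ)`:
the kernel of the mod-`p` reduction homomorphism `SL_n(ℤ) → SL_n(ℤ/p)`. -/
def congruenceSubgroup (n p : ℕ) : Subgroup (Matrix.SpecialLinearGroup (Fin n) ℤ) :=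
  MonoidHom.ker (Matrix.SpecialLinearGroup.map (Int.castRingHom (ZMod p)))

namespace CodimOne
open Finset Filter Topology

/-- The signed maximal minor of a `(k+1) × k` matrix obtained by omitting row `i`. -/
noncomputable def signedMinor {k : ℕ} (y : Fin (k + 1) → Fin k → ℝ) (i : Fin (k + 1)) : ℝ :=
  (-1) ^ (i : ℕ) * Matrix.det (Matrix.of fun a => y (i.succAbove a))

open Classical in
/-- The local degree at the origin of the affine simplex with vertices `y`. -/
noncomputable def deg {k : ℕ} (y : Fin (k + 1) → Fin k → ℝ) : ℤ :=
  if ∀ i, 0 < signedMinor y i then 1 else if ∀ i, signedMinor y i < 0 then -1 else 0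

theorem det_cons_eq_sum {k : ℕ} (α : Fin (k + 1) → ℝ) (y : Fin (k + 1) → Fin k → ℝ) :
    Matrix.det (Matrix.of fun i => (Fin.cons (α i) (y i) : Fin (k + 1) → ℝ)) =
      ∑ i, signedMinor y i * α i := by
  rw [Matrix.det_succ_column_zero]
  refine Finset.sum_congr rfl fun i _ => ?_
  have : (Matrix.of fun i => (Fin.cons (α i) (y i) : Fin (k + 1) → ℝ)).submatrix
      i.succAbove Fin.succ = Matrix.of fun a => y (i.succAbove a) := by
    ext a b; simp
  rw [this, signedMinor]; simp; ring

theorem sum_signedMinor_mul {k : ℕ} (y : Fin (k + 1) → Fin k → ℝ) (b : Fin k) :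
    ∑ i, signedMinor y i * y i b = 0 := by
  rw [← det_cons_eq_sum (fun i => y i b) y]
  exact Matrix.det_zero_of_column_eq (i := 0) (j := b.succ) (Fin.succ_ne_zero b).symm
    (fun i => by simp)

theorem exists_pos_relation_of_deg_ne_zero {k : ℕ} {y : Fin (k + 1) → Fin k → ℝ}
    (h : deg y ≠ 0) : ∃ c : Fin (k + 1) → ℝ, (∀ i, 0 < c i) ∧ ∀ b, ∑ i, c i * y i b = 0 := by
  unfold deg at h
  split_ifs at h with h1 h2
  · exact ⟨_, h1, sum_signedMinor_mul y⟩
  · refine ⟨fun i => -signedMinor y i, fun i => by simpa using h2 i, fun b => ?_⟩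
    simp [sum_signedMinor_mul y b]
  · exact absurd rfl h

theorem deg_smul_det {k : ℕ} (y : Fin (k + 1) → Fin k → ℝ) (B : Matrix (Fin k) (Fin k) ℝ)
    (hB : 0 < B.det) : deg (fun i => B.mulVec (y i)) = deg y := by
  have : ∀ i, signedMinor (fun i => B.mulVec (y i)) i = signedMinor y i * B.det := by
    intro i
    have : (Matrix.of fun a => B.mulVec (y (i.succAbove a))) =
        (Matrix.of fun a => y (i.succAbove a)) * B.transpose := by
      ext a b
      simp [Matrix.mul_apply, Matrix.mulVec, dotProduct, mul_comm]
    rw [signedMinor, this, Matrix.det_mul, Matrix.det_transpose, signedMinor, mul_assoc]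
  unfold deg
  have h2 : ∀ x : ℝ, x * B.det < 0 ↔ x < 0 := fun x =>
    ⟨fun h => by by_contra h'; exact absurd (mul_nonneg (not_lt.mp h') hB.le) h.not_ge,
      fun h => mul_neg_of_neg_of_pos h hB⟩
  simp only [this, mul_pos_iff_of_pos_right hB, h2]

/-- A functional nonnegative on all vertices and positive on one forces degree zero. -/
theorem deg_eq_zero_of_functional {k : ℕ} {y : Fin (k + 1) → Fin k → ℝ} (c : Fin k → ℝ)
    (h0 : ∀ i, 0 ≤ ∑ b, c b * y i b) (h1 : ∃ i, ∑ b, c b * y i b ≠ 0) : deg y = 0 := by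
  by_contra h
  obtain ⟨l, hl, hs⟩ := exists_pos_relation_of_deg_ne_zero h
  have : ∑ i, l i * ∑ b, c b * y i b = 0 := by
    simp only [Finset.mul_sum]
    rw [Finset.sum_comm]
    refine Finset.sum_eq_zero fun b _ => ?_
    have := hs b
    calc _ = c b * ∑ i, l i * y i b := by
          rw [Finset.mul_sum]; exact Finset.sum_congr rfl fun i _ => by ring
      _ = 0 := by rw [this, mul_zero]
  rw [Finset.sum_eq_zero_iff_of_nonneg (fun i _ => mul_nonneg (hl i).le (h0 i))] at this
  obtain ⟨i, hi⟩ := h1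
  exact hi ((mul_eq_zero.mp (this i (mem_univ i))).resolve_left (hl i).ne')

/-- Every nontrivial nonnegative relation among the vertices is strictly positive. -/
def WeaklyGeneric {k : ℕ} (y : Fin (k + 1) → Fin k → ℝ) : Prop :=
  ∀ c : Fin (k + 1) → ℝ, (∀ i, 0 ≤ c i) → c ≠ 0 → (∀ b, ∑ i, c i * y i b = 0) → ∀ i, 0 < c i

theorem continuous_signedMinor {k : ℕ} (i : Fin (k + 1)) :
    Continuous fun y : Fin (k + 1) → Fin k → ℝ => signedMinor y i := by
  unfold signedMinor
  refine continuous_const.mul (Continuous.matrix_det ?_)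
  refine continuous_matrix fun a b => ?_
  simp only [Matrix.of_apply]
  fun_prop

theorem deg_ne_zero_of_relation {k : ℕ} {y : Fin (k + 1) → Fin k → ℝ} (hy : WeaklyGeneric y)
    {c : Fin (k + 1) → ℝ} (hc : ∀ i, 0 ≤ c i) (hc0 : c ≠ 0) (hr : ∀ b, ∑ i, c i * y i b = 0) :
    deg y ≠ 0 := by
  have hpos := hy c hc hc0 hr
  -- every relation is a multiple of `c`
  have hone : ∀ d : Fin (k + 1) → ℝ, (∀ b, ∑ i, d i * y i b = 0) → ∃ s : ℝ, d = s • c := by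
    intro d hd
    obtain ⟨i0, -, hi0⟩ := Finset.exists_min_image univ (fun i => d i / c i) univ_nonempty
    refine ⟨d i0 / c i0, ?_⟩
    by_contra hne
    have h1 : ∀ b, ∑ i, (d - (d i0 / c i0) • c) i * y i b = 0 := by
      intro b
      simp only [Pi.sub_apply, Pi.smul_apply, smul_eq_mul, sub_mul, sum_sub_distrib, hd b,
        mul_assoc,
        ← Finset.mul_sum, hr b]
      simp
    have := hy _ (fun i => ?_) (sub_ne_zero.mpr hne) h1 i0
    · simp [div_mul_cancel₀ _ (hpos i0).ne'] at this
    · have := (le_div_iff₀ (hpos i)).mp (hi0 i (mem_univ i))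
      simpa using this
  have hdet : ∀ i, signedMinor y i ≠ 0 := by
    intro i hi
    have h0 : Matrix.det (Matrix.of fun a => y (i.succAbove a)) = 0 := by
      simpa [signedMinor] using hi
    obtain ⟨v, hv, hv0⟩ := Matrix.exists_vecMul_eq_zero_iff.mpr h0
    obtain ⟨s, hs⟩ := hone (i.insertNth 0 v) (fun b => by
      rw [Fin.sum_univ_succAbove _ i]
      simpa [Matrix.vecMul, dotProduct] using congrFun hv0 b)
    have : s = 0 := by
      have := congrFun hs i
      simpa [(hpos i).ne'] using this.symm
    apply hv
    funext a
    have := congrFun hs (i.succAbove a)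
    simpa [‹s = 0›] using this
  obtain ⟨s, hs⟩ := hone (signedMinor y) (sum_signedMinor_mul y)
  have hs' : ∀ i, signedMinor y i = s * c i := fun i => congrFun hs i
  have hs0 : s ≠ 0 := fun h => hdet 0 (by rw [hs', h, zero_mul])
  unfold deg
  rcases lt_or_gt_of_ne hs0 with h | h
  · have h2 : ∀ i, signedMinor y i < 0 := fun i => by
      rw [hs']; exact mul_neg_of_neg_of_pos h (hpos i)
    rw [if_neg (fun H => (H 0).not_gt (h2 0)), if_pos h2]; decide
  · have h2 : ∀ i, 0 < signedMinor y i := fun i => by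
      rw [hs']; exact mul_pos h (hpos i)
    rw [if_pos h2]; decide

theorem eventually_deg_eq {k : ℕ} {y : Fin (k + 1) → Fin k → ℝ} (hy : WeaklyGeneric y) :
    ∀ᶠ y' in 𝓝 y, deg y' = deg y := by
  by_cases h1 : ∀ i, 0 < signedMinor y i
  · have : ∀ᶠ y' in 𝓝 y, ∀ i, 0 < signedMinor y' i :=
      eventually_all.mpr fun i =>
        (continuous_signedMinor i).continuousAt.eventually (lt_mem_nhds (h1 i))
    filter_upwards [this] with y' hy'
    rw [deg, deg, if_pos hy', if_pos h1]
  by_cases h2 : ∀ i, signedMinor y i < 0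
  · have : ∀ᶠ y' in 𝓝 y, ∀ i, signedMinor y' i < 0 :=
      eventually_all.mpr fun i =>
        (continuous_signedMinor i).continuousAt.eventually (gt_mem_nhds (h2 i))
    filter_upwards [this] with y' hy'
    rw [deg, deg, if_pos hy', if_pos h2, if_neg h1, if_neg fun H => (H 0).not_gt (hy' 0)]
  have h0 : deg y = 0 := by rw [deg, if_neg h1, if_neg h2]
  rw [h0]
  have key : ∀ c ∈ stdSimplex ℝ (Fin (k + 1)), ∀ᶠ z : (Fin (k + 1) → Fin k → ℝ) × (Fin (k + 1) → ℝ)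
      in 𝓝 (y, c), ¬ ∀ b, ∑ i, z.2 i * z.1 i b = 0 := by
    intro c hc
    have hne : ¬ ∀ b, ∑ i, c i * y i b = 0 := fun hr => by
      refine deg_ne_zero_of_relation hy hc.1 (fun h => ?_) hr h0
      have := hc.2
      simp [h] at this
    push Not at hne
    obtain ⟨b, hb⟩ := hne
    have hcont : Continuous fun z : (Fin (k + 1) → Fin k → ℝ) × (Fin (k + 1) → ℝ) =>
      ∑ i, z.2 i * z.1 i b := by fun_prop
    filter_upwards [hcont.continuousAt.eventually_ne hb] with z hz H
    exact hz (H b)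
  filter_upwards [(isCompact_stdSimplex ℝ (Fin (k + 1))).eventually_forall_of_forall_eventually
    (P := fun y' c => ¬ ∀ b, ∑ i, c i * y' i b = 0) key]
    with y' hy'
  by_contra hne
  obtain ⟨c, hc, hr⟩ := exists_pos_relation_of_deg_ne_zero hne
  have hS : 0 < ∑ i, c i := Finset.sum_pos (fun i _ => hc i) univ_nonempty
  refine hy' (fun i => c i / ∑ i, c i) ⟨fun i => (div_pos (hc i) hS).le, ?_⟩ (fun b => ?_)
  · rw [← Finset.sum_div, div_self hS.ne']
  · simp only [div_mul_eq_mul_div, ← Finset.sum_div, hr b, zero_div]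

/-- Sinks and sources of the tournament of a generic rank-two alternating form cancel. -/
theorem sum_sink_source_eq_zero {N : Type*} [Fintype N] [Nontrivial N] (b : N → N → ℝ)
    (hanti : ∀ i j, b i j = - b j i) (hne : ∀ i j, i ≠ j → b i j ≠ 0)
    (hpl : ∀ i j l m, b i j * b l m - b i l * b j m + b i m * b j l = 0) (s : N → ℤ)
    (hs1 : ∀ j, (∀ i, i ≠ j → 0 < b i j) → s j = 1)
    (hs2 : ∀ j, (∀ i, i ≠ j → b i j < 0) → s j = -1)
    (hs0 : ∀ j, ¬ (∀ i, i ≠ j → 0 < b i j) → ¬ (∀ i, i ≠ j → b i j < 0) → s j = 0) :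
    ∑ j, s j = 0 := by
  classical
  have aux : ∀ b : N → N → ℝ, (∀ i j, b i j = - b j i) → (∀ i j, i ≠ j → b i j ≠ 0) →
      (∀ i j l m, b i j * b l m - b i l * b j m + b i m * b j l = 0) →
      (∃ j, ∀ i, i ≠ j → 0 < b i j) → ∃ j, ∀ i, i ≠ j → b i j < 0 := by
    intro b hanti hne hpl ⟨j, hj⟩
    have hself : ∀ i, b i i = 0 := fun i => by have := hanti i i; linarith
    have htrans : ∀ i l m, 0 < b i l → 0 < b l m → 0 < b i m := by
      intro i l m hil hlm
      by_cases hmj : m = j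
      · subst hmj
        refine hj i fun h => ?_
        subst h
        have := hanti i l; linarith
      by_cases hlj : l = j
      · subst hlj
        have := hj m hmj
        have := hanti m l; linarith
      by_cases hij : i = j
      · subst hij
        have := hj l hlj
        have := hanti i l; linarith
      have h1 := hj i hij
      have h2 := hj m hmj
      have h3 := hj l hlj
      have h4 := hpl i j l m
      rw [hanti j m, hanti j l] at h4
      have h5 : 0 < b i m * b l j := by nlinarith [mul_pos h1 hlm, mul_pos hil h2]
      exact (mul_pos_iff_of_pos_right h3).mp h5
    let r : N → N → Prop := fun i l => 0 < b i l
    have : IsTrans N r := ⟨htrans⟩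
    have : Std.Irrefl r := ⟨fun i h => by simp [r, hself] at h⟩
    obtain ⟨m, -, hm⟩ := (Finite.wellFounded_of_trans_of_irrefl r).has_min Set.univ
      Set.univ_nonempty
    refine ⟨m, fun i hi => lt_of_le_of_ne (not_lt.mp (hm i trivial)) (hne i m hi)⟩
  have iff1 : (∃ j, ∀ i, i ≠ j → 0 < b i j) ↔ ∃ j, ∀ i, i ≠ j → b i j < 0 := by
    refine ⟨aux b hanti hne hpl, fun h => ?_⟩
    obtain ⟨j, hj⟩ := h
    obtain ⟨m, hm⟩ := aux (fun i j => b j i) (fun i j => hanti j i) (fun i j h => hne j i h.symm)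
      (fun i j l m => by
        have := hpl i j l m
        rw [hanti i j, hanti l m, hanti i l, hanti j m, hanti i m, hanti j l] at this
        linarith) ⟨j, fun i hi => by rw [hanti]; linarith [hj i hi]⟩
    exact ⟨m, fun i hi => by rw [hanti]; linarith [hm i hi]⟩
  by_cases hex : ∃ j, ∀ i, i ≠ j → 0 < b i j
  · obtain ⟨p, hp⟩ := hex
    obtain ⟨q, hq⟩ := iff1.mp ⟨p, hp⟩
    have hpq : p ≠ q := by
      rintro rfl
      obtain ⟨i, hi⟩ := exists_ne p
      linarith [hp i hi, hq i hi]
    have hrest : ∀ j, j ≠ p ∧ j ≠ q → s j = 0 := by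
      rintro j ⟨h1, h2⟩
      apply hs0
      · intro h
        have e1 := h p h1.symm
        have e2 := hp j h1
        have := hanti p j; linarith
      · intro h
        have e1 := h q h2.symm
        have e2 := hq j h2
        have := hanti q j; linarith
    rw [Fintype.sum_eq_add p q hpq hrest, hs1 p hp, hs2 q hq]; rfl
  · have hex2 : ¬ ∃ j, ∀ i, i ≠ j → b i j < 0 := fun h => hex (iff1.mpr h)
    push Not at hex hex2
    refine Finset.sum_eq_zero fun j _ => hs0 j (fun h => ?_) (fun h => ?_)
    · obtain ⟨i, h1, h2⟩ := hex j; linarith [h i h1]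
    · obtain ⟨i, h1, h2⟩ := hex2 j; linarith [h i h1]

theorem sum_deg_of_linearIndependent {k : ℕ} (y : Fin (k + 2) → Fin k → ℝ)
    (hg : ∀ c : Fin k → Fin (k + 2), Function.Injective c → LinearIndependent ℝ fun a => y (c a)) :
    ∑ j : Fin (k + 2), (-1) ^ (j : ℕ) * deg (fun a => y (j.succAbove a)) = 0 := by
  classical
  let Z : (Fin (k + 2) → ℝ) → Fin (k + 2) → Fin (k + 1) → ℝ := fun β i => Fin.cons (β i) (y i)
  let b : Fin (k + 2) → Fin (k + 2) → ℝ := fun i j => signedMinor (Z (Pi.single j 1)) i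
  have hb : ∀ i j, b i j = Matrix.det (Matrix.of fun r => (Fin.cons ((Pi.single i 1 :
      Fin (k + 2) → ℝ) r) (Z (Pi.single j 1) r) : Fin (k + 2) → ℝ)) := by
    intro i j
    rw [det_cons_eq_sum]
    simp [b, Pi.single_apply]
  have hanti : ∀ i j, b i j = - b j i := by
    intro i j
    rw [hb, hb]
    have := Matrix.det_permute' (Equiv.swap (0 : Fin (k + 2)) 1) (Matrix.of fun r =>
      (Fin.cons ((Pi.single j 1 : Fin (k + 2) → ℝ) r) (Z (Pi.single i 1) r) : Fin (k + 2) → ℝ))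
    rw [Equiv.Perm.sign_swap (by simp)] at this
    simp only [Units.val_neg, Units.val_one, Int.cast_neg, Int.cast_one, neg_mul, one_mul] at this
    rw [← this]
    congr 1
    ext r c
    refine Fin.cases ?_ (fun c => Fin.cases ?_ (fun c => ?_) c) c
    · simp [Z]
    · simp [Z]
    · have h1 : (Equiv.swap (0 : Fin (k + 2)) 1) c.succ.succ = c.succ.succ :=
        Equiv.swap_apply_of_ne_of_ne (Fin.succ_ne_zero _)
          (by rw [← Fin.succ_zero_eq_one]; exact fun h =>
            Fin.succ_ne_zero c (Fin.succ_injective _ h))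
      simp [h1, Z]
  have hself : ∀ i, b i i = 0 := fun i => by have := hanti i i; linarith
  have hrel : ∀ j c, ∑ i, b i j * y i c = 0 := fun j c => by
    simpa [Z] using sum_signedMinor_mul (Z (Pi.single j 1)) c.succ
  have hval : ∀ j i', b (j.succAbove i') j =
      - ((-1) ^ (j : ℕ) * signedMinor (fun a => y (j.succAbove a)) i') := by
    intro j i'
    rw [hanti]
    simp only [b]
    rw [signedMinor]
    have := det_cons_eq_sum (fun a => (Pi.single (j.succAbove i') (1 : ℝ) : Fin (k + 2) → ℝ)
      (j.succAbove a)) (fun a => y (j.succAbove a))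
    simp only [Z]
    rw [this]
    simp [Pi.single_apply]
  have hne : ∀ i j, i ≠ j → b i j ≠ 0 := by
    intro i j hij
    obtain ⟨i', rfl⟩ := Fin.exists_succAbove_eq hij
    rw [hval]
    have hli := hg (fun a => j.succAbove (i'.succAbove a))
      (Fin.succAbove_right_injective.comp Fin.succAbove_right_injective)
    have := (Matrix.linearIndependent_rows_iff_isUnit (A := Matrix.of fun a =>
      y (j.succAbove (i'.succAbove a)))).mp hli
    rw [Matrix.isUnit_iff_isUnit_det, isUnit_iff_ne_zero] at this
    simp [signedMinor, this]
  have hpl : ∀ i j l m, b i j * b l m - b i l * b j m + b i m * b j l = 0 := by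
    intro i j l m
    by_cases hjm : j = m
    · subst hjm
      rw [hself, hanti j l]; ring
    let v : Fin (k + 2) → ℝ := fun i => b i j * b l m - b i l * b j m + b i m * b j l
    have hv : ∀ c, ∑ i, v i * y i c = 0 := by
      intro c
      have e : ∀ i, v i * y i c = b l m * (b i j * y i c) - b j m * (b i l * y i c)
        + b j l * (b i m * y i c) := fun i => by simp only [v]; ring
      simp only [e, sum_add_distrib, sum_sub_distrib, ← mul_sum, hrel]; ring
    have hvj : v j = 0 := by simp only [v, hself]; ring
    have hvm : v m = 0 := by simp only [v, hself]; rw [hanti m j, hanti m l]; ring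
    obtain ⟨m', rfl⟩ := Fin.exists_succAbove_eq (Ne.symm hjm)
    have hli := Fintype.linearIndependent_iff.mp (hg (fun a => j.succAbove (m'.succAbove a))
      (Fin.succAbove_right_injective.comp Fin.succAbove_right_injective))
      (fun a => v (j.succAbove (m'.succAbove a))) (by
        ext c
        have := hv c
        rw [Fin.sum_univ_succAbove _ j, Fin.sum_univ_succAbove _ m', hvj, hvm] at this
        simpa using this)
    change v i = 0
    by_cases hij : i = j
    · rw [hij, hvj]
    obtain ⟨i', rfl⟩ := Fin.exists_succAbove_eq hij
    by_cases him : i' = m'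
    · rw [him, hvm]
    obtain ⟨i'', rfl⟩ := Fin.exists_succAbove_eq him
    exact hli i''
  have hsgn : ∀ j : Fin (k + 2), ((-1 : ℝ) ^ (j : ℕ) = 1 ∧ (-1 : ℤ) ^ (j : ℕ) = 1) ∨
      ((-1 : ℝ) ^ (j : ℕ) = -1 ∧ (-1 : ℤ) ^ (j : ℕ) = -1) := by
    intro j
    rcases Nat.even_or_odd (j : ℕ) with h | h
    · left; exact ⟨h.neg_one_pow, h.neg_one_pow⟩
    · right; exact ⟨h.neg_one_pow, h.neg_one_pow⟩
  have hall : ∀ (j) (P : ℝ → Prop), (∀ i, i ≠ j → P (b i j)) ↔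
      ∀ i', P (- ((-1) ^ (j : ℕ) * signedMinor (fun a => y (j.succAbove a)) i')) := by
    intro j P
    refine ⟨fun h i' => by rw [← hval]; exact h _ (Fin.succAbove_ne j i'), fun h i hi => ?_⟩
    obtain ⟨i', rfl⟩ := Fin.exists_succAbove_eq hi
    rw [hval]; exact h i'
  have key := sum_sink_source_eq_zero b hanti hne hpl
    (fun j => - ((-1) ^ (j : ℕ) * deg (fun a => y (j.succAbove a)))) ?_ ?_ ?_
  · rw [Finset.sum_neg_distrib, neg_eq_zero] at key; exact key
  · intro j hj
    rw [hall j (fun x => 0 < x)] at hj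
    rcases hsgn j with ⟨h1, h2⟩ | ⟨h1, h2⟩ <;> simp only [h1, h2] at hj ⊢
    · rw [deg, if_neg, if_pos]
      · rfl
      · intro i; linarith [hj i]
      · intro h; linarith [hj 0, h 0]
    · rw [deg, if_pos]
      · rfl
      · intro i; linarith [hj i]
  · intro j hj
    rw [hall j (fun x => x < 0)] at hj
    rcases hsgn j with ⟨h1, h2⟩ | ⟨h1, h2⟩ <;> simp only [h1, h2] at hj ⊢
    · rw [deg, if_pos]
      · rfl
      · intro i; linarith [hj i]
    · rw [deg, if_neg, if_pos]
      · rfl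
      · intro i; linarith [hj i]
      · intro h; linarith [hj 0, h 0]
  · intro j hj1 hj2
    rw [hall j (fun x => 0 < x)] at hj1
    rw [hall j (fun x => x < 0)] at hj2
    rcases hsgn j with ⟨h1, h2⟩ | ⟨h1, h2⟩ <;> simp only [h1, h2] at hj1 hj2 ⊢
    · rw [deg, if_neg, if_neg]
      · simp
      · intro h; exact hj1 fun i => by linarith [h i]
      · intro h; exact hj2 fun i => by linarith [h i]
    · rw [deg, if_neg, if_neg]
      · simp
      · intro h; exact hj2 fun i => by linarith [h i]
      · intro h; exact hj1 fun i => by linarith [h i]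

section Generic
variable {W : Type*} [NormedAddCommGroup W] [NormedSpace ℝ W] [FiniteDimensional ℝ W]

theorem exists_mem_open_forall_notMem {σ : Type*} [Countable σ] (P : σ → Submodule ℝ W)
    (hP : ∀ s, P s ≠ ⊤) {U : Set W} (hU : IsOpen U) (hne : U.Nonempty) :
    ∃ x ∈ U, ∀ s, x ∉ P s := by
  have := FiniteDimensional.complete ℝ W
  have hd : Dense (⋂ s, ((P s : Set W)ᶜ)) := by
    refine dense_iInter_of_isOpen (fun s => ?_) (fun s => ?_)
    · exact (P s).closed_of_finiteDimensional.isOpen_compl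
    · rw [← interior_eq_empty_iff_dense_compl]
      by_contra h
      exact hP s ((P s).eq_top_of_nonempty_interior' (Set.nonempty_iff_ne_empty.mpr h))
  obtain ⟨x, hx, hxU⟩ := hd.exists_mem_open hU hne
  exact ⟨x, hxU, fun s => Set.mem_iInter.mp hx s⟩

/-- Sequences chosen one term at a time, the term `i` depending only on the earlier terms. -/
noncomputable def seqOf {W : Type*} [Zero W] (next : ℕ → (ℕ → W) → W) : ℕ → W
  | i => next i fun j => if _h : j < i then seqOf next j else 0

theorem exists_generic_nat {A : Type*} [Countable A] {k : ℕ} (p : A → W →ₗ[ℝ] (Fin k → ℝ))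
    (hp : ∀ a, Function.Surjective (p a)) (U : ℕ → Set W) (hU : ∀ i, IsOpen (U i))
    (hne : ∀ i, (U i).Nonempty) :
    ∃ x : ℕ → W, (∀ i, x i ∈ U i) ∧ ∀ (T : Finset ℕ), T.card ≤ k → ∀ α : ℕ → A,
      LinearIndependent ℝ fun c : T => p (α c) (x c) := by
  classical
  let P : (ℕ → W) → (i : ℕ) → A × {Tα : (Σ T : Finset ℕ, (T → A)) // Tα.1.card < k} →
    Submodule ℝ W := fun h i s =>
      (Submodule.span ℝ (Set.range fun c : s.2.1.1 => p (s.2.1.2 c) (h c))).comap (p s.1)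
  have hP : ∀ h i s, P h i s ≠ ⊤ := by
    intro h i s htop
    have h1 : Submodule.span ℝ (Set.range fun c : s.2.1.1 => p (s.2.1.2 c) (h c)) = ⊤ := by
      rw [eq_top_iff]
      intro z _
      obtain ⟨w, rfl⟩ := hp s.1 z
      have : w ∈ P h i s := htop ▸ Submodule.mem_top
      exact this
    have h2 := finrank_range_le_card (R := ℝ) fun c : s.2.1.1 => p (s.2.1.2 c) (h c)
    rw [Set.finrank, h1, finrank_top, Module.finrank_fin_fun, Fintype.card_coe] at h2
    exact absurd s.2.2 (not_lt.mpr h2)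
  have hex := fun (i : ℕ) (h : ℕ → W) =>
    exists_mem_open_forall_notMem (P h i) (hP h i) (hU i) (hne i)
  choose next hn1 hn2 using hex
  refine ⟨seqOf next, fun i => by rw [seqOf]; exact hn1 _ _, fun T => ?_⟩
  induction T using Finset.induction_on_max with
  | empty => intro _ α; exact linearIndependent_empty_type
  | insert a T hmax ih =>
    intro hcard α
    have haT : a ∉ T := fun h => lt_irrefl _ (hmax a h)
    rw [Finset.card_insert_of_notMem haT] at hcard
    have h1 := ih (by omega) α
    have h2 : p (α a) (seqOf next a) ∉ Submodule.span ℝ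
        (Set.range fun c : T => p (α c) (seqOf next c)) := by
      intro hmem
      have h3 := hn2 a (fun j => if _h : j < a then seqOf next j else 0)
        ⟨α a, ⟨⟨T, fun c => α c⟩, by simpa using by omega⟩⟩
      apply h3
      have e1 : next a (fun j => if _h : j < a then seqOf next j else 0) = seqOf next a := by
        rw [seqOf]
      have e2 : (fun c : T => p (α c) (if _h : (c : ℕ) < a then seqOf next c else 0)) =
          fun c : T => p (α c) (seqOf next c) := by
        funext c
        rw [dif_pos (hmax c c.2)]
      rw [e1, Submodule.mem_comap, e2]
      exact hmem
    have h4 : LinearIndepOn ℝ (fun c => p (α c) (seqOf next c)) (insert a (T : Set ℕ)) := by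
      refine LinearIndepOn.insert (s := (T : Set ℕ)) h1 ?_
      have himg : (fun c => p (α c) (seqOf next c)) '' (T : Set ℕ) =
          Set.range fun c : T => p (α c) (seqOf next c) := by
        ext z; simp
      rw [himg]; exact h2
    have : ((insert a T : Finset ℕ) : Set ℕ) = insert a (T : Set ℕ) := by simp
    rw [← this] at h4
    exact h4

theorem exists_generic {ι A : Type*} [Countable ι] [Countable A] {k : ℕ}
    (p : A → W →ₗ[ℝ] (Fin k → ℝ))
    (hp : ∀ a, Function.Surjective (p a)) (U : ι → Set W) (hU : ∀ i, IsOpen (U i))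
    (hne : ∀ i, (U i).Nonempty) :
    ∃ x : ι → W, (∀ i, x i ∈ U i) ∧ ∀ (c : Fin k → ι), Function.Injective c → ∀ α : Fin k → A,
      LinearIndependent ℝ fun a => p (α a) (x (c a)) := by
  classical
  rcases isEmpty_or_nonempty A with hA | hA
  · rcases Nat.eq_zero_or_pos k with rfl | hk
    · choose x hx using hne
      exact ⟨x, hx, fun _ _ _ => linearIndependent_empty_type⟩
    · choose x hx using hne
      exact ⟨x, hx, fun _ _ α => (hA.false (α ⟨0, hk⟩)).elim⟩
  obtain ⟨enc, henc⟩ := exists_injective_nat ι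
  obtain ⟨x, hx, hli⟩ := exists_generic_nat p hp
    (fun m => if h : ∃ i, enc i = m then U h.choose else Set.univ)
    (fun m => by split_ifs with h; exacts [hU _, isOpen_univ])
    (fun m => by split_ifs with h; exacts [hne _, Set.univ_nonempty])
  refine ⟨fun i => x (enc i), fun i => ?_, fun c hc α => ?_⟩
  · have := hx (enc i)
    have h : ∃ j, enc j = enc i := ⟨i, rfl⟩
    rw [dif_pos h] at this
    rwa [henc h.choose_spec] at this
  · have hinj : Function.Injective fun a => enc (c a) := henc.comp hc
    let T : Finset ℕ := univ.image fun a => enc (c a)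
    have hT : T.card ≤ k := by
      simpa using Finset.card_image_le (s := (univ : Finset (Fin k))) (f := fun a => enc (c a))
    let β : ℕ → A := fun m => if h : ∃ a, enc (c a) = m then α h.choose else hA.some
    have hβ : ∀ a, β (enc (c a)) = α a := by
      intro a
      have h : ∃ b, enc (c b) = enc (c a) := ⟨a, rfl⟩
      simp only [β, dif_pos h]
      rw [hinj h.choose_spec]
    have := (hli T hT β).comp (fun a : Fin k => (⟨enc (c a), by simp [T]⟩ : T))
      (fun a b h => hinj (by simpa using congrArg Subtype.val h))
    simpa [Function.comp_def, hβ] using this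

end Generic

/-- No `k` of the vectors satisfy a nontrivial nonnegative relation. -/
def NoRelation {k N : ℕ} (y : Fin N → Fin k → ℝ) : Prop :=
  ∀ c : Fin k → Fin N, Function.Injective c → ∀ l : Fin k → ℝ, (∀ a, 0 ≤ l a) →
    (∀ b, ∑ a, l a * y (c a) b = 0) → l = 0

theorem NoRelation.weaklyGeneric {k : ℕ} {y : Fin (k + 1) → Fin k → ℝ} (h : NoRelation y) :
    WeaklyGeneric y := by
  intro c hc hc0 hr i
  refine lt_of_le_of_ne (hc i) fun hi => hc0 ?_
  have := h i.succAbove Fin.succAbove_right_injective (fun a => c (i.succAbove a))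
    (fun a => hc _) (fun b => by
      have := hr b
      rw [Fin.sum_univ_succAbove _ i, ← hi] at this
      simpa using this)
  funext j
  by_cases hj : j = i
  · rw [hj, ← hi]; rfl
  · obtain ⟨j', rfl⟩ := Fin.exists_succAbove_eq hj
    exact congrFun this j'

theorem NoRelation.comp {k N M : ℕ} {y : Fin N → Fin k → ℝ} (h : NoRelation y)
    (c : Fin M → Fin N) (hc : Function.Injective c) : NoRelation fun a => y (c a) :=
  fun d hd l hl hr => h (fun a => c (d a)) (hc.comp hd) l hl hr

theorem sum_deg_of_noRelation {k : ℕ} (y : Fin (k + 2) → Fin k → ℝ) (hy : NoRelation y) :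
    ∑ j : Fin (k + 2), (-1) ^ (j : ℕ) * deg (fun a => y (j.succAbove a)) = 0 := by
  have h1 : ∀ᶠ y' in 𝓝 y, ∀ j : Fin (k + 2), deg (fun a => y' (j.succAbove a)) =
      deg (fun a => y (j.succAbove a)) := by
    refine eventually_all.mpr fun j => ?_
    have hw := (hy.comp _ (Fin.succAbove_right_injective (p := j))).weaklyGeneric
    have hc : Continuous fun y' : Fin (k + 2) → Fin k → ℝ => fun a => y' (j.succAbove a) := by
      fun_prop
    exact hc.continuousAt.eventually (eventually_deg_eq hw)
  obtain ⟨ε, hε, hball⟩ := Metric.eventually_nhds_iff.mp h1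
  obtain ⟨y', hy', hli⟩ := exists_generic (ι := Fin (k + 2)) (A := Unit) (k := k)
    (fun _ => (LinearMap.id : (Fin k → ℝ) →ₗ[ℝ] _)) (fun _ => Function.surjective_id)
    (fun i => Metric.ball (y i) ε) (fun i => Metric.isOpen_ball)
    (fun i => ⟨y i, Metric.mem_ball_self hε⟩)
  have h2 := sum_deg_of_linearIndependent y' (fun c hc => by simpa using hli c hc fun _ => ())
  have h3 := hball (y := y') ((dist_pi_lt_iff hε).mpr hy')
  simpa [h3] using h2

end CodimOne

namespace CodimOne
open Finset

/-- Augmented ordered chains: integral combinations of finite lists of points. -/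
abbrev Chain (X : Type*) := List X →₀ ℤ

section Chains
variable {X Y Z : Type*}

/-- The chain of a single list. -/
noncomputable abbrev pt (l : List X) : Chain X := Finsupp.single l 1

/-- Adjoining a first vertex. -/
noncomputable def consL (v : X) : Chain X →ₗ[ℤ] Chain X := Finsupp.lmapDomain ℤ ℤ (List.cons v)

/-- The simplicial boundary of a list. -/
noncomputable def bdL : List X → Chain X
  | [] => 0
  | v :: l => pt l - consL v (bdL l)

/-- The simplicial boundary. -/
noncomputable def bd : Chain X →ₗ[ℤ] Chain X := Finsupp.linearCombination ℤ bdL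

/-- Evaluation of a cochain on chains. -/
noncomputable def ev (F : List X → ℤ) : Chain X →ₗ[ℤ] ℤ := Finsupp.linearCombination ℤ F

/-- The map induced on chains by a map of points. -/
noncomputable def mapL (f : X → Y) : Chain X →ₗ[ℤ] Chain Y := Finsupp.lmapDomain ℤ ℤ (List.map f)

/-- Chains supported on lists with property `P`. -/
noncomputable abbrev Supp (P : List X → Prop) : Submodule ℤ (Chain X) :=
  Finsupp.supported ℤ ℤ {l | P l}

/-- Chains of lists of length `L` with vertices in `S`. -/
noncomputable abbrev Ch (S : Set X) (L : ℕ) : Submodule ℤ (Chain X) :=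
  Supp fun l => l.length = L ∧ ∀ x ∈ l, x ∈ S

@[simp] theorem consL_pt (v : X) (l : List X) : consL v (pt l) = pt (v :: l) := by
  simp [consL]
@[simp] theorem bd_pt (l : List X) : bd (pt l) = bdL l := by simp [bd]
@[simp] theorem ev_pt (F : List X → ℤ) (l : List X) : ev F (pt l) = F l := by simp [ev]
@[simp] theorem mapL_pt (f : X → Y) (l : List X) : mapL f (pt l) = pt (l.map f) := by simp [mapL]

theorem supp_induction {P : List X → Prop} {c : Chain X} (hc : c ∈ Supp P)
    (M : Submodule ℤ (Chain X)) (h : ∀ l, P l → pt l ∈ M) : c ∈ M := by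
  rw [Supp, Finsupp.supported_eq_span_single] at hc
  refine Submodule.span_le.mpr ?_ hc
  rintro _ ⟨l, hl, rfl⟩
  exact h l hl

theorem pt_mem_supp {P : List X → Prop} {l : List X} (h : P l) : pt l ∈ Supp P :=
  Finsupp.single_mem_supported ℤ 1 h

theorem eq_of_supp {M : Type*} [AddCommGroup M] {P : List X → Prop} {c : Chain X}
    (hc : c ∈ Supp P) (f g : Chain X →ₗ[ℤ] M) (h : ∀ l, P l → f (pt l) = g (pt l)) : f c = g c :=
  supp_induction hc (LinearMap.eqLocus f g) h

theorem mem_of_supp {M : Type*} [AddCommGroup M] {P : List X → Prop} {c : Chain X}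
    (hc : c ∈ Supp P) (f : Chain X →ₗ[ℤ] M) (N : Submodule ℤ M) (h : ∀ l, P l → f (pt l) ∈ N) :
    f c ∈ N :=
  supp_induction hc (N.comap f) h

theorem hom_ext_chain {M : Type*} [AddCommGroup M] (f g : Chain X →ₗ[ℤ] M)
    (h : ∀ l, f (pt l) = g (pt l)) : f = g := by
  ext l
  simpa using h l

theorem supp_mono {P Q : List X → Prop} (h : ∀ l, P l → Q l) {c : Chain X} (hc : c ∈ Supp P) :
    c ∈ Supp Q := Finsupp.supported_mono (fun l hl => h l hl) hc

theorem bd_consL (v : X) (c : Chain X) : bd (consL v c) = c - consL v (bd c) := by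
  have : bd ∘ₗ consL v = LinearMap.id - consL v ∘ₗ bd :=
    hom_ext_chain _ _ fun l => by simp [bdL]
  exact LinearMap.congr_fun this c

theorem bd_bd (c : Chain X) : bd (bd c) = 0 := by
  have : bd ∘ₗ bd = (0 : Chain X →ₗ[ℤ] Chain X) := by
    refine hom_ext_chain _ _ fun l => ?_
    induction l with
    | nil => simp [bdL]
    | cons v l ih =>
      simp only [LinearMap.comp_apply, bd_pt, LinearMap.zero_apply, bdL, map_sub, bd_consL] at ih ⊢
      simp [ih]
  exact LinearMap.congr_fun this c

theorem mapL_consL (f : X → Y) (v : X) (c : Chain X) :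
    mapL f (consL v c) = consL (f v) (mapL f c) := by
  have : mapL f ∘ₗ consL v = consL (f v) ∘ₗ mapL f := hom_ext_chain _ _ fun l => by simp
  exact LinearMap.congr_fun this c

theorem bd_mapL (f : X → Y) (c : Chain X) : bd (mapL f c) = mapL f (bd c) := by
  have : bd ∘ₗ mapL f = mapL f ∘ₗ bd := by
    refine hom_ext_chain _ _ fun l => ?_
    induction l with
    | nil => simp [bdL]
    | cons v l ih =>
      simp only [LinearMap.comp_apply, bd_pt, mapL_pt, List.map_cons, bdL, map_sub,
        mapL_consL] at ih ⊢
      rw [ih]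
  exact LinearMap.congr_fun this c

theorem mapL_mapL (f : X → Y) (g : Y → Z) (c : Chain X) :
    mapL g (mapL f c) = mapL (fun x => g (f x)) c := by
  have : mapL g ∘ₗ mapL f = mapL (fun x => g (f x)) :=
    hom_ext_chain _ _ fun l => by simp [Function.comp_def]
  exact LinearMap.congr_fun this c

theorem mapL_id (c : Chain X) : mapL (fun x => x) c = c := by
  have : mapL (fun x : X => x) = LinearMap.id := hom_ext_chain _ _ fun l => by simp
  exact LinearMap.congr_fun this c

theorem ev_mapL (F : List Y → ℤ) (f : X → Y) (c : Chain X) :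
    ev F (mapL f c) = ev (fun l => F (l.map f)) c := by
  have : ev F ∘ₗ mapL f = ev fun l => F (l.map f) := hom_ext_chain _ _ fun l => by simp
  exact LinearMap.congr_fun this c

theorem ev_linear (f : Chain X →ₗ[ℤ] Chain Y) (F : List Y → ℤ) (c : Chain X) :
    ev F (f c) = ev (fun l => ev F (f (pt l))) c := by
  have : ev F ∘ₗ f = ev fun l => ev F (f (pt l)) := hom_ext_chain _ _ fun l => by simp
  exact LinearMap.congr_fun this c

theorem ev_congr {P : List X → Prop} {F F' : List X → ℤ} {c : Chain X} (hc : c ∈ Supp P)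
    (h : ∀ l, P l → F l = F' l) : ev F c = ev F' c :=
  eq_of_supp hc _ _ fun l hl => by simp [h l hl]

theorem consL_mem {P Q : List X → Prop} {v : X} (h : ∀ l, P l → Q (v :: l)) {c : Chain X}
    (hc : c ∈ Supp P) : consL v c ∈ Supp Q :=
  mem_of_supp hc _ _ fun l hl => by rw [consL_pt]; exact pt_mem_supp (h l hl)

theorem mapL_mem {P : List X → Prop} {Q : List Y → Prop} {f : X → Y} (h : ∀ l, P l → Q (l.map f))
    {c : Chain X} (hc : c ∈ Supp P) : mapL f c ∈ Supp Q :=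
  mem_of_supp hc _ _ fun l hl => by rw [mapL_pt]; exact pt_mem_supp (h l hl)

theorem bdL_mem {S : Set X} (l : List X) (hl : ∀ x ∈ l, x ∈ S) : bdL l ∈ Ch S (l.length - 1) := by
  induction l with
  | nil => exact Submodule.zero_mem _
  | cons v l ih =>
    simp only [List.mem_cons, forall_eq_or_imp] at hl
    refine Submodule.sub_mem _ (pt_mem_supp ⟨by simp, hl.2⟩) ?_
    cases l with
    | nil => simp [bdL]
    | cons w l =>
      refine consL_mem (fun s hs => ⟨?_, ?_⟩) (ih hl.2)
      · simp [hs.1]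
      · simp only [List.mem_cons, forall_eq_or_imp]; exact ⟨hl.1, hs.2⟩

theorem bd_mem {S : Set X} {L : ℕ} {c : Chain X} (hc : c ∈ Ch S L) : bd c ∈ Ch S (L - 1) :=
  mem_of_supp hc _ _ fun l hl => by rw [bd_pt, ← hl.1]; exact bdL_mem l hl.2

theorem bdL_ofFn {n : ℕ} (s : Fin (n + 1) → X) :
    bdL (List.ofFn s) =
      ∑ i : Fin (n + 1), (-1 : ℤ) ^ (i : ℕ) • pt (List.ofFn fun a => s (Fin.succAbove i a)) := by
  induction n with
  | zero => simp [bdL]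
  | succ n ih =>
    rw [List.ofFn_succ, bdL, ih (fun i => s i.succ), map_sum, sub_eq_add_neg,
      ← Finset.sum_neg_distrib, Fin.sum_univ_succ (n := n + 1)]
    congr 1
    · simp
    · refine Finset.sum_congr rfl fun i _ => ?_
      rw [map_smul, consL_pt, Fin.val_succ, pow_succ, mul_neg_one, neg_smul]
      congr 3
      rw [List.ofFn_succ]
      simp

/-! ### Acyclic-model constructions -/

/-- Cone each list off the image of its head. -/
noncomputable def stepL (V : X → Z) (ψ : Chain X →ₗ[ℤ] Chain Z) : List X → Chain Z
  | [] => 0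
  | x :: l => consL (V x) (ψ (pt (x :: l)))

/-- The linear extension of `stepL`. -/
noncomputable def step (V : X → Z) (ψ : Chain X →ₗ[ℤ] Chain Z) : Chain X →ₗ[ℤ] Chain Z :=
  Finsupp.linearCombination ℤ (stepL V ψ)

@[simp] theorem step_pt (V : X → Z) (ψ : Chain X →ₗ[ℤ] Chain Z) (l : List X) :
    step V ψ (pt l) = stepL V ψ l := by simp [step]

theorem bd_step {n : ℕ} {V : X → Z} {ψ : Chain X →ₗ[ℤ] Chain Z}
    (h : ∀ l : List X, l.length = n + 1 → bd (ψ (pt l)) = 0) {l : List X} (hl : l.length = n + 1) :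
    bd (step V ψ (pt l)) = ψ (pt l) := by
  cases l with
  | nil => simp at hl
  | cons x l => rw [step_pt, stepL, bd_consL, h _ hl, map_zero, sub_zero]

theorem mapL_step {X' Z' : Type*} {V : X → Z} {V' : X' → Z'} {a : X → X'} {b : Z → Z'}
    {ψ : Chain X →ₗ[ℤ] Chain Z} {ψ' : Chain X' →ₗ[ℤ] Chain Z'}
    (hV : ∀ x, b (V x) = V' (a x)) (h : ∀ c, mapL b (ψ c) = ψ' (mapL a c)) (c : Chain X) :
    mapL b (step V ψ c) = step V' ψ' (mapL a c) := by
  have : mapL b ∘ₗ step V ψ = step V' ψ' ∘ₗ mapL a := by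
    refine hom_ext_chain _ _ fun l => ?_
    cases l with
    | nil => simp [stepL]
    | cons x l => simp [stepL, mapL_consL, h, hV]
  exact LinearMap.congr_fun this c

theorem step_mem {P : List X → Prop} {Q R : List Z → Prop} {V : X → Z}
    {ψ : Chain X →ₗ[ℤ] Chain Z} (h : ∀ l, P l → ψ (pt l) ∈ Supp Q)
    (h' : ∀ x s, Q s → R (V x :: s)) {c : Chain X} (hc : c ∈ Supp P) : step V ψ c ∈ Supp R := by
  refine mem_of_supp hc _ _ fun l hl => ?_
  rw [step_pt]
  cases l with
  | nil => exact Submodule.zero_mem _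
  | cons x l => exact consL_mem (h' x) (h _ hl)

/-- The subdivision operator whose new vertex in degree `n` is given by `v n`. -/
noncomputable def subdiv (v : ℕ → X → Z) : ℕ → Chain X →ₗ[ℤ] Chain Z
  | 0 => Finsupp.linearCombination ℤ fun _ => pt []
  | n + 1 => step (v n) (subdiv v n ∘ₗ bd)

theorem bd_subdiv_pt (v : ℕ → X → Z) (n : ℕ) : ∀ l : List X, l.length = n + 1 →
    bd (subdiv v (n + 1) (pt l)) = subdiv v n (bd (pt l)) := by
  induction n with
  | zero =>
    refine fun l hl => bd_step (n := 0) (fun l hl => ?_) hl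
    obtain ⟨x, rfl⟩ := List.length_eq_one_iff.mp hl
    simp [bdL, subdiv]
  | succ n ih =>
    refine fun l hl => bd_step (n := n + 1) (fun l hl => ?_) hl
    have h1 : bd (pt l) ∈ Ch Set.univ (n + 1) := by
      have := bd_mem (pt_mem_supp (P := fun s => s.length = n + 2 ∧ ∀ x ∈ s, x ∈ Set.univ)
        ⟨hl, fun _ _ => trivial⟩)
      simpa using this
    have h2 := eq_of_supp h1 (bd ∘ₗ subdiv v (n + 1)) (subdiv v n ∘ₗ bd) fun s hs => ih s hs.1
    simp only [LinearMap.comp_apply] at h2 ⊢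
    rw [h2, bd_bd, map_zero]

theorem mapL_subdiv {X' Z' : Type*} {v : ℕ → X → Z} {v' : ℕ → X' → Z'} {a : X → X'} {b : Z → Z'}
    (hv : ∀ n x, b (v n x) = v' n (a x)) (n : ℕ) :
    ∀ c : Chain X, mapL b (subdiv v n c) = subdiv v' n (mapL a c) := by
  induction n with
  | zero =>
    intro c
    have : mapL b ∘ₗ subdiv v 0 = subdiv v' 0 ∘ₗ mapL a :=
      hom_ext_chain _ _ fun l => by simp [subdiv]
    exact LinearMap.congr_fun this c
  | succ n ih =>
    exact mapL_step (hv n) fun c => by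
      simp only [LinearMap.comp_apply, ih, bd_mapL]

/-- The cone homotopy annihilating a family `D` of chain maps. -/
noncomputable def coneHtpy (V : ℕ → X → Z) (D : ℕ → Chain X →ₗ[ℤ] Chain Z) :
    ℕ → Chain X →ₗ[ℤ] Chain Z
  | 0 => 0
  | n + 1 => step (V (n + 1)) (D (n + 1) - coneHtpy V D n ∘ₗ bd)

theorem mem_ch_univ {l : List X} : pt l ∈ Ch Set.univ l.length :=
  pt_mem_supp ⟨rfl, fun _ _ => trivial⟩

theorem bd_coneHtpy_pt {V : ℕ → X → Z} {D : ℕ → Chain X →ₗ[ℤ] Chain Z}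
    (h0 : D 0 (pt []) = 0)
    (hD : ∀ n (l : List X), l.length = n + 1 → bd (D (n + 1) (pt l)) = D n (bd (pt l))) (n : ℕ) :
    ∀ l : List X, l.length = n + 1 → bd (coneHtpy V D (n + 1) (pt l)) =
      D (n + 1) (pt l) - coneHtpy V D n (bd (pt l)) := by
  induction n with
  | zero =>
    intro l hl
    refine bd_step (n := 0) (fun l hl => ?_) hl
    simp only [coneHtpy, LinearMap.zero_comp, sub_zero]
    rw [hD 0 l hl]
    obtain ⟨x, rfl⟩ := List.length_eq_one_iff.mp hl
    simpa [bdL] using h0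
  | succ n ih =>
    intro l hl
    refine bd_step (n := n + 1) (fun l hl => ?_) hl
    have h1 : bd (pt l) ∈ Ch Set.univ (n + 1) := by
      have := bd_mem (mem_ch_univ (l := l))
      rwa [hl] at this
    have h2 := eq_of_supp h1 (bd ∘ₗ coneHtpy V D (n + 1))
      (D (n + 1) - coneHtpy V D n ∘ₗ bd) fun s hs => ih s hs.1
    simp only [LinearMap.comp_apply, LinearMap.sub_apply, bd_bd, map_zero, sub_zero] at h2 ⊢
    rw [map_sub, h2, hD _ _ hl, sub_self]

theorem mapL_coneHtpy {X' Z' : Type*} {V : ℕ → X → Z} {V' : ℕ → X' → Z'} {a : X → X'} {b : Z → Z'}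
    {D : ℕ → Chain X →ₗ[ℤ] Chain Z} {D' : ℕ → Chain X' →ₗ[ℤ] Chain Z'}
    (hV : ∀ n x, b (V n x) = V' n (a x)) (hD : ∀ n c, mapL b (D n c) = D' n (mapL a c)) (n : ℕ) :
    ∀ c : Chain X, mapL b (coneHtpy V D n c) = coneHtpy V' D' n (mapL a c) := by
  induction n with
  | zero => intro c; simp [coneHtpy]
  | succ n ih =>
    exact mapL_step (hV _) fun c => by
      simp only [LinearMap.sub_apply, LinearMap.comp_apply, map_sub, ih, bd_mapL, hD]

theorem coneHtpy_nil (V : ℕ → X → Z) (D : ℕ → Chain X →ₗ[ℤ] Chain Z) (n : ℕ) :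
    coneHtpy V D n (pt []) = 0 := by
  cases n <;> simp [coneHtpy, stepL]

end Chains

section Group
variable {G : Type*} [Group G]

/-- Left translation of chains on a group. -/
noncomputable abbrev lm (g : G) : Chain G →ₗ[ℤ] Chain G := mapL fun x => g * x

theorem lm_lm (g h : G) (c : Chain G) : lm g (lm h c) = lm (g * h) c := by
  rw [lm, lm, mapL_mapL]; simp only [lm, mul_assoc]

theorem lm_one (c : Chain G) : lm 1 c = c := by
  simp only [lm, one_mul]; exact mapL_id c

theorem lm_mem {S : Set G} {g : G} (hg : ∀ x ∈ S, g * x ∈ S) {L : ℕ} {c : Chain G}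
    (hc : c ∈ Ch S L) : lm g c ∈ Ch S L :=
  mapL_mem (fun l hl => ⟨by simp [hl.1], fun x hx => by
    obtain ⟨y, hy, rfl⟩ := List.mem_map.mp hx
    exact hg y (hl.2 y hy)⟩) hc

/-- Invariance of a cochain under left translation by `K`, vanishing on the empty list. -/
def InvFun (K : Subgroup G) (F : List G → ℤ) : Prop :=
  (∀ k ∈ K, ∀ l, F (l.map fun x => k * x) = F l) ∧ F [] = 0

/-- Chains annihilated by all `K`-invariant cochains. -/
def Ann (K : Subgroup G) : Submodule ℤ (Chain G) where
  carrier := {c | ∀ F, InvFun K F → ev F c = 0}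
  add_mem' ha hb F hF := by rw [map_add, ha F hF, hb F hF, add_zero]
  zero_mem' F _ := map_zero _
  smul_mem' r c hc F hF := by rw [map_smul, hc F hF, smul_zero]

theorem ann_mono {K K' : Subgroup G} (h : K ≤ K') : Ann K ≤ Ann K' :=
  fun _ hc F hF => hc F ⟨fun k hk => hF.1 k (h hk), hF.2⟩

theorem lm_sub_mem_ann {K : Subgroup G} {k : G} (hk : k ∈ K) (c : Chain G) :
    lm k c - c ∈ Ann K := by
  intro F hF
  rw [map_sub, lm, ev_mapL]
  simp only [hF.1 k hk]
  exact sub_self _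

theorem bd_ann {K : Subgroup G} {c : Chain G} (hc : c ∈ Ann K) : bd c ∈ Ann K := by
  intro F hF
  rw [ev_linear]
  refine hc _ ⟨fun k hk l => ?_, by simp [bdL]⟩
  change ev F (bd (pt (l.map _))) = ev F (bd (pt l))
  rw [← mapL_pt, bd_mapL, ev_mapL]
  simp only [hF.1 k hk]

theorem lm_ann {K : Subgroup G} [hK : K.Normal] (g : G) {c : Chain G} (hc : c ∈ Ann K) :
    lm g c ∈ Ann K := by
  intro F hF
  rw [lm, ev_mapL]
  refine hc _ ⟨fun k hk l => ?_, by simpa using hF.2⟩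
  have := hF.1 (g * k * g⁻¹) (hK.conj_mem k hk g) (l.map fun x => g * x)
  simpa [Function.comp_def, mul_assoc] using this

theorem ann_le_span {K : Subgroup G} {S : Set G} {L : ℕ}
    (hL : L ≠ 0) {c : Chain G} (hc : c ∈ Ch S L) (ha : c ∈ Ann K) :
    c ∈ Submodule.span ℤ {a | ∃ k ∈ K, ∃ l : List G, pt l ∈ Ch S L ∧ a = lm k (pt l) - pt l} := by
  classical
  let st : Setoid (List G) :=
    { r := fun l l' => ∃ k ∈ K, l.map (fun x => k * x) = l'
      iseqv := ⟨fun l => ⟨1, K.one_mem, by simp⟩, fun {l l'} ⟨k, hk, h⟩ => ⟨k⁻¹, K.inv_mem hk, by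
        rw [← h]; simp [Function.comp_def]⟩, fun {l l' l''} ⟨k, hk, h⟩ ⟨k', hk', h'⟩ =>
        ⟨k' * k, K.mul_mem hk' hk, by rw [← h', ← h]; simp [Function.comp_def, mul_assoc]⟩⟩ }
  let rep : List G → List G := fun l => (Quotient.mk st l).out
  have hrep : ∀ l, ∃ k ∈ K, l.map (fun x => k * x) = rep l := fun l =>
    st.symm (Quotient.mk_out (s := st) l)
  have hrepk : ∀ k ∈ K, ∀ l, rep (l.map fun x => k * x) = rep l := by
    intro k hk l
    have : Quotient.mk st (l.map fun x => k * x) = Quotient.mk st l :=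
      Quotient.sound (st.symm ⟨k, hk, rfl⟩)
    simp only [rep, this]
  set N := Submodule.span ℤ
    {a | ∃ k ∈ K, ∃ l : List G, pt l ∈ Ch S L ∧ a = lm k (pt l) - pt l} with hN
  let R : Chain G →ₗ[ℤ] Chain G := Finsupp.lmapDomain ℤ ℤ rep
  have h1 : R c - c ∈ N := by
    refine mem_of_supp hc (R - LinearMap.id) N fun l hl => ?_
    obtain ⟨k, hk, h⟩ := hrep l
    refine Submodule.subset_span ⟨k, hk, l, pt_mem_supp hl, ?_⟩
    simp [R, h]
  have h2 : R c = 0 := by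
    ext l0
    let F : List G → ℤ := fun l => if rep l = l0 ∧ l ≠ [] then 1 else 0
    have hF : InvFun K F := by
      refine ⟨fun k hk l => ?_, by simp [F]⟩
      simp only [F, hrepk k hk, ne_eq, List.map_eq_nil_iff]
    have h3 := eq_of_supp hc (Finsupp.lapply l0 ∘ₗ R) (ev F) fun l hl => by
      have hl0 : l ≠ [] := by rintro rfl; exact hL hl.1.symm
      simp [R, F, hl0, Finsupp.single_apply]
    rw [ha F hF] at h3
    simpa using h3
  rw [h2, zero_sub] at h1
  simpa using N.neg_mem h1

theorem ann_of_lm_sub {K : Subgroup G} [hK : K.Normal] {Y : G → ℝ} {t : G} {p : ℝ} (hp : 0 < p)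
    (hYK : ∀ k ∈ K, ∀ x, Y (k * x) = Y x) (hYt : ∀ x, Y (t * x) = Y x + p) {c : Chain G}
    (hc : lm t c - c ∈ Ann K) : c ∈ Ann K := by
  classical
  intro F hF
  let lev : List G → ℝ := fun l => match l with
    | [] => 0
    | x :: _ => Y x
  obtain ⟨M, hM⟩ : ∃ M : ℝ, ∀ l ∈ c.support, M < lev l := by
    have := (c.support.image lev).finite_toSet.bddBelow
    obtain ⟨M, hM⟩ := this
    exact ⟨M - 1, fun l hl => by
      have := hM (Finset.mem_coe.mpr (Finset.mem_image_of_mem lev hl)); linarith⟩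
  let F' : List G → ℤ := fun l => if M < lev l then F l else 0
  have hYpow : ∀ (j : ℕ) x, Y ((t ^ j)⁻¹ * x) = Y x - j * p := by
    intro j
    induction j with
    | zero => simp
    | succ j ih =>
      intro x
      have e : (t ^ (j + 1))⁻¹ * x = (t ^ j)⁻¹ * (t⁻¹ * x) := by rw [pow_succ']; group
      have h := hYt (t⁻¹ * x)
      rw [mul_inv_cancel_left] at h
      rw [e, ih]; push_cast; linarith
  have hF'0 : F' [] = 0 := by simp [F', hF.2]
  have hF'K : ∀ k ∈ K, ∀ l, F' (l.map fun x => k * x) = F' l := by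
    intro k hk l
    cases l with
    | nil => rfl
    | cons x l =>
      have := hF.1 k hk (x :: l)
      simp only [F', lev, List.map_cons, hYK k hk] at this ⊢
      rw [this]
  have hfin : ∀ l : List G, ∃ N : ℕ, ∀ j, N ≤ j → F' (l.map fun x => (t ^ j)⁻¹ * x) = 0 := by
    intro l
    cases l with
    | nil => exact ⟨0, fun j _ => hF'0⟩
    | cons x l =>
      obtain ⟨N, hN⟩ := exists_nat_gt ((Y x - M) / p)
      refine ⟨N, fun j hj => ?_⟩
      have h1 : ¬ M < Y ((t ^ j)⁻¹ * x) := by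
        rw [hYpow]
        have := (div_lt_iff₀ hp).mp hN
        have h2 : (N : ℝ) * p ≤ j * p := mul_le_mul_of_nonneg_right (by exact_mod_cast hj) hp.le
        linarith
      simp only [F', lev, List.map_cons, if_neg h1]
  let E : List G → ℤ := fun l => ∑ᶠ j : ℕ, F' (l.map fun x => (t ^ (j + 1))⁻¹ * x)
  have hE : ∀ l : List G, ∃ N : ℕ, ∀ m, N ≤ m →
      E l = ∑ j ∈ range m, F' (l.map fun x => (t ^ (j + 1))⁻¹ * x) := by
    intro l
    obtain ⟨N, hN⟩ := hfin l
    refine ⟨N, fun m hm => finsum_eq_sum_of_support_subset _ fun j hj => ?_⟩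
    by_contra h
    exact hj (hN (j + 1) (by simp at h; omega))
  have hEK : InvFun K E := by
    refine ⟨fun k hk l => ?_, by simp [E, hF'0]⟩
    simp only [E]
    refine finsum_congr fun j => ?_
    have := hF'K ((t ^ (j + 1))⁻¹ * k * (t ^ (j + 1))) (by
      simpa using hK.conj_mem k hk (t ^ (j + 1))⁻¹) (l.map fun x => (t ^ (j + 1))⁻¹ * x)
    rw [← this]
    simp [Function.comp_def, mul_assoc]
  have hEt : ∀ l : List G, E (l.map fun x => t * x) - E l = F' l := by
    intro l
    obtain ⟨N, hN⟩ := hE l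
    obtain ⟨N', hN'⟩ := hE (l.map fun x => t * x)
    rw [hN (max N N') (le_max_left _ _), hN' (max N N' + 1) (by omega), Finset.sum_range_succ']
    have : ∀ j : ℕ, (List.map (fun x => (t ^ (j + 1))⁻¹ * x) (List.map (fun x => t * x) l)) =
        l.map fun x => (t ^ j)⁻¹ * x := by
      intro j
      simp [Function.comp_def, pow_succ', mul_assoc]
    simp only [this]
    simp
  have h1 := hc E hEK
  rw [map_sub, lm, ev_mapL] at h1
  have h2 : ev F c = ev F' c := by
    simp only [ev, Finsupp.linearCombination_apply, Finsupp.sum]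
    refine Finset.sum_congr rfl fun l hl => ?_
    simp only [F', if_pos (hM l hl)]
  have h3 : ev F' c = ev (fun l => E (l.map fun x => t * x)) c - ev E c := by
    have : ev F' = ev (fun l => E (l.map fun x => t * x)) - ev E :=
      hom_ext_chain _ _ fun l => by simp [hEt]
    rw [this]; rfl
  rw [h2, h3, h1]

/-- A filtration of a group by normal subgroups with infinite cyclic central quotients, together
with real coordinates detecting it. -/
structure Tower (G : Type*) [Group G] (k : ℕ) where
  Y : ℕ → G → ℝ
  K : ℕ → Subgroup G
  t : ℕ → G
  p : ℝ
  p_pos : 0 < p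
  normal : ∀ d, (K d).Normal
  K_zero : K 0 = ⊥
  mono : ∀ d, K d ≤ K (d + 1)
  t_mem : ∀ d < k, t d ∈ K (d + 1)
  Y_t : ∀ d < k, ∀ x, Y d (t d * x) = Y d x + p
  Y_K : ∀ d, ∀ g ∈ K d, ∀ e, d ≤ e → e < k → ∀ x, Y e (g * x) = Y e x
  gen : ∀ d < k, ∀ g ∈ K (d + 1), ∃ c : ℤ, ∃ h ∈ K d, g = t d ^ c * h
  comm : ∀ d < k, ∀ g, ∃ z ∈ K d, g * t d = z * (t d * g)

namespace Tower
variable {k : ℕ} (T : Tower G k)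

theorem Y_zpow {d : ℕ} (hd : d < k) (c : ℤ) (x : G) :
    T.Y d (T.t d ^ c * x) = T.Y d x + c * T.p := by
  induction c using Int.induction_on generalizing x with
  | zero => simp
  | succ i ih =>
    rw [zpow_add_one, mul_assoc, ih, T.Y_t d hd]; push_cast; ring
  | pred i ih =>
    have h := T.Y_t d hd ((T.t d)⁻¹ * x)
    rw [mul_inv_cancel_left] at h
    rw [zpow_sub_one, mul_assoc, ih]; push_cast; linarith

theorem exists_decomp {d : ℕ} (hd : d < k) {S : Set G} (hS : ∀ g ∈ T.K (d + 1), ∀ x ∈ S, g * x ∈ S)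
    {L : ℕ} (hL : L ≠ 0) {c : Chain G} (hc : c ∈ Ch S L) (ha : c ∈ Ann (T.K (d + 1))) :
    ∃ b ∈ Ch S L, c - (lm (T.t d) b - b) ∈ Ann (T.K d) := by
  set D : Chain G →ₗ[ℤ] Chain G := lm (T.t d) - LinearMap.id with hD
  have hz : ∀ (x : Chain G), x ∈ Ch S L → ∀ z : ℤ, lm (T.t d ^ z) x - x ∈ (Ch S L).map D := by
    intro x hx z
    have hmem : ∀ z : ℤ, lm (T.t d ^ z) x ∈ Ch S L := fun z =>
      lm_mem (hS _ (Subgroup.zpow_mem _ (T.t_mem d hd) z)) hx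
    have hstep : ∀ z : ℤ, D (lm (T.t d ^ z) x) = lm (T.t d ^ (z + 1)) x - lm (T.t d ^ z) x := by
      intro z
      rw [hD, LinearMap.sub_apply, lm_lm, LinearMap.id_apply, add_comm, zpow_one_add]
    induction z using Int.induction_on with
    | zero => simp only [zpow_zero, lm_one, sub_self]; exact Submodule.zero_mem _
    | succ i ih =>
      have := Submodule.add_mem _ (Submodule.mem_map_of_mem (f := D) (hmem i)) ih
      rw [hstep] at this
      simpa using this
    | pred i ih =>
      have := Submodule.sub_mem _ ih (Submodule.mem_map_of_mem (f := D) (hmem (-i - 1)))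
      rw [hstep, sub_add_cancel] at this
      simpa using this
  have key : c ∈ (Ch S L).map D ⊔ Ann (T.K d) := by
    refine Submodule.span_le.mpr ?_ (ann_le_span hL hc ha)
    rintro _ ⟨g, hg, l, hl, rfl⟩
    obtain ⟨z, h, hh, rfl⟩ := T.gen d hd g hg
    have h1 := hz _ (lm_mem (hS _ (T.mono d hh)) hl) z
    have h2 := lm_sub_mem_ann hh (pt l)
    rw [lm_lm] at h1
    have := Submodule.add_mem_sup h1 h2
    rwa [sub_add_sub_cancel] at this
  obtain ⟨_, ⟨b, hb, rfl⟩, i, hi, hbi⟩ := Submodule.mem_sup.mp key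
  refine ⟨b, hb, ?_⟩
  rw [← hbi]
  simpa [hD] using hi

theorem ann_of_lm_sub {d : ℕ} (hd : d < k) {c : Chain G}
    (hc : lm (T.t d) c - c ∈ Ann (T.K d)) : c ∈ Ann (T.K d) :=
  have := T.normal d
  CodimOne.ann_of_lm_sub T.p_pos (fun g hg x => T.Y_K d g hg d le_rfl hd x) (T.Y_t d hd) hc

/-- Above the filtration degree, cycles modulo `K d` are boundaries modulo `K d`. -/
theorem acyclic {d : ℕ} (hd : d ≤ k) {S : Set G} (hne : S.Nonempty)
    (hS : ∀ g ∈ T.K d, ∀ x ∈ S, g * x ∈ S) {L : ℕ} (hL : d + 1 < L) {a : Chain G}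
    (ha : a ∈ Ch S L) (hb : bd a ∈ Ann (T.K d)) : ∃ e ∈ Ch S (L + 1), a - bd e ∈ Ann (T.K d) := by
  induction d generalizing L a with
  | zero =>
    obtain ⟨x0, hx0⟩ := hne
    have h0 : bd a = 0 := by
      classical
      ext l0
      by_cases hl0 : l0 = []
      · have := bd_mem ha
        rw [Finsupp.mem_supported'] at this
        refine this l0 fun h => ?_
        have := h.1
        simp only [hl0, List.length_nil] at this
        omega
      · have h1 := hb (fun l => if l = l0 then 1 else 0) ⟨fun g hg l => by
          rw [T.K_zero, Subgroup.mem_bot] at hg; simp [hg], by simp [Ne.symm hl0]⟩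
        have h2 : ev (fun l : List G => if l = l0 then 1 else 0) =
            (Finsupp.lapply l0 : Chain G →ₗ[ℤ] ℤ) :=
          hom_ext_chain _ _ fun l => by simp [Finsupp.single_apply]
        rw [h2] at h1
        simpa using h1
    refine ⟨consL x0 a, consL_mem (fun l hl => ⟨by simp [hl.1], ?_⟩) ha, ?_⟩
    · rw [bd_consL, h0, map_zero, sub_zero, sub_self]; exact Submodule.zero_mem _
    · simp only [List.mem_cons, forall_eq_or_imp]; exact ⟨hx0, hl.2⟩
  | succ d ih =>
    have hSd : ∀ g ∈ T.K d, ∀ x ∈ S, g * x ∈ S := fun g hg => hS g (T.mono d hg)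
    have hdk : d < k := hd
    have := T.normal d
    obtain ⟨b, hbS, hi⟩ := T.exists_decomp hdk hS (by omega) (bd_mem ha) hb
    have hcyc : bd b ∈ Ann (T.K d) := by
      refine T.ann_of_lm_sub hdk ?_
      have := bd_ann hi
      rw [map_sub, bd_bd, map_sub, bd_mapL, zero_sub] at this
      simpa using Submodule.neg_mem _ this
    obtain ⟨β, hβ, hi2⟩ := ih hdk.le hSd (by omega) hbS hcyc
    have hL1 : L - 1 + 1 = L := by omega
    rw [hL1] at hβ
    have htS : ∀ x ∈ S, T.t d * x ∈ S := hS _ (T.t_mem d hdk)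
    have hcyc2 : bd (a - (lm (T.t d) β - β)) ∈ Ann (T.K d) := by
      have e : bd (a - (lm (T.t d) β - β)) = (bd a - (lm (T.t d) b - b)) +
          (lm (T.t d) (b - bd β) - (b - bd β)) := by
        simp only [map_sub, bd_mapL]; abel
      rw [e]
      exact Submodule.add_mem _ hi (Submodule.sub_mem _ (lm_ann _ hi2) hi2)
    obtain ⟨ε, hε, hi3⟩ := ih hdk.le hSd (by omega)
      (Submodule.sub_mem _ ha (Submodule.sub_mem _ (lm_mem htS hβ) hβ)) hcyc2
    refine ⟨ε, hε, ?_⟩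
    have e : a - bd ε = (a - (lm (T.t d) β - β) - bd ε) + (lm (T.t d) β - β) := by abel
    rw [e]
    exact Submodule.add_mem _ (ann_mono (T.mono d) hi3) (lm_sub_mem_ann (T.t_mem d hdk) β)

/-- Translation acts trivially on top-degree cycles modulo `K d`. -/
theorem translate {d : ℕ} (hd : d ≤ k) {S : Set G} (hne : S.Nonempty)
    (hS : ∀ g ∈ T.K d, ∀ x ∈ S, g * x ∈ S) {g : G} (hg : ∀ x ∈ S, g * x ∈ S) {a : Chain G}
    (ha : a ∈ Ch S (d + 1)) (hb : bd a ∈ Ann (T.K d)) :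
    ∃ e ∈ Ch S (d + 2), lm g a - a - bd e ∈ Ann (T.K d) := by
  induction d generalizing a with
  | zero =>
    let M : Submodule ℤ (Chain G) := (Submodule.map bd (Ch S 2))
    have hM : lm g a - a ∈ M := by
      refine mem_of_supp ha (lm g - LinearMap.id) M fun l hl => ?_
      obtain ⟨x, rfl⟩ := List.length_eq_one_iff.mp hl.1
      have hx : x ∈ S := hl.2 x (by simp)
      refine ⟨pt [x, g * x], pt_mem_supp ⟨rfl, ?_⟩, ?_⟩
      · simp only [List.mem_cons, List.not_mem_nil, or_false, forall_eq_or_imp, forall_eq]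
        exact ⟨hx, hg x hx⟩
      · simp [bdL]
    obtain ⟨e, he, h⟩ := hM
    exact ⟨e, he, by rw [h, sub_self]; exact Submodule.zero_mem _⟩
  | succ d ih =>
    have hSd : ∀ g ∈ T.K d, ∀ x ∈ S, g * x ∈ S := fun g hg => hS g (T.mono d hg)
    have hdk : d < k := hd
    have := T.normal d
    obtain ⟨b, hbS, hi⟩ := T.exists_decomp hdk hS (by omega) (bd_mem ha) hb
    have hcyc : bd b ∈ Ann (T.K d) := by
      refine T.ann_of_lm_sub hdk ?_
      have := bd_ann hi
      rw [map_sub, bd_bd, map_sub, bd_mapL, zero_sub] at this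
      simpa using Submodule.neg_mem _ this
    obtain ⟨β, hβ, hi2⟩ := ih hdk.le hSd hbS hcyc
    have htS : ∀ x ∈ S, T.t d * x ∈ S := hS _ (T.t_mem d hdk)
    obtain ⟨z, hz, hcomm⟩ := T.comm d hdk g
    set t := T.t d
    have hcyc2 : bd (lm g a - a - (lm t β - β)) ∈ Ann (T.K d) := by
      have e : bd (lm g a - a - (lm t β - β)) =
          (lm g (bd a - (lm t b - b)) - (bd a - (lm t b - b)))
          + (lm t (lm g b - b - bd β) - (lm g b - b - bd β))
          + (lm z (lm (t * g) b) - lm (t * g) b) := by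
        have e1 : lm z (lm (t * g) b) = lm g (lm t b) := by rw [lm_lm, lm_lm, hcomm]
        have e2 : lm (t * g) b = lm t (lm g b) := by rw [lm_lm]
        rw [e1, e2]
        simp only [map_sub, bd_mapL]; abel
      rw [e]
      exact Submodule.add_mem _ (Submodule.add_mem _ (Submodule.sub_mem _ (lm_ann _ hi) hi)
        (Submodule.sub_mem _ (lm_ann _ hi2) hi2)) (lm_sub_mem_ann hz _)
    obtain ⟨ε, hε, hi3⟩ := T.acyclic hdk.le hne hSd (L := d + 2) (by omega)
      (Submodule.sub_mem _ (Submodule.sub_mem _ (lm_mem hg ha) ha)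
        (Submodule.sub_mem _ (lm_mem htS hβ) hβ)) hcyc2
    refine ⟨ε, hε, ?_⟩
    have e : lm g a - a - bd ε = (lm g a - a - (lm t β - β) - bd ε) + (lm t β - β) := by abel
    rw [e]
    exact Submodule.add_mem _ (ann_mono (T.mono d) hi3) (lm_sub_mem_ann (T.t_mem d hdk) β)

end Tower
end Group

/-- Extend a function of `L` points to lists, by zero on lists of another length. -/
def onList {X : Type*} (L : ℕ) (F : (Fin L → X) → ℤ) (l : List X) : ℤ :=
  if h : l.length = L then F fun i => l.get (Fin.cast h.symm i) else 0

@[simp] theorem onList_ofFn {X : Type*} {L : ℕ} (F : (Fin L → X) → ℤ) (x : Fin L → X) :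
    onList L F (List.ofFn x) = F x := by
  rw [onList, dif_pos (List.length_ofFn)]
  congr 1
  funext i
  simp

theorem onList_of_length_ne {X : Type*} {L : ℕ} {F : (Fin L → X) → ℤ} {l : List X}
    (h : l.length ≠ L) : onList L F l = 0 := dif_neg h

theorem exists_ofFn_of_length {X : Type*} {L : ℕ} {l : List X} (h : l.length = L) :
    ∃ x : Fin L → X, l = List.ofFn x := by
  subst h; exact ⟨l.get, (List.ofFn_get l).symm⟩

theorem ev_finsum {X H : Type*} {P : List X → Prop} {c : Chain X} (hc : c ∈ Supp P)
    (F : H → List X → ℤ) (hF : ∀ l, P l → (Function.support fun h => F h l).Finite) :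
    ev (fun l => ∑ᶠ h, F h l) c = ∑ᶠ h, ev (F h) c := by
  simp only [ev, Finsupp.linearCombination_apply, Finsupp.sum]
  rw [finsum_sum_comm]
  · exact Finset.sum_congr rfl fun l _ => smul_finsum _ _
  · intro l hl
    refine (hF l (hc hl)).subset fun h hh => ?_
    simp only [Function.mem_support] at hh ⊢
    exact right_ne_zero_of_mul hh

theorem finsum_telescope (A : ℤ → ℤ) (N : ℕ) (h0 : ∀ j ≤ 0, A j = A 0)
    (hN : ∀ j : ℤ, N ≤ j → A j = 0) :
    ∑ᶠ c : ℤ, (A (1 - c) - A (-c)) = -A 0 := by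
  have h1 : ∑ᶠ c : ℤ, (A (1 - c) - A (-c)) = ∑ᶠ c : ℤ, (A (c + 1) - A c) := by
    rw [← finsum_comp_equiv (Equiv.neg ℤ)]
    refine finsum_congr fun c => ?_
    simp [sub_neg_eq_add, add_comm]
  rw [h1, finsum_eq_sum_of_support_subset (s := (range N).map Nat.castEmbedding)]
  · rw [Finset.sum_map]
    have := Finset.sum_range_sub (fun j : ℕ => A j) N
    simp only [Nat.cast_add, Nat.cast_one, Nat.cast_zero] at this
    simp only [Nat.castEmbedding_apply]
    rw [this, hN N le_rfl, zero_sub]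
  · intro c hc
    by_contra h
    apply hc
    simp only [Finset.coe_map, Set.mem_image, Finset.coe_range, Set.mem_Iio,
      Nat.castEmbedding_apply, not_exists, not_and] at h
    rcases lt_or_ge c 0 with h2 | h2
    · simp only [h0 c h2.le, h0 (c + 1) (by omega), sub_self]
    · have : (N : ℤ) ≤ c := by
        by_contra h3
        exact h c.toNat (by omega) (by omega)
      simp only [hN c this, hN (c + 1) (by omega), sub_self]

/-- Adjoining the last basis vector. -/
def addTop {d N : ℕ} (y : Fin N → Fin (d + 1) → ℝ) : Fin (N + 1) → Fin (d + 1) → ℝ :=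
  Fin.cons (Pi.single (Fin.last d) 1) y

theorem signedMinor_addTop {d : ℕ} (y : Fin (d + 1) → Fin (d + 1) → ℝ) (i : Fin (d + 1)) :
    signedMinor (addTop y) i.succ =
      (-1) ^ (d + 1) * signedMinor (fun i a => y i a.castSucc) i := by
  rw [signedMinor, signedMinor, Matrix.det_succ_row_zero, Finset.sum_eq_single (Fin.last d)]
  · have h : (Matrix.of fun a => addTop y (i.succ.succAbove a)).submatrix Fin.succ
        (Fin.last d).succAbove = Matrix.of fun a b => y (i.succAbove a) b.castSucc := by
      ext a b
      simp [addTop]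
    rw [h]
    simp [addTop, pow_succ]
    ring
  · intro b _ hb
    simp [addTop, hb]
  · simp

theorem sum_addTop {d : ℕ} (y : Fin (d + 1) → Fin (d + 1) → ℝ) :
    signedMinor (addTop y) 0 +
      ∑ i : Fin (d + 1), signedMinor (addTop y) i.succ * y i (Fin.last d) = 0 := by
  have := sum_signedMinor_mul (addTop y) (Fin.last d)
  rw [Fin.sum_univ_succ] at this
  simpa [addTop] using this

theorem signedMinor_addTop_pos {d : ℕ} {y : Fin (d + 1) → Fin (d + 1) → ℝ}
    (hy : ∀ i, y i (Fin.last d) < 0) :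
    ((∀ i, 0 < signedMinor (addTop y) i) ↔ ∀ i : Fin (d + 1), 0 < signedMinor (addTop y) i.succ) ∧
    ((∀ i, signedMinor (addTop y) i < 0) ↔
      ∀ i : Fin (d + 1), signedMinor (addTop y) i.succ < 0) := by
  have h := sum_addTop y
  refine ⟨⟨fun H i => H _, fun H => Fin.cases ?_ H⟩, ⟨fun H i => H _, fun H => Fin.cases ?_ H⟩⟩
  · have : ∑ i : Fin (d + 1), signedMinor (addTop y) i.succ * y i (Fin.last d) < 0 :=
      Finset.sum_neg (fun i _ => mul_neg_of_pos_of_neg (H i) (hy i)) univ_nonempty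
    linarith
  · have : 0 < ∑ i : Fin (d + 1), signedMinor (addTop y) i.succ * y i (Fin.last d) :=
      Finset.sum_pos (fun i _ => mul_pos_of_neg_of_neg (H i) (hy i)) univ_nonempty
    linarith

theorem deg_addTop {d : ℕ} {y : Fin (d + 1) → Fin (d + 1) → ℝ} (hy : ∀ i, y i (Fin.last d) < 0) :
    deg (addTop y) = (-1) ^ (d + 1) * deg fun i a => y i a.castSucc := by
  unfold deg
  obtain ⟨h1, h2⟩ := signedMinor_addTop_pos hy
  simp only [h1, h2, signedMinor_addTop]
  rcases Nat.even_or_odd (d + 1) with h | h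
  · simp only [h.neg_one_pow, one_mul]
  · simp only [h.neg_one_pow, neg_one_mul, neg_pos, neg_lt_zero]
    by_cases h3 : ∀ i : Fin (d + 1), signedMinor (fun i a => y i a.castSucc) i < 0
    · have h4 : ¬ ∀ i : Fin (d + 1), 0 < signedMinor (fun i a => y i a.castSucc) i :=
        fun h4 => absurd (h3 0) (h4 0).not_gt
      simp only [if_pos h3, if_neg h4, neg_neg]
    · simp only [if_neg h3]
      split_ifs <;> simp

theorem deg_eq_zero_of_coord {d : ℕ} {y : Fin (d + 1) → Fin d → ℝ} (i : Fin d) (ε : ℝ)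
    (h0 : ∀ j, 0 ≤ ε * y j i) (h1 : ∃ j, ε * y j i ≠ 0) : deg y = 0 := by
  have : ∀ j, ∑ b, (Pi.single i ε : Fin d → ℝ) b * y j b = ε * y j i := fun j => by
    simp [Pi.single_apply]
  refine deg_eq_zero_of_functional (Pi.single i ε) ?_ ?_ <;> simpa only [this]

namespace Tower
variable {G : Type*} [Group G] {k : ℕ} (T : Tower G k)

/-- Coordinates below `d`. -/
def vec (d : ℕ) (x : G) : Fin d → ℝ := fun i => T.Y i x

/-- The degree cochain built from the first `d` coordinates. -/
noncomputable def degL (d : ℕ) : List G → ℤ := onList (d + 1) fun x => deg fun i => T.vec d (x i)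

/-- The relative degree cochain: degree of the cone from the last basis vector. -/
noncomputable def relL (d : ℕ) : List G → ℤ :=
  onList (d + 1) fun x => deg (addTop fun i => T.vec (d + 1) (x i))

/-- The coordinates are in general position for nonnegative relations. -/
def Generic : Prop := ∀ d ≤ k, ∀ x : Fin d → G, ∀ l : Fin d → ℝ, (∀ j, 0 ≤ l j) →
  (∀ i : Fin d, ∑ j, l j * T.Y i (x j) = 0) → l = 0

variable {T}

theorem Generic.noRelation (hT : T.Generic) {d N : ℕ} (hd : d ≤ k) (x : Fin N → G) :
    NoRelation fun i => T.vec d (x i) :=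
  fun c _ l hl h => hT d hd (x ∘ c) l hl h

theorem Generic.noRelation_addTop (hT : T.Generic) {d N : ℕ} (hd : d < k) (x : Fin N → G) :
    NoRelation (addTop fun i => T.vec (d + 1) (x i)) := by
  intro c hc l hl h
  by_cases h0 : ∃ a0, c a0 = 0
  · obtain ⟨a0, ha0⟩ := h0
    have hs : ∀ j, ∃ q, c (a0.succAbove j) = Fin.succ q := fun j => by
      refine Fin.exists_succ_eq.mpr (fun h => ?_) |>.imp fun _ h => h.symm
      rw [← ha0] at h
      exact Fin.succAbove_ne a0 j (hc h)
    choose q hq using hs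
    have hl' : (fun j => l (a0.succAbove j)) = 0 := by
      refine hT d hd.le (x ∘ q) _ (fun j => hl _) fun i => ?_
      have := h i.castSucc
      rw [Fin.sum_univ_succAbove _ a0] at this
      simpa [ha0, hq, addTop, vec] using this
    have hl1 : l a0 = 0 := by
      have := h (Fin.last d)
      rw [Fin.sum_univ_succAbove _ a0] at this
      have h2 : ∀ j, l (a0.succAbove j) = 0 := fun j => congrFun hl' j
      simpa [ha0, hq, addTop, h2] using this
    funext a
    rcases Fin.eq_self_or_eq_succAbove a0 a with rfl | ⟨j, rfl⟩
    · exact hl1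
    · exact congrFun hl' j
  · push Not at h0
    have hs : ∀ j, ∃ q, c j = Fin.succ q := fun j =>
      (Fin.exists_succ_eq.mpr (h0 j)).imp fun _ h => h.symm
    choose q hq using hs
    exact hT (d + 1) hd (x ∘ q) l hl fun i => by
      have := h i
      simpa [hq, addTop, vec] using this

theorem degL_nil (d : ℕ) : T.degL d [] = 0 := onList_of_length_ne (by simp)
theorem relL_nil (d : ℕ) : T.relL d [] = 0 := onList_of_length_ne (by simp)

theorem degL_succ (hT : T.Generic) {d : ℕ} (hd : d < k) {l : List G} (hl : l.length = d + 2) :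
    T.degL (d + 1) l = ev (T.relL d) (bd (pt l)) := by
  obtain ⟨x, rfl⟩ := exists_ofFn_of_length hl
  have h := sum_deg_of_noRelation _ (hT.noRelation_addTop hd x)
  rw [bd_pt, bdL_ofFn, map_sum, degL, onList_ofFn]
  rw [Fin.sum_univ_succ] at h
  simp only [map_smul, ev_pt, relL, onList_ofFn, smul_eq_mul]
  have h1 : (fun a => addTop (fun i => T.vec (d + 1) (x i)) (Fin.succAbove 0 a)) =
      fun i => T.vec (d + 1) (x i) := by
    funext a; simp [addTop]
  have h2 : ∀ i : Fin (d + 2), (fun a => addTop (fun i => T.vec (d + 1) (x i))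
      (i.succ.succAbove a)) = addTop fun a => T.vec (d + 1) (x (i.succAbove a)) := by
    intro i; funext a
    refine Fin.cases ?_ (fun a => ?_) a <;> simp [addTop]
  simp only [h1, h2, Fin.val_zero, pow_zero, one_mul, Fin.val_succ, pow_succ, mul_neg_one,
    neg_mul, sum_neg_distrib] at h
  linarith

/-- No coordinate below `d` is of constant sign on the list. -/
def Mixed (T : Tower G k) (d : ℕ) (l : List G) : Prop :=
  ∀ i < d, ¬ (∀ x ∈ l, 0 < T.Y i x) ∧ ¬ (∀ x ∈ l, T.Y i x < 0)

theorem mixed_of_degL {d : ℕ} {l : List G} (h : T.degL d l ≠ 0) : T.Mixed d l := by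
  have hl : l.length = d + 1 := by by_contra h'; exact h (onList_of_length_ne h')
  obtain ⟨x, rfl⟩ := exists_ofFn_of_length hl
  rw [degL, onList_ofFn] at h
  refine fun i hi => ⟨fun H => h ?_, fun H => h ?_⟩
  · have H' : ∀ j, 0 < T.Y i (x j) := fun j => H _ (List.mem_ofFn.mpr ⟨j, rfl⟩)
    refine deg_eq_zero_of_coord ⟨i, hi⟩ 1 (fun j => ?_) ⟨0, ?_⟩
    · simpa [vec] using (H' j).le
    · simpa [vec] using (H' 0).ne'
  · have H' : ∀ j, T.Y i (x j) < 0 := fun j => H _ (List.mem_ofFn.mpr ⟨j, rfl⟩)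
    refine deg_eq_zero_of_coord ⟨i, hi⟩ (-1) (fun j => ?_) ⟨0, ?_⟩
    · simpa [vec] using (H' j).le
    · simpa [vec] using (H' 0).ne

theorem mixed_of_relL {d : ℕ} {l : List G} (h : T.relL d l ≠ 0) : T.Mixed d l := by
  have hl : l.length = d + 1 := by by_contra h'; exact h (onList_of_length_ne h')
  obtain ⟨x, rfl⟩ := exists_ofFn_of_length hl
  rw [relL, onList_ofFn] at h
  have hne : ∀ i (hi : i < d), (Pi.single (Fin.last d) (1 : ℝ) : Fin (d + 1) → ℝ)
      (Fin.castSucc ⟨i, hi⟩) = 0 := fun i hi => by simp [Fin.ext_iff, hi.ne]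
  refine fun i hi => ⟨fun H => h ?_, fun H => h ?_⟩
  · have H' : ∀ j, 0 < T.Y i (x j) := fun j => H _ (List.mem_ofFn.mpr ⟨j, rfl⟩)
    refine deg_eq_zero_of_coord (Fin.castSucc ⟨i, hi⟩) 1 (fun j => ?_) ⟨Fin.succ 0, ?_⟩
    · refine Fin.cases ?_ (fun j => ?_) j
      · simp only [addTop, Fin.cons_zero, hne, mul_zero, le_refl]
      · simpa [addTop, vec] using (H' j).le
    · simpa [addTop, vec] using (H' 0).ne'
  · have H' : ∀ j, T.Y i (x j) < 0 := fun j => H _ (List.mem_ofFn.mpr ⟨j, rfl⟩)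
    refine deg_eq_zero_of_coord (Fin.castSucc ⟨i, hi⟩) (-1) (fun j => ?_) ⟨Fin.succ 0, ?_⟩
    · refine Fin.cases ?_ (fun j => ?_) j
      · simp only [addTop, Fin.cons_zero, hne, mul_zero, le_refl]
      · simpa [addTop, vec] using (H' j).le
    · simpa [addTop, vec] using (H' 0).ne

theorem relL_eq_zero {d : ℕ} {l : List G} (h : ∀ x ∈ l, 0 < T.Y d x) : T.relL d l = 0 := by
  by_cases hl : l.length = d + 1
  · obtain ⟨x, rfl⟩ := exists_ofFn_of_length hl
    rw [relL, onList_ofFn]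
    have H' : ∀ j, 0 < T.Y d (x j) := fun j => h _ (List.mem_ofFn.mpr ⟨j, rfl⟩)
    refine deg_eq_zero_of_coord (Fin.last d) 1 (fun j => ?_) ⟨0, by simp [addTop]⟩
    refine Fin.cases ?_ (fun j => ?_) j
    · simp [addTop]
    · simpa [addTop, vec] using (H' j).le
  · exact onList_of_length_ne hl

theorem relL_eq_degL {d : ℕ} {l : List G} (h : ∀ x ∈ l, T.Y d x < 0) :
    T.relL d l = (-1) ^ (d + 1) * T.degL d l := by
  by_cases hl : l.length = d + 1
  · obtain ⟨x, rfl⟩ := exists_ofFn_of_length hl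
    rw [relL, degL, onList_ofFn, onList_ofFn, deg_addTop]
    · rfl
    · exact fun i => h _ (List.mem_ofFn.mpr ⟨i, rfl⟩)
  · rw [relL, degL, onList_of_length_ne hl, onList_of_length_ne hl, mul_zero]

variable (T)

theorem gen_unique {d : ℕ} (hd : d < k) {c c' : ℤ} {h h' : G} (hh : h ∈ T.K d) (hh' : h' ∈ T.K d)
    (e : T.t d ^ c * h = T.t d ^ c' * h') : c = c' ∧ h = h' := by
  have h1 := congrArg (T.Y d) e
  rw [T.Y_zpow hd, T.Y_zpow hd, ← mul_one h, ← mul_one h', T.Y_K d _ hh d le_rfl hd,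
    T.Y_K d _ hh' d le_rfl hd] at h1
  have h2 : (c : ℝ) = c' := mul_right_cancel₀ T.p_pos.ne' (add_left_cancel h1)
  have h3 : c = c' := by exact_mod_cast h2
  subst h3
  exact ⟨rfl, mul_left_cancel e⟩

/-- The next stage of the filtration as a product set. -/
noncomputable def prodEquiv {d : ℕ} (hd : d < k) : ℤ × T.K d ≃ T.K (d + 1) :=
  Equiv.ofBijective (fun q => ⟨T.t d ^ q.1 * q.2, (T.K (d + 1)).mul_mem
    (Subgroup.zpow_mem _ (T.t_mem d hd) _) (T.mono d q.2.2)⟩) (by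
    constructor
    · rintro ⟨c, h, hh⟩ ⟨c', h', hh'⟩ e
      obtain ⟨rfl, rfl⟩ := T.gen_unique hd hh hh' (Subtype.ext_iff.mp e)
      rfl
    · rintro ⟨g, hg⟩
      obtain ⟨c, h, hh, rfl⟩ := T.gen d hd g hg
      exact ⟨⟨c, h, hh⟩, rfl⟩)

theorem prodEquiv_inv {d : ℕ} (hd : d < k) (q : ℤ × T.K d) (x : G) :
    ((T.prodEquiv hd q : G))⁻¹ * x = (q.2 : G)⁻¹ * (T.t d ^ (-q.1) * x) := by
  change (T.t d ^ q.1 * q.2)⁻¹ * x = _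
  rw [mul_inv_rev, zpow_neg, mul_assoc]

/-- Only finitely many translates of a list have mixed coordinates. -/
theorem finite_mixed {d : ℕ} (hd : d ≤ k) {l : List G} (hl : l ≠ []) :
    {h : T.K d | T.Mixed d (l.map fun x => (h : G)⁻¹ * x)}.Finite := by
  induction d generalizing l with
  | zero =>
    have : Finite (T.K 0) := by rw [T.K_zero]; infer_instance
    exact Set.toFinite _
  | succ d ih =>
    have hdk : d < k := hd
    refine Set.Finite.of_preimage ?_ (T.prodEquiv hdk).surjective
    obtain ⟨x0, hx0⟩ := List.exists_mem_of_ne_nil l hl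
    have hp := T.p_pos
    obtain ⟨M, hM⟩ : ∃ M : ℕ, ∀ x ∈ l, |T.Y d x| < M * T.p := by
      clear hx0 hl
      induction l with
      | nil => exact ⟨0, by simp⟩
      | cons x l ihl =>
        obtain ⟨M, hM⟩ := ihl
        obtain ⟨M', hM'⟩ := exists_nat_gt (|T.Y d x| / T.p)
        rw [div_lt_iff₀ hp] at hM'
        refine ⟨max M M', ?_⟩
        simp only [List.mem_cons, forall_eq_or_imp]
        have h1 : (M : ℝ) ≤ (max M M' : ℕ) := by exact_mod_cast le_max_left _ _
        have h2 : (M' : ℝ) ≤ (max M M' : ℕ) := by exact_mod_cast le_max_right _ _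
        exact ⟨hM'.trans_le (mul_le_mul_of_nonneg_right h2 hp.le),
          fun y hy => (hM y hy).trans_le (mul_le_mul_of_nonneg_right h1 hp.le)⟩
    have hfin : (⋃ c ∈ Set.Icc (-(M : ℤ)) M, (fun h : T.K d => (c, h)) ''
        {h : T.K d | T.Mixed d ((l.map fun x => T.t d ^ (-c) * x).map
          fun x => (h : G)⁻¹ * x)}).Finite :=
      (Set.finite_Icc _ _).biUnion fun c _ => (ih hdk.le (by simpa using hl)).image _
    refine hfin.subset fun q hq => ?_
    have hq' : T.Mixed (d + 1) ((l.map fun x => T.t d ^ (-q.1) * x).map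
        fun x => (q.2 : G)⁻¹ * x) := by
      simp only [Set.mem_preimage, Set.mem_ofPred_eq, prodEquiv_inv] at hq
      simpa [Function.comp_def] using hq
    have hY : ∀ x, T.Y d ((q.2 : G)⁻¹ * (T.t d ^ (-q.1) * x)) = T.Y d x - q.1 * T.p := by
      intro x
      rw [T.Y_K d _ ((T.K d).inv_mem q.2.2) d le_rfl hdk, T.Y_zpow hdk]
      push_cast; ring
    obtain ⟨h1, h2⟩ := hq' d (Nat.lt_succ_self d)
    simp only [List.map_map, List.mem_map, Function.comp_apply, forall_exists_index, and_imp,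
      forall_apply_eq_imp_iff₂, hY, not_forall, not_lt] at h1 h2
    obtain ⟨x, hx, h1⟩ := h1
    obtain ⟨y, hy, h2⟩ := h2
    refine Set.mem_biUnion (x := q.1) ⟨?_, ?_⟩ ⟨q.2, fun i hi => hq' i (by omega), rfl⟩
    · have := (abs_lt.mp (hM x hx)).1
      have h3 : (-(M : ℝ)) * T.p < q.1 * T.p := by linarith
      have h4 : (-(M : ℝ)) < q.1 := lt_of_mul_lt_mul_right h3 hp.le
      exact_mod_cast h4.le
    · have := (abs_lt.mp (hM y hy)).2
      have h3 : q.1 * T.p < (M : ℝ) * T.p := by linarith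
      have h4 : (q.1 : ℝ) < M := lt_of_mul_lt_mul_right h3 hp.le
      exact_mod_cast h4.le

/-- Summation of a cochain over the translates by `K d`. -/
noncomputable def avg (d : ℕ) (F : List G → ℤ) (l : List G) : ℤ :=
  ∑ᶠ h : T.K d, F (l.map fun x => (h : G)⁻¹ * x)

variable {T}

theorem avg_inv {d : ℕ} {F : List G → ℤ} (hF : F [] = 0) : InvFun (T.K d) (T.avg d F) := by
  refine ⟨fun g hg l => ?_, by simp [avg, hF]⟩
  unfold avg
  rw [← finsum_comp_equiv (Equiv.mulLeft (⟨g, hg⟩ : T.K d))]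
  refine finsum_congr fun h => ?_
  simp [Function.comp_def, mul_assoc]

theorem support_finite {d : ℕ} (hd : d ≤ k) {F : List G → ℤ} (hF : F [] = 0)
    (hm : ∀ l, F l ≠ 0 → T.Mixed d l) (l : List G) :
    (Function.support fun h : T.K d => F (l.map fun x => (h : G)⁻¹ * x)).Finite := by
  by_cases hl : l = []
  · simp [hl, hF]
  · exact (T.finite_mixed hd hl).subset fun h hh => hm _ hh

theorem ev_avg {d : ℕ} (hd : d ≤ k) {F : List G → ℤ} (hF : F [] = 0)
    (hm : ∀ l, F l ≠ 0 → T.Mixed d l) (c : Chain G) :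
    ev (T.avg d F) c = ∑ᶠ h : T.K d, ev F (lm (h : G)⁻¹ c) := by
  unfold avg
  rw [ev_finsum (P := fun _ => True) (by simp [Supp]) _ fun l _ => support_finite hd hF hm l]
  refine finsum_congr fun h => ?_
  rw [lm, ev_mapL]

theorem avg_degL_succ (hT : T.Generic) {d : ℕ} (hd : d < k) {l : List G} (hl : l.length = d + 2) :
    T.avg d (T.degL (d + 1)) l = ev (T.avg d (T.relL d)) (bd (pt l)) := by
  rw [ev_avg hd.le (relL_nil d) (fun l => mixed_of_relL)]
  refine finsum_congr fun h => ?_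
  rw [degL_succ hT hd (by simpa using hl), lm, ← bd_mapL, mapL_pt]

theorem avg_degL_succ_eq (hT : T.Generic) {d : ℕ} (hd : d < k) {l : List G}
    (hl : l.length = d + 2) : T.avg (d + 1) (T.degL (d + 1)) l =
      ∑ᶠ c : ℤ, ev (T.avg d (T.relL d)) (bd (pt (l.map fun x => T.t d ^ (-c) * x))) := by
  have hs := support_finite (T := T) (d := d + 1) hd (degL_nil (d + 1)) (fun l => mixed_of_degL) l
  have h1 : T.avg (d + 1) (T.degL (d + 1)) l = ∑ᶠ q : ℤ × T.K d,
      T.degL (d + 1) (l.map fun x => (T.prodEquiv hd q : G)⁻¹ * x) :=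
    (finsum_comp_equiv (T.prodEquiv hd)).symm
  rw [h1, finsum_curry _ (hs.preimage (T.prodEquiv hd).injective.injOn)]
  refine finsum_congr fun c => ?_
  rw [← avg_degL_succ hT hd (by simpa using hl)]
  refine finsum_congr fun h => ?_
  simp only [prodEquiv_inv, List.map_map, Function.comp_def]

theorem finite_support_c (hT : T.Generic) {d : ℕ} (hd : d < k) {l : List G}
    (hl : l.length = d + 2) : (Function.support fun c : ℤ =>
      ev (T.avg d (T.relL d)) (bd (pt (l.map fun x => T.t d ^ (-c) * x)))).Finite := by
  have hs := support_finite (T := T) (d := d + 1) hd (degL_nil (d + 1)) (fun l => mixed_of_degL) l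
  refine ((hs.preimage (T.prodEquiv hd).injective.injOn).image Prod.fst).subset fun c hc => ?_
  simp only [Function.mem_support] at hc
  rw [← avg_degL_succ hT hd (by simpa using hl)] at hc
  obtain ⟨h, hh⟩ : ∃ h : T.K d,
      T.degL (d + 1) ((l.map fun x => T.t d ^ (-c) * x).map fun x => (h : G)⁻¹ * x) ≠ 0 := by
    by_contra! h
    exact hc (finsum_eq_zero_of_forall_eq_zero h)
  refine ⟨(c, h), ?_, rfl⟩
  simp only [Set.mem_preimage, Function.mem_support, prodEquiv_inv]
  simpa [Function.comp_def] using hh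

/-- The half-spaces in which the higher coordinates are negative. -/
def neg (T : Tower G k) (d : ℕ) : Set G := {x | ∀ e, d ≤ e → e < k → T.Y e x < 0}

theorem mul_mem_neg {d : ℕ} {g x : G} (hg : g ∈ T.K d) (hx : x ∈ T.neg d) : g * x ∈ T.neg d :=
  fun e he hek => by rw [T.Y_K d g hg e he hek]; exact hx e he hek

/-- Existence of a cycle modulo `K d` on which the averaged degree cochain is a unit. -/
theorem exists_cycle (hT : T.Generic) (hne : (T.neg 0).Nonempty) {d : ℕ} (hd : d ≤ k) :
    ∃ a ∈ Ch (T.neg d) (d + 1), bd a ∈ Ann (T.K d) ∧ IsUnit (ev (T.avg d (T.degL d)) a) := by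
  induction d with
  | zero =>
    obtain ⟨x, hx⟩ := hne
    refine ⟨pt [x], pt_mem_supp ⟨rfl, by simpa using hx⟩, fun F hF => ?_, ?_⟩
    · simp [bdL, hF.2]
    · have h0 : ∀ l : List G, l.length = 1 → T.degL 0 l = 1 := by
        intro l hl
        obtain ⟨x, rfl⟩ := exists_ofFn_of_length hl
        rw [degL, onList_ofFn]
        simp [deg, signedMinor]
      have h1 : (ev (T.avg 0 (T.degL 0)) (pt [x])) = 1 := by
        rw [ev_pt, avg, finsum_congr (g := fun _ => (1 : ℤ)) fun h => h0 _ (by simp)]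
        have : Unique (T.K 0) := by rw [T.K_zero]; infer_instance
        rw [finsum_unique]
      rw [h1]; exact isUnit_one
  | succ d ih =>
    have hdk : d < k := hd
    obtain ⟨b, hbS, hbc, hbu⟩ := ih hdk.le
    have hsub : T.neg d ⊆ T.neg (d + 1) := fun x hx e he hek => hx e (by omega) hek
    have hne' : (T.neg (d + 1)).Nonempty := by
      obtain ⟨x, hx⟩ := hne; exact ⟨x, fun e _ hek => hx e (Nat.zero_le _) hek⟩
    have hne'' : (T.neg d).Nonempty := by
      obtain ⟨x, hx⟩ := hne; exact ⟨x, fun e _ hek => hx e (Nat.zero_le _) hek⟩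
    have hbS' : b ∈ Ch (T.neg (d + 1)) (d + 1) :=
      supp_mono (fun l hl => ⟨hl.1, fun x hx => hsub (hl.2 x hx)⟩) hbS
    have := T.normal d
    obtain ⟨a, ha, hab⟩ := T.translate hdk.le hne'
      (fun g hg x hx => mul_mem_neg (T.mono d hg) hx)
      (fun x hx => mul_mem_neg (T.t_mem d hdk) hx) hbS' hbc
    set W := T.avg d (T.relL d) with hW
    have hWi : InvFun (T.K d) W := avg_inv (relL_nil d)
    refine ⟨a, ha, ?_, ?_⟩
    · have h1 := lm_sub_mem_ann (T.t_mem d hdk) b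
      have := Submodule.sub_mem _ h1 (ann_mono (T.mono d) hab)
      simpa using this
    have key : ev (T.avg (d + 1) (T.degL (d + 1))) a =
        ∑ᶠ c : ℤ, ev W (lm (T.t d ^ (-c)) (bd a)) := by
      rw [ev_congr ha fun l hl => avg_degL_succ_eq hT hdk hl.1,
        ev_finsum ha _ fun l hl => finite_support_c hT hdk hl.1]
      refine finsum_congr fun c => ?_
      rw [lm, ← bd_mapL, ev_linear, ev_mapL]
    set A : ℤ → ℤ := fun j => ev W (lm (T.t d ^ j) b) with hA
    have h1 : ∀ c : ℤ, ev W (lm (T.t d ^ (-c)) (bd a)) = A (1 - c) - A (-c) := by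
      intro c
      have h := lm_ann (T.t d ^ (-c)) hab W hWi
      simp only [map_sub, lm_lm] at h
      have e : T.t d ^ (-c) * T.t d = T.t d ^ (1 - c) := by
        rw [← zpow_add_one]; congr 1; ring
      rw [e] at h
      simp only [hA]
      linarith
    have h2 : ∀ j ≤ 0, A j = A 0 := by
      intro j hj
      have hg : ∀ x ∈ T.neg d, T.t d ^ j * x ∈ T.neg d := by
        intro x hx e he hek
        rcases he.eq_or_lt with rfl | he
        · rw [T.Y_zpow hdk]
          have h3 : (j : ℝ) ≤ 0 := by exact_mod_cast hj
          have := hx d le_rfl hek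
          have := mul_nonpos_of_nonpos_of_nonneg h3 T.p_pos.le
          linarith
        · rw [T.Y_K (d + 1) _ (Subgroup.zpow_mem _ (T.t_mem d hdk) _) e he hek]
          exact hx e he.le hek
      obtain ⟨e, he, hbe⟩ := T.translate hdk.le hne'' (fun g hg x hx => mul_mem_neg hg hx) hg
        hbS hbc
      have h3 := hbe W hWi
      have h4 : ev W (bd e) = 0 := by
        rw [ev_linear, ev_congr (F' := fun _ => 0) he]
        · rw [show (fun _ : List G => (0 : ℤ)) = 0 from rfl]; simp [ev]
        · intro l hl
          rw [← avg_degL_succ hT hdk hl.1]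
          refine finsum_eq_zero_of_forall_eq_zero fun h => ?_
          by_contra h5
          refine (mixed_of_degL h5 d (Nat.lt_succ_self d)).2 fun x hx => ?_
          obtain ⟨y, hy, rfl⟩ := List.mem_map.mp hx
          exact mul_mem_neg ((T.K d).inv_mem h.2) (hl.2 y hy) d le_rfl hdk
      simp only [map_sub, h4, sub_zero] at h3
      simp only [hA, zpow_zero, lm_one]
      linarith
    have hYi : ∀ (h : T.K d) (j : ℤ) x, T.Y d ((h : G)⁻¹ * (T.t d ^ j * x)) =
        T.Y d x + j * T.p := fun h j x => by
      rw [T.Y_K d _ ((T.K d).inv_mem h.2) d le_rfl hdk, T.Y_zpow hdk]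
    obtain ⟨N, h3⟩ : ∃ N : ℕ, ∀ j : ℤ, N ≤ j → A j = 0 := by
      obtain ⟨N, hN⟩ : ∃ N : ℕ, ∀ l ∈ b.support, ∀ x ∈ l, 0 < T.Y d x + N * T.p := by
        have hfin : (⋃ l ∈ b.support, T.Y d '' {x | x ∈ l}).Finite :=
          b.support.finite_toSet.biUnion fun l _ => (List.finite_toSet l).image _
        obtain ⟨M, hM⟩ := hfin.bddBelow
        obtain ⟨N, hN⟩ := exists_nat_gt (-M / T.p)
        rw [div_lt_iff₀ T.p_pos] at hN
        refine ⟨N, fun l hl x hx => ?_⟩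
        have := hM (Set.mem_biUnion hl ⟨x, hx, rfl⟩)
        linarith
      refine ⟨N, fun j hj => ?_⟩
      simp only [hA]
      rw [lm, ev_mapL, ev, Finsupp.linearCombination_apply]
      refine Finset.sum_eq_zero fun l hl => ?_
      have : W (l.map fun x => T.t d ^ j * x) = 0 := by
        refine finsum_eq_zero_of_forall_eq_zero fun h => relL_eq_zero fun x hx => ?_
        simp only [List.map_map, List.mem_map, Function.comp_apply] at hx
        obtain ⟨y, hy, rfl⟩ := hx
        rw [hYi]
        have h4 := hN l hl y hy
        have h5 : (N : ℝ) ≤ j := by exact_mod_cast hj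
        have := mul_le_mul_of_nonneg_right h5 T.p_pos.le
        linarith
      simp [this]
    have h4 : A 0 = (-1) ^ (d + 1) * ev (T.avg d (T.degL d)) b := by
      simp only [hA, zpow_zero, lm_one]
      rw [ev_congr (F' := fun l => (-1) ^ (d + 1) * T.avg d (T.degL d) l) hbS]
      · have : ev (fun l => (-1) ^ (d + 1) * T.avg d (T.degL d) l) =
            ((-1 : ℤ) ^ (d + 1)) • ev (T.avg d (T.degL d)) :=
          hom_ext_chain _ _ fun l => by simp
        rw [this]; simp
      · intro l hl
        simp only [hW, avg]
        rw [← smul_eq_mul, smul_finsum]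
        refine finsum_congr fun h => ?_
        rw [smul_eq_mul, relL_eq_degL]
        intro x hx
        obtain ⟨y, hy, rfl⟩ := List.mem_map.mp hx
        exact mul_mem_neg ((T.K d).inv_mem h.2) (hl.2 y hy) d le_rfl hdk
    rw [key, finsum_congr h1, finsum_telescope A N h2 h3, h4]
    exact ((isUnit_neg_one.pow _).mul hbu).neg

end Tower

theorem ev_chainMap_eq_zero {G Z : Type*} [Group G] {K : Subgroup G} (act : G → Z → Z)
    {V : ℕ → G → Z} (hV : ∀ n g x, V n (g * x) = act g (V n x))
    {D : ℕ → Chain G →ₗ[ℤ] Chain Z} (h0 : D 0 (pt []) = 0)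
    (hD : ∀ n (l : List G), l.length = n + 1 → bd (D (n + 1) (pt l)) = D n (bd (pt l)))
    (hDe : ∀ g n c, mapL (act g) (D n c) = D n (lm g c))
    {f : List Z → ℤ} (hf : ∀ g ∈ K, ∀ l, f (l.map (act g)) = f l) {L : ℕ} {z : Chain G}
    (hz : z ∈ Ch Set.univ (L + 1)) (hbz : bd z ∈ Ann K)
    (hcoc : ev f (bd (coneHtpy V D (L + 1) z)) = 0) : ev f (D (L + 1) z) = 0 := by
  have h1 := eq_of_supp hz (bd ∘ₗ coneHtpy V D (L + 1))
    (D (L + 1) - coneHtpy V D L ∘ₗ bd) fun l hl => by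
      simpa using bd_coneHtpy_pt h0 hD L l hl.1
  simp only [LinearMap.comp_apply, LinearMap.sub_apply] at h1
  rw [h1, map_sub, ev_linear (coneHtpy V D L)] at hcoc
  have h2 := hbz (fun l => ev f (coneHtpy V D L (pt l))) ⟨fun g hg l => by
    have := mapL_coneHtpy (V := V) (V' := V) (D := D) (D' := D) (a := fun x => g * x)
      (b := act g) (fun n x => (hV n g x).symm) (fun n c => hDe g n c) L (pt l)
    rw [mapL_pt] at this
    change ev f (coneHtpy V D L (pt (l.map _))) = _
    rw [← this, ev_mapL]
    simp only [hf g hg], by simp [coneHtpy_nil]⟩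
  rw [h2, sub_zero] at hcoc
  exact hcoc

namespace Tower
variable {G : Type*} [Group G] {k : ℕ} {T : Tower G k}

theorem degL_bd (hT : T.Generic) (c : Chain G) : ev (T.degL k) (bd c) = 0 := by
  have : ev (T.degL k) ∘ₗ bd = 0 := hom_ext_chain _ _ fun l => by
    by_cases hl : l.length = k + 2
    · obtain ⟨x, rfl⟩ := exists_ofFn_of_length hl
      have h := sum_deg_of_noRelation _ (hT.noRelation le_rfl x)
      simp only [LinearMap.comp_apply, bd_pt, bdL_ofFn, map_sum, map_smul, ev_pt, degL,
        onList_ofFn, smul_eq_mul, LinearMap.zero_apply]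
      exact h
    · have h1 := bd_mem (mem_ch_univ (l := l))
      simp only [LinearMap.comp_apply, LinearMap.zero_apply]
      rw [ev_congr (F' := fun _ => 0) h1]
      · rw [show (fun _ : List G => (0 : ℤ)) = 0 from rfl]; simp [ev]
      · intro s hs
        refine onList_of_length_ne ?_
        have := hs.1
        rcases l with _ | ⟨x, l⟩
        · simp at this; simp [this]
        · simp at this hl; omega
  exact LinearMap.congr_fun this c

/-- The averaged degree is unchanged by subdivision. -/
theorem ev_avg_subdiv (hT : T.Generic) {z : Chain G} (hz : z ∈ Ch Set.univ (k + 1))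
    (hb : bd z ∈ Ann (T.K k)) :
    ev (T.avg k (T.degL k)) (subdiv (fun _ x => x) (k + 1) z) = ev (T.avg k (T.degL k)) z := by
  let D : ℕ → Chain G →ₗ[ℤ] Chain G := fun n => LinearMap.id - subdiv (fun _ x => x) n
  have h := ev_chainMap_eq_zero (K := T.K k) (fun g x => g * x) (V := fun _ x => x) (D := D)
    (fun _ _ _ => rfl) (by simp [D, subdiv])
    (fun n l hl => by
      simp only [D, LinearMap.sub_apply, LinearMap.id_apply, map_sub]
      rw [bd_subdiv_pt _ n l hl])
    (fun g n c => by
      simp only [D, LinearMap.sub_apply, LinearMap.id_apply, map_sub]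
      rw [mapL_subdiv (v' := fun _ x => x) (a := fun x => g * x) (fun _ _ => rfl)])
    (f := T.avg k (T.degL k)) (fun g hg l => (avg_inv (degL_nil k)).1 g hg l) hz hb (by
      rw [ev_avg le_rfl (degL_nil k) (fun l => mixed_of_degL)]
      refine finsum_eq_zero_of_forall_eq_zero fun h => ?_
      rw [lm, ← bd_mapL, degL_bd hT])
  simp only [D, LinearMap.sub_apply, LinearMap.id_apply, map_sub] at h
  linarith

end Tower

/-! ### Positions -/

/-- Matrix positions of the unipotent radical of the block upper triangular subgroup with blocks
of sizes `2, 1, …, 1`. -/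
def IsPos {n : ℕ} (i j : Fin n) : Prop := i < j ∧ 2 ≤ (j : ℕ)

instance {n : ℕ} (i j : Fin n) : Decidable (IsPos i j) := inferInstanceAs (Decidable (_ ∧ _))

/-- Positions ordered by row, then by decreasing column. -/
abbrev PosType (n : ℕ) : Type :=
  {q : Lex (Fin n × (Fin n)ᵒᵈ) // IsPos (ofLex q).1 (OrderDual.ofDual (ofLex q).2)}

noncomputable instance (n : ℕ) : Fintype (PosType n) := Fintype.ofFinite _

/-- The number of positions. -/
noncomputable def numPos (n : ℕ) : ℕ := Fintype.card (PosType n)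

noncomputable def posIso (n : ℕ) : Fin (numPos n) ≃o PosType n :=
  Fintype.orderIsoFinOfCardEq (PosType n) rfl

section Pos
variable {n : ℕ}

/-- The row of a position. -/
noncomputable def row (i : Fin (numPos n)) : Fin n := (ofLex (posIso n i).1).1
/-- The column of a position. -/
noncomputable def col (i : Fin (numPos n)) : Fin n := OrderDual.ofDual (ofLex (posIso n i).1).2

theorem isPos (i : Fin (numPos n)) : IsPos (row i) (col i) := (posIso n i).2

theorem row_lt_col (i : Fin (numPos n)) : row i < col i := (isPos i).1

theorem exists_pos {a b : Fin n} (h : IsPos a b) : ∃ i, row i = a ∧ col i = b := by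
  obtain ⟨i, hi⟩ := (posIso n).surjective ⟨toLex (a, OrderDual.toDual b), h⟩
  exact ⟨i, by simp [row, hi], by simp [col, hi]⟩

theorem pos_injective {i j : Fin (numPos n)} (h : row i = row j) (h' : col i = col j) : i = j := by
  apply (posIso n).injective
  apply Subtype.ext
  apply ofLex.injective
  exact Prod.ext h h'

theorem pos_mono {i j : Fin (numPos n)} (h : row i ≤ row j) (h' : col j ≤ col i) : i ≤ j := by
  rw [← (posIso n).le_iff_le, ← Subtype.coe_le_coe, Prod.Lex.le_iff]
  rcases h.lt_or_eq with h | h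
  · exact Or.inl h
  · exact Or.inr ⟨h, h'⟩

theorem numPos_eq (hn : 2 ≤ n) : numPos n = n * (n - 1) / 2 - 1 := by
  have h1 : numPos n = ∑ j : Fin n, if 2 ≤ (j : ℕ) then (j : ℕ) else 0 := by
    have e : PosType n ≃ Σ j : Fin n, {i : Fin n // IsPos i j} :=
      { toFun := fun q => ⟨OrderDual.ofDual (ofLex q.1).2, (ofLex q.1).1, q.2⟩
        invFun := fun s => ⟨toLex (s.2.1, OrderDual.toDual s.1), s.2.2⟩
        left_inv := fun _ => rfl
        right_inv := fun _ => rfl }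
    rw [numPos, Fintype.card_congr e, Fintype.card_sigma]
    refine Finset.sum_congr rfl fun j _ => ?_
    split_ifs with hj
    · rw [Fintype.card_subtype]
      have : (univ.filter fun i => IsPos i j) = Finset.Iio j := by
        ext i; simp [IsPos, hj]
      rw [this, Fin.card_Iio]
    · rw [Fintype.card_eq_zero_iff]
      exact ⟨fun i => hj i.2.2⟩
  rw [h1, Fin.sum_univ_eq_sum_range (fun j => if 2 ≤ j then j else 0), ← Finset.sum_range_id]
  obtain ⟨m, rfl⟩ := Nat.exists_eq_add_of_le hn
  rw [Finset.sum_range_add, Finset.sum_range_add]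
  simp [Finset.sum_range_succ]

end Pos

end CodimOne

namespace CodimOne
open Finset Matrix

section Radical
variable {n : ℕ}

/-- Matrices agreeing with the identity outside the positions. -/
def UniPat (A : Matrix (Fin n) (Fin n) ℤ) : Prop :=
  ∀ i j, ¬ IsPos i j → A i j = (1 : Matrix (Fin n) (Fin n) ℤ) i j

theorem UniPat.apply_self {A : Matrix (Fin n) (Fin n) ℤ} (h : UniPat A) (i : Fin n) :
    A i i = 1 := by
  rw [h i i (fun h => h.1.false), one_apply_eq]

theorem UniPat.isPos {A : Matrix (Fin n) (Fin n) ℤ} (h : UniPat A) {i j : Fin n} (hij : i ≠ j)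
    (hA : A i j ≠ 0) : IsPos i j := by
  by_contra h'; exact hA (by rw [h i j h', one_apply_ne hij])

theorem UniPat.le {A : Matrix (Fin n) (Fin n) ℤ} (h : UniPat A) {i j : Fin n} (hA : A i j ≠ 0) :
    i ≤ j := by
  by_cases hij : i = j
  · exact hij.le
  · exact (h.isPos hij hA).1.le

theorem UniPat.one : UniPat (1 : Matrix (Fin n) (Fin n) ℤ) := fun _ _ _ => rfl

theorem UniPat.mul {A B : Matrix (Fin n) (Fin n) ℤ} (hA : UniPat A) (hB : UniPat B) :
    UniPat (A * B) := by
  intro i j hij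
  rw [mul_apply, Finset.sum_eq_single i, hA.apply_self, one_mul, hB i j hij]
  · intro c _ hc
    by_contra h
    have h1 := hA.isPos (Ne.symm hc) (left_ne_zero_of_mul h)
    by_cases hcj : c = j
    · exact hij (hcj ▸ h1)
    · have h2 := hB.isPos hcj (right_ne_zero_of_mul h)
      exact hij ⟨h1.1.trans h2.1, h2.2⟩
  · simp

/-- The integral unipotent radical of level `p`. -/
def radical (n p : ℕ) : Subgroup (SpecialLinearGroup (Fin n) ℤ) where
  carrier := {x | x ∈ congruenceSubgroup n p ∧ UniPat x.1 ∧ UniPat (x⁻¹).1}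
  one_mem' := ⟨Subgroup.one_mem _, UniPat.one, by rw [inv_one]; exact UniPat.one⟩
  mul_mem' {a b} ha hb := ⟨Subgroup.mul_mem _ ha.1 hb.1, ha.2.1.mul hb.2.1, by
    rw [_root_.mul_inv_rev]; exact hb.2.2.mul ha.2.2⟩
  inv_mem' {a} ha := ⟨Subgroup.inv_mem _ ha.1, ha.2.2, by rw [inv_inv]; exact ha.2.1⟩

theorem dvd_of_mem_congruence {p : ℕ} {x : SpecialLinearGroup (Fin n) ℤ}
    (hx : x ∈ congruenceSubgroup n p) (i j : Fin n) :
    ((x : Matrix (Fin n) (Fin n) ℤ) i j : ZMod p) = (1 : Matrix (Fin n) (Fin n) (ZMod p)) i j := by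
  have : SpecialLinearGroup.map (Int.castRingHom (ZMod p)) x = 1 := hx
  have h := congrArg (fun y : SpecialLinearGroup (Fin n) (ZMod p) => y i j) this
  simpa using h

theorem mem_congruence_iff {p : ℕ} {x : SpecialLinearGroup (Fin n) ℤ} :
    x ∈ congruenceSubgroup n p ↔ ∀ i j, ((x : Matrix (Fin n) (Fin n) ℤ) i j : ZMod p) =
      (1 : Matrix (Fin n) (Fin n) (ZMod p)) i j := by
  refine ⟨fun h => dvd_of_mem_congruence h, fun h => ?_⟩
  change SpecialLinearGroup.map (Int.castRingHom (ZMod p)) x = 1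
  ext i j
  simpa using h i j

variable {p : ℕ}

/-- The matrix of the inverse. -/
def im (x : radical n p) : Matrix (Fin n) (Fin n) ℤ :=
  ((x : SpecialLinearGroup (Fin n) ℤ)⁻¹).1

theorem im_uniPat (x : radical n p) : UniPat (im x) := x.2.2.2

theorem im_mul (x y : radical n p) : im (x * y) = im y * im x := by
  rw [im, Subgroup.coe_mul, _root_.mul_inv_rev]
  rfl

theorem im_one : im (1 : radical n p) = 1 := by rw [im, Subgroup.coe_one, inv_one]; rfl

theorem im_injective : Function.Injective (im : radical n p → Matrix (Fin n) (Fin n) ℤ) := by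
  intro x y h
  have h1 : ((x : SpecialLinearGroup (Fin n) ℤ)⁻¹) = (y : SpecialLinearGroup (Fin n) ℤ)⁻¹ :=
    Subtype.ext h
  exact Subtype.ext (inv_injective h1)

theorem dvd_im (x : radical n p) {i j : Fin n} (hij : i ≠ j) : (p : ℤ) ∣ im x i j := by
  have := dvd_of_mem_congruence (Subgroup.inv_mem _ x.2.1) i j
  rw [one_apply_ne hij] at this
  exact (ZMod.intCast_zmod_eq_zero_iff_dvd _ _).mp this

/-- Off-diagonal parts supported on the positions of index below `d`. -/
def Below (d : ℕ) (A : Matrix (Fin n) (Fin n) ℤ) : Prop :=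
  ∀ e : Fin (numPos n), d ≤ e → A (row e) (col e) = 0

theorem Below.lt {d : ℕ} {A : Matrix (Fin n) (Fin n) ℤ} (hA : UniPat A) (h : Below d A)
    {i j : Fin n} (hij : i ≠ j) (h0 : A i j ≠ 0) :
    ∃ e : Fin (numPos n), row e = i ∧ col e = j ∧ (e : ℕ) < d := by
  obtain ⟨e, rfl, rfl⟩ := exists_pos (hA.isPos hij h0)
  exact ⟨e, rfl, rfl, by by_contra h'; exact h0 (h e (by omega))⟩

theorem Below.mul_apply {d : ℕ} {A B : Matrix (Fin n) (Fin n) ℤ} (hA : UniPat A) (hB : UniPat B)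
    (h : Below d B) (e : Fin (numPos n)) (he : d ≤ e) :
    (A * B) (row e) (col e) = A (row e) (col e) := by
  rw [Matrix.mul_apply, Finset.sum_eq_single (col e), hB.apply_self, mul_one]
  · intro c _ hc
    by_contra h0
    obtain ⟨f, hf, hf', hfd⟩ := h.lt hB hc (right_ne_zero_of_mul h0)
    have : e ≤ f := pos_mono (by rw [hf]; exact hA.le (left_ne_zero_of_mul h0)) (by rw [hf'])
    have : (e : ℕ) ≤ f := this
    omega
  · simp

theorem Below.mul {d : ℕ} {A B : Matrix (Fin n) (Fin n) ℤ} (hA : UniPat A) (hB : UniPat B)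
    (h : Below d A) (h' : Below d B) : Below d (A * B) := fun e he => by
  rw [h'.mul_apply hA hB e he, h e he]

theorem Below.conj {d : ℕ} {A A' B : Matrix (Fin n) (Fin n) ℤ} (hA : UniPat A) (hA' : UniPat A')
    (hAA : A * A' = 1) (hB : UniPat B) (h : Below d B) : Below d (A * B * A') := by
  intro e he
  have h1 : A * B * A' = 1 + A * (B - 1) * A' := by
    rw [mul_sub, mul_one, sub_mul, hAA]; abel
  have h2 : (A * (B - 1) * A') (row e) (col e) = 0 := by
    simp only [Matrix.mul_apply, Finset.sum_mul]
    refine Finset.sum_eq_zero fun j _ => Finset.sum_eq_zero fun i _ => ?_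
    by_contra h0
    have hAi := hA.le (left_ne_zero_of_mul (left_ne_zero_of_mul h0))
    have hBi := right_ne_zero_of_mul (left_ne_zero_of_mul h0)
    have hA'i := hA'.le (right_ne_zero_of_mul h0)
    have hij : i ≠ j := by
      rintro rfl; exact hBi (by simp [hB.apply_self])
    rw [Matrix.sub_apply, one_apply_ne hij, sub_zero] at hBi
    obtain ⟨f, hf, hf', hfd⟩ := h.lt hB hij hBi
    have : e ≤ f := pos_mono (by rw [hf]; exact hAi) (by rw [hf']; exact hA'i)
    have : (e : ℕ) ≤ f := this
    omega
  rw [h1, Matrix.add_apply, h2, one_apply_ne (row_lt_col e).ne, add_zero]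

/-- The filtration of the radical. -/
def filt (n p d : ℕ) : Subgroup (radical n p) where
  carrier := {x | Below d (im x) ∧ Below d (im x⁻¹)}
  one_mem' := by
    have : Below d (1 : Matrix (Fin n) (Fin n) ℤ) := fun e _ => one_apply_ne (row_lt_col e).ne
    simp [im_one, this]
  mul_mem' {a b} ha hb := ⟨by rw [im_mul]; exact hb.1.mul (im_uniPat _) (im_uniPat _) ha.1, by
    rw [_root_.mul_inv_rev, im_mul]; exact ha.2.mul (im_uniPat _) (im_uniPat _) hb.2⟩
  inv_mem' {a} ha := ⟨ha.2, by rw [inv_inv]; exact ha.1⟩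

theorem below_inv {d : ℕ} {x : radical n p} (h : Below d (im x)) : Below d (im x⁻¹) := by
  intro e he
  have h1 := h.mul_apply (im_uniPat x⁻¹) (im_uniPat x) e he
  rw [← im_mul, mul_inv_cancel, im_one, one_apply_ne (row_lt_col e).ne] at h1
  exact h1.symm

theorem mem_filt {d : ℕ} {x : radical n p} : x ∈ filt n p d ↔ Below d (im x) :=
  ⟨fun h => h.1, fun h => ⟨h, below_inv h⟩⟩

theorem uniPat_transvection {i j : Fin n} (h : IsPos i j) (c : ℤ) :
    UniPat (transvection i j c) := by
  intro a b hab
  have : ¬ (i = a ∧ j = b) := by rintro ⟨rfl, rfl⟩; exact hab h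
  simp [transvection, this]

/-- The transvection at a position. -/
noncomputable def tv (e : Fin (numPos n)) (c : ℤ) : SpecialLinearGroup (Fin n) ℤ :=
  ⟨transvection (row e) (col e) c, det_transvection_of_ne _ _ (row_lt_col e).ne _⟩

theorem tv_inv (e : Fin (numPos n)) (c : ℤ) : (tv e c)⁻¹ = tv e (-c) := by
  refine inv_eq_of_mul_eq_one_right (Subtype.ext ?_)
  change transvection (row e) (col e) c * transvection (row e) (col e) (-c) = 1
  rw [transvection_mul_transvection_same _ _ (row_lt_col e).ne, add_neg_cancel, transvection_zero]

/-- The elementary generators of the radical, with inverse a transvection. -/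
noncomputable def gen (p : ℕ) (e : Fin (numPos n)) : radical n p :=
  ⟨tv e (-p), by
    refine ⟨?_, uniPat_transvection (isPos e) _, ?_⟩
    · refine mem_congruence_iff.mpr fun i j => ?_
      simp [tv, transvection, single_apply, one_apply]
    · rw [tv_inv]; exact uniPat_transvection (isPos e) _⟩

theorem im_gen (e : Fin (numPos n)) : im (gen p e) = transvection (row e) (col e) (p : ℤ) := by
  rw [im, gen, tv_inv, neg_neg]; rfl

theorem im_gen_inv (e : Fin (numPos n)) :
    im (gen p e)⁻¹ = transvection (row e) (col e) (-p : ℤ) := by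
  rw [im, Subgroup.coe_inv, inv_inv]; rfl

theorem im_gen_mul (e : Fin (numPos n)) (x : radical n p) (i : Fin n) :
    im (gen p e * x) i (col e) = im x i (col e) + im x i (row e) * p := by
  rw [im_mul, im_gen, transvection, mul_add, mul_one, Matrix.add_apply, mul_single_apply_same]

theorem gen_mem (e : Fin (numPos n)) : gen p e ∈ filt n p (e + 1) := by
  rw [mem_filt]
  intro f hf
  rw [im_gen, transvection, Matrix.add_apply, one_apply_ne (row_lt_col f).ne, zero_add,
    single_apply, if_neg]
  rintro ⟨h, h'⟩
  have := pos_injective h h'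
  subst this
  omega

theorem im_gen_zpow_mul (e : Fin (numPos n)) (c : ℤ) (x : radical n p) :
    im (gen p e ^ c * x) (row e) (col e) = im x (row e) (col e) + c * p := by
  induction c using Int.induction_on generalizing x with
  | zero => simp
  | succ i ih =>
    rw [_root_.zpow_add_one, mul_assoc, ih, im_gen_mul, (im_uniPat x).apply_self]; ring
  | pred i ih =>
    have h := im_gen_mul e ((gen p e)⁻¹ * x) (row e)
    rw [mul_inv_cancel_left, (im_uniPat _).apply_self] at h
    rw [_root_.zpow_sub_one, mul_assoc, ih, h]; ring

theorem exists_gen_mul (e : Fin (numPos n)) {g : radical n p} (hg : g ∈ filt n p (e + 1)) :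
    ∃ c : ℤ, ∃ h ∈ filt n p e, g = gen p e ^ c * h := by
  obtain ⟨c, hc⟩ := dvd_im g (row_lt_col e).ne
  refine ⟨c, (gen p e ^ c)⁻¹ * g, ?_, by group⟩
  have hmem : (gen p e ^ c)⁻¹ * g ∈ filt n p (e + 1) :=
    Subgroup.mul_mem _ (Subgroup.inv_mem _ (Subgroup.zpow_mem _ (gen_mem e) _)) hg
  rw [mem_filt] at hmem ⊢
  intro f hf
  rcases hf.eq_or_lt with hf | hf
  · have : e = f := Fin.ext hf
    subst this
    rw [← _root_.zpow_neg, im_gen_zpow_mul, hc]; ring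
  · exact hmem f hf

theorem filt_normal (d : ℕ) : (filt n p d).Normal where
  conj_mem x hx g := by
    rw [mem_filt] at hx ⊢
    rw [im_mul, im_mul, ← mul_assoc]
    exact hx.conj (im_uniPat _) (im_uniPat _) (by rw [← im_mul, mul_inv_cancel, im_one])
      (im_uniPat _)

theorem exists_comm (e : Fin (numPos n)) (g : radical n p) :
    ∃ z ∈ filt n p e, g * gen p e = z * (gen p e * g) := by
  refine ⟨g * gen p e * g⁻¹ * (gen p e)⁻¹, ?_, by group⟩
  have hmem : (g * gen p e * g⁻¹ * (gen p e)⁻¹)⁻¹ ∈ filt n p (e + 1) :=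
    Subgroup.inv_mem _ (Subgroup.mul_mem _ ((filt_normal _).conj_mem _ (gen_mem e) g)
      (Subgroup.inv_mem _ (gen_mem e)))
  rw [← inv_mem_iff]
  rw [mem_filt] at hmem ⊢
  intro f hf
  rcases hf.eq_or_lt with hf | hf
  swap
  · exact hmem f hf
  obtain rfl : e = f := Fin.ext hf
  have h1 : (g * gen p e * g⁻¹ * (gen p e)⁻¹)⁻¹ = gen p e * (g * (gen p e)⁻¹ * g⁻¹) := by group
  have hsum : im (g * (gen p e)⁻¹ * g⁻¹) =
      1 + im g⁻¹ * single (row e) (col e) (-p : ℤ) * im g := by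
    rw [im_mul, im_mul, im_gen_inv, transvection, add_mul, one_mul, mul_add, ← im_mul,
      mul_inv_cancel, im_one, mul_assoc]
  rw [h1, im_gen_mul, (im_uniPat _).apply_self, hsum, Matrix.add_apply,
    one_apply_ne (row_lt_col e).ne, Matrix.mul_apply, Finset.sum_eq_single (col e),
    mul_single_apply_same, (im_uniPat _).apply_self, (im_uniPat _).apply_self]
  · ring
  · intro c _ hc
    rw [mul_single_apply_of_ne _ _ _ _ _ hc, zero_mul]
  · simp

/-- The coordinate functions of the radical tower. -/
noncomputable def coord (s : ℕ → ℝ) (d : ℕ) (x : radical n p) : ℝ :=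
  if h : d < numPos n then (im x (row ⟨d, h⟩) (col ⟨d, h⟩) : ℝ) - s d else 0

theorem filt_zero : filt n p 0 = ⊥ := by
  rw [eq_bot_iff]
  intro x hx
  rw [mem_filt] at hx
  refine im_injective ?_
  rw [im_one]
  ext i j
  by_cases h : IsPos i j
  · obtain ⟨e, rfl, rfl⟩ := exists_pos h
    rw [hx e (Nat.zero_le _), one_apply_ne (row_lt_col e).ne]
  · exact im_uniPat x i j h

theorem filt_top : filt n p (numPos n) = ⊤ := by
  rw [eq_top_iff]
  intro x _
  rw [mem_filt]
  intro e he
  have := e.2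
  omega

/-- The tower of the unipotent radical. -/
noncomputable def tower (n p : ℕ) (hp : 0 < p) (s : ℕ → ℝ) : Tower (radical n p) (numPos n) where
  Y := coord s
  K := filt n p
  t d := if h : d < numPos n then gen p ⟨d, h⟩ else 1
  p := p
  p_pos := by exact_mod_cast hp
  normal := filt_normal
  K_zero := filt_zero
  mono d x hx := by
    rw [mem_filt] at hx ⊢
    exact fun e he => hx e (by omega)
  t_mem d hd := by rw [dif_pos hd]; exact gen_mem ⟨d, hd⟩
  Y_t d hd x := by
    simp only [coord, dif_pos hd]
    rw [im_gen_mul, (im_uniPat _).apply_self]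
    push_cast; ring
  Y_K d g hg e hde he x := by
    simp only [coord, dif_pos he]
    rw [im_mul, (mem_filt.mp hg).mul_apply (im_uniPat _) (im_uniPat _) _ hde]
  gen d hd g hg := by
    simp only [dif_pos hd]
    exact exists_gen_mul ⟨d, hd⟩ hg
  comm d hd g := by
    simp only [dif_pos hd]
    exact exists_comm ⟨d, hd⟩ g

theorem tower_Y {hp : 0 < p} (s : ℕ → ℝ) (d : ℕ) (x : radical n p) :
    (tower n p hp s).Y d x = coord s d x := rfl

theorem exists_rat_relation {d : ℕ} (a : Fin d → Fin (d + 1) → ℚ) :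
    ∃ c : Fin (d + 1) → ℚ, c ≠ 0 ∧ ∀ j, ∑ i, a j i * c i = 0 := by
  have h : LinearMap.ker (Matrix.mulVecLin (Matrix.of a)) ≠ ⊥ :=
    LinearMap.ker_ne_bot_of_finrank_lt (by simp)
  obtain ⟨c, hc, h0⟩ := Submodule.exists_mem_ne_zero_of_ne_bot h
  exact ⟨c, h0, fun j => congrFun (show Matrix.of a *ᵥ c = 0 from hc) j⟩

theorem transcendental_sum_ne {τ : ℝ} (hτ : Transcendental ℚ τ) {d : ℕ} {c : Fin d → ℚ}
    (hc : c ≠ 0) : ∑ i : Fin d, (c i : ℝ) * τ ^ (i : ℕ) ≠ 0 := by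
  intro h
  let P : Polynomial ℚ := ∑ i : Fin d, Polynomial.C (c i) * Polynomial.X ^ (i : ℕ)
  refine hτ ⟨P, fun hP => hc (funext fun i => ?_), ?_⟩
  · have := congrArg (fun Q : Polynomial ℚ => Q.coeff i) hP
    simp only [P, Polynomial.finsetSum_coeff, Polynomial.coeff_C_mul, Polynomial.coeff_X_pow,
      Polynomial.coeff_zero] at this
    rw [Finset.sum_eq_single i] at this
    · simpa using this
    · intro j _ hj
      rw [if_neg (fun h => hj (Fin.ext h.symm)), mul_zero]
    · simp
  · simpa [P] using h

theorem tower_generic {hp : 0 < p} {τ : ℝ} (hτ : Transcendental ℚ τ) :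
    (tower n p hp fun d => τ ^ (d + 1)).Generic := by
  intro d hd x l hl hrel
  have hY : ∀ (i : Fin d) (j : Fin d), (tower n p hp fun d => τ ^ (d + 1)).Y i (x j) =
      (im (x j) (row ⟨i, by omega⟩) (col ⟨i, by omega⟩) : ℝ) - τ ^ ((i : ℕ) + 1) := by
    intro i j
    rw [tower_Y, coord, dif_pos]
  simp only [hY] at hrel
  obtain ⟨c, hc, hrat⟩ := exists_rat_relation (d := d) fun j => Fin.cons 1 fun i =>
    (im (x j) (row ⟨i, by omega⟩) (col ⟨i, by omega⟩) : ℚ)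
  have hτ0 := transcendental_sum_ne hτ hc
  rw [Fin.sum_univ_succ] at hτ0
  have hrat' : ∀ j, (c 0 : ℝ) + ∑ i : Fin d, (im (x j) (row ⟨i, by omega⟩)
      (col ⟨i, by omega⟩) : ℝ) * c i.succ = 0 := fun j => by
    have := hrat j
    rw [Fin.sum_univ_succ] at this
    simp only [Fin.cons_zero, Fin.cons_succ, one_mul] at this
    exact_mod_cast this
  have key : (∑ j, l j) * (∑ i : Fin (d + 1), (c i : ℝ) * τ ^ (i : ℕ)) = 0 := by
    have h1 : ∑ i : Fin d, (c i.succ : ℝ) * ∑ j, l j * ((im (x j) (row ⟨i, by omega⟩)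
        (col ⟨i, by omega⟩) : ℝ) - τ ^ ((i : ℕ) + 1)) = 0 :=
      Finset.sum_eq_zero fun i _ => by rw [hrel i, mul_zero]
    simp only [Finset.mul_sum] at h1
    rw [Finset.sum_comm] at h1
    have h2 : ∀ j, ∑ i : Fin d, (c i.succ : ℝ) * (l j * ((im (x j) (row ⟨i, by omega⟩)
        (col ⟨i, by omega⟩) : ℝ) - τ ^ ((i : ℕ) + 1))) =
        - (l j * ∑ i : Fin (d + 1), (c i : ℝ) * τ ^ (i : ℕ)) := by
      intro j
      have h3 : (c 0 : ℝ) = - ∑ i : Fin d, (im (x j) (row ⟨i, by omega⟩)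
        (col ⟨i, by omega⟩) : ℝ) * c i.succ := by linarith [hrat' j]
      rw [Fin.sum_univ_succ, h3]
      simp only [Fin.val_zero, pow_zero, mul_one, mul_add, mul_neg, Finset.mul_sum, Fin.val_succ,
        neg_add, neg_neg, ← Finset.sum_neg_distrib, ← Finset.sum_add_distrib]
      exact Finset.sum_congr rfl fun i _ => by ring
    simp only [h2, Finset.sum_neg_distrib, ← Finset.sum_mul] at h1
    linarith
  rw [Fin.sum_univ_succ] at key
  have hsum := (mul_eq_zero.mp key).resolve_right hτ0
  rw [Finset.sum_eq_zero_iff_of_nonneg fun j _ => hl j] at hsum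
  exact funext fun j => hsum j (Finset.mem_univ j)

theorem exists_transcendental : ∃ τ : ℝ, 0 < τ ∧ Transcendental ℚ τ := by
  refine ⟨liouvilleNumber 2, ?_, fun h => ?_⟩
  · rw [← LiouvilleNumber.partialSum_add_remainder one_lt_two 0]
    refine add_pos_of_nonneg_of_pos ?_ (LiouvilleNumber.remainder_pos one_lt_two 0)
    exact Finset.sum_nonneg fun i _ => by positivity
  · exact transcendental_liouvilleNumber (m := 2) le_rfl
      (by exact_mod_cast (IsFractionRing.isAlgebraic_iff ℤ ℚ ℝ).mpr h)

/-- A cycle of the radical with averaged degree one, after subdivision. -/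
theorem exists_radical_cycle (n p : ℕ) (hp : 0 < p) : ∃ s : ℕ → ℝ,
    (tower n p hp s).Generic ∧ ∃ z ∈ Ch (Set.univ : Set (radical n p)) (numPos n + 1),
      bd z ∈ Ann (⊤ : Subgroup (radical n p)) ∧
      ev ((tower n p hp s).avg (numPos n) ((tower n p hp s).degL (numPos n)))
        (subdiv (fun _ x => x) (numPos n + 1) z) = 1 := by
  obtain ⟨τ, h0, hτ⟩ := exists_transcendental
  refine ⟨fun d => τ ^ (d + 1), tower_generic hτ, ?_⟩
  set T := tower n p hp fun d => τ ^ (d + 1)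
  have hT : T.Generic := tower_generic hτ
  have hne : (T.neg 0).Nonempty := ⟨1, fun e _ he => by
    rw [tower_Y, coord, dif_pos he, im_one, one_apply_ne (row_lt_col _).ne]
    simpa using pow_pos h0 _⟩
  obtain ⟨a, ha, hb, hu⟩ := T.exists_cycle hT hne le_rfl
  have ha' : a ∈ Ch (Set.univ : Set (radical n p)) (numPos n + 1) :=
    supp_mono (fun l hl => ⟨hl.1, fun _ _ => Set.mem_univ _⟩) ha
  have hK : T.K (numPos n) = ⊤ := filt_top
  rcases Int.isUnit_iff.mp hu with h | h
  · exact ⟨a, ha', hK ▸ hb, by rw [Tower.ev_avg_subdiv hT ha' hb, h]⟩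
  · refine ⟨-a, neg_mem ha', ?_, ?_⟩
    · rw [map_neg]; exact neg_mem (hK ▸ hb)
    · rw [map_neg, map_neg, Tower.ev_avg_subdiv hT ha' hb, h, neg_neg]

end Radical

section PosMat
variable {n : ℕ}

/-- The action of a matrix on the rows of the positions. -/
noncomputable def posMat (m : Matrix (Fin n) (Fin n) ℝ) :
    Matrix (Fin (numPos n)) (Fin (numPos n)) ℝ :=
  of fun e e' => if col e = col e' then m (row e) (row e') else 0

theorem posMat_mulVec (m Y : Matrix (Fin n) (Fin n) ℝ) (e : Fin (numPos n)) :
    (posMat m *ᵥ fun e' => Y (row e') (col e')) e =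
      ∑ a, if IsPos a (col e) then m (row e) a * Y a (col e) else 0 := by
  simp only [mulVec, dotProduct, posMat, of_apply, ite_mul, zero_mul]
  rw [← Finset.sum_filter, ← Finset.sum_filter]
  refine Finset.sum_nbij row ?_ ?_ ?_ ?_
  · intro e' he'
    rw [mem_filter] at he' ⊢
    exact ⟨mem_univ _, he'.2 ▸ isPos e'⟩
  · intro e₁ h₁ e₂ h₂ h
    simp only [coe_filter, mem_univ, true_and, Set.mem_ofPred_eq] at h₁ h₂
    exact pos_injective h (h₁.symm.trans h₂)
  · intro a ha
    simp only [coe_filter, mem_univ, true_and, Set.mem_ofPred_eq] at ha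
    obtain ⟨e', rfl, h⟩ := exists_pos ha
    exact ⟨e', by simp [h], rfl⟩
  · intro e' he'
    rw [mem_filter] at he'
    rw [he'.2]

theorem det_posMat_pos {m : Matrix (Fin n) (Fin n) ℝ}
    (h : ∀ c : Fin n, 0 < (m.submatrix (Subtype.val : {r // IsPos r c} → Fin n)
      Subtype.val).det) : 0 < (posMat m).det := by
  have ht : (posMat m).BlockTriangular col := fun e e' hee => by
    rw [posMat, of_apply, if_neg hee.ne']
  rw [ht.det]
  refine Finset.prod_pos fun c _ => ?_
  let eq : {e : Fin (numPos n) // col e = c} ≃ {r : Fin n // IsPos r c} :=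
    Equiv.ofBijective (fun e => ⟨row e.1, by have h := isPos e.1; rwa [e.2] at h⟩)
      ⟨fun e₁ e₂ h => by
      exact Subtype.ext (pos_injective (congrArg Subtype.val h) (e₁.2.trans e₂.2.symm)),
      fun ⟨r, hr⟩ => by
      obtain ⟨e, rfl, rfl⟩ := exists_pos hr
      exact ⟨⟨e, rfl⟩, rfl⟩⟩
  have h1 : (posMat m).toSquareBlock col c =
      (m.submatrix (Subtype.val : {r // IsPos r c} → Fin n) Subtype.val).submatrix eq eq := by
    ext e e'
    exact if_pos (e.2.trans e'.2.symm)
  rw [h1, det_submatrix_equiv_self]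
  exact h c

theorem det_posMat_posDef {m : Matrix (Fin n) (Fin n) ℝ} (h : m.PosDef) : 0 < (posMat m).det :=
  det_posMat_pos fun _ => (h.submatrix Subtype.val_injective).det_pos

theorem det_posMat_unipotent {m : Matrix (Fin n) (Fin n) ℝ} (h0 : ∀ i j, j < i → m i j = 0)
    (h1 : ∀ i, m i i = 1) : 0 < (posMat m).det := by
  refine det_posMat_pos fun c => ?_
  rw [det_of_isUpperTriangular]
  · simp [h1]
  · intro i j hij
    exact h0 _ _ hij

theorem det_posMat_block {m : Matrix (Fin n) (Fin n) ℝ}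
    (h : ∀ i j : Fin n, 2 ≤ (i : ℕ) ∨ 2 ≤ (j : ℕ) → m i j = (1 : Matrix (Fin n) (Fin n) ℝ) i j)
    (hd : m.det = 1) : 0 < (posMat m).det := by
  refine det_posMat_pos fun c => ?_
  by_cases hc : 2 ≤ (c : ℕ)
  · rw [twoBlockTriangular_det m (fun r => IsPos r c)] at hd
    · have : m.toSquareBlockProp (fun r => ¬ IsPos r c) = 1 := by
        ext i j
        have hi : 2 ≤ (i.1 : ℕ) := by
          by_contra h'
          exact i.2 ⟨Fin.lt_def.mpr (by omega), hc⟩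
        rw [toSquareBlockProp_def, of_apply, h _ _ (Or.inl hi), one_apply, one_apply]
        simp [Subtype.ext_iff]
      rw [this, det_one, mul_one] at hd
      have h2 : m.submatrix (Subtype.val : {r // IsPos r c} → Fin n) Subtype.val =
        m.toSquareBlockProp fun r => IsPos r c := rfl
      rw [h2, hd]
      exact one_pos
    · intro i hi j hj
      have hi : 2 ≤ (i : ℕ) := by
        by_contra h'
        exact hi ⟨Fin.lt_def.mpr (by omega), hc⟩
      rw [h _ _ (Or.inl hi), one_apply_ne]
      rintro rfl; exact absurd hj ‹_›
  · have : IsEmpty {r : Fin n // IsPos r c} := ⟨fun r => hc r.2.2⟩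
    rw [det_isEmpty]
    exact one_pos

end PosMat

section Forms
variable {n : ℕ}

/-- The symmetrisation of a matrix. -/
def sy (A : Matrix (Fin n) (Fin n) ℝ) : Matrix (Fin n) (Fin n) ℝ := A + Aᵀ

theorem sy_symm (A : Matrix (Fin n) (Fin n) ℝ) : (sy A)ᵀ = sy A := by
  simp [sy, add_comm]

/-- The entries at the positions of the transformed form. -/
noncomputable def pv (M A : Matrix (Fin n) (Fin n) ℝ) : Fin (numPos n) → ℝ :=
  fun e => (Mᵀ * sy A * M) (row e) (col e)

/-- The real matrix of an integral one. -/
abbrev rl (g : SpecialLinearGroup (Fin n) ℤ) : Matrix (Fin n) (Fin n) ℝ :=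
  g.1.map (Int.cast : ℤ → ℝ)

theorem rl_mul (g h : SpecialLinearGroup (Fin n) ℤ) : rl (g * h) = rl g * rl h := by
  have : (g * h).1 = g.1 * h.1 := rfl
  simp only [rl, this]
  exact Matrix.map_mul (f := Int.castRingHom ℝ)

theorem rl_one : rl (1 : SpecialLinearGroup (Fin n) ℤ) = 1 :=
  Matrix.map_one (Int.cast : ℤ → ℝ) Int.cast_zero Int.cast_one

theorem rl_mul_inv (g : SpecialLinearGroup (Fin n) ℤ) : rl g * rl g⁻¹ = 1 := by
  rw [← rl_mul, mul_inv_cancel, rl_one]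

theorem rl_inv_mul (g : SpecialLinearGroup (Fin n) ℤ) : rl g⁻¹ * rl g = 1 := by
  rw [← rl_mul, inv_mul_cancel, rl_one]

theorem det_rl (g : SpecialLinearGroup (Fin n) ℤ) : (rl g).det = 1 := by
  have h := Int.coe_castRingHom (α := ℝ) ▸ (RingHom.map_det (Int.castRingHom ℝ) g.1)
  have h2 : g.1.det = 1 := g.2
  rw [h2] at h
  simpa using h.symm

/-- Matrices acting on the first two basis vectors only. -/
def InBlock (l : SpecialLinearGroup (Fin n) ℤ) : Prop :=
  ∀ i j : Fin n, 2 ≤ (i : ℕ) ∨ 2 ≤ (j : ℕ) → l.1 i j = (1 : Matrix (Fin n) (Fin n) ℤ) i j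

theorem InBlock.rl_apply {l : SpecialLinearGroup (Fin n) ℤ} (h : InBlock l) (i j : Fin n)
    (hij : 2 ≤ (i : ℕ) ∨ 2 ≤ (j : ℕ)) :
    rl l i j = (1 : Matrix (Fin n) (Fin n) ℝ) i j := by
  rw [rl, Matrix.map_apply, h i j hij, one_apply, one_apply]
  split_ifs <;> simp

theorem pv_block (M A : Matrix (Fin n) (Fin n) ℝ) {l : SpecialLinearGroup (Fin n) ℤ}
    (h : InBlock l) : pv (M * rl l) A = posMat (rl l)ᵀ *ᵥ pv M A := by
  funext e
  have h1 : (M * rl l)ᵀ * sy A * (M * rl l) = (rl l)ᵀ * ((Mᵀ * sy A * M) * rl l) := by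
    rw [transpose_mul]; simp only [mul_assoc]
  have h2 : ∀ a, ((Mᵀ * sy A * M) * rl l) a (col e) = (Mᵀ * sy A * M) a (col e) := fun a => by
    rw [Matrix.mul_apply, Finset.sum_eq_single (col e)]
    · rw [h.rl_apply _ _ (Or.inl (isPos e).2), one_apply_eq, mul_one]
    · intro b _ hb
      rw [h.rl_apply _ _ (Or.inr (isPos e).2), one_apply_ne hb, mul_zero]
    · simp
  unfold pv
  rw [posMat_mulVec, h1, Matrix.mul_apply]
  refine Finset.sum_congr rfl fun a _ => ?_
  rw [h2]
  split_ifs with ha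
  · rfl
  · have ha' : ¬ a < col e := fun h' => ha ⟨h', (isPos e).2⟩
    have ha2 : 2 ≤ (a : ℕ) := (isPos e).2.trans (by simpa using ha')
    have hne : a ≠ row e := by
      rintro rfl; exact ha' (row_lt_col e)
    rw [transpose_apply, h.rl_apply _ _ (Or.inl ha2), one_apply_ne hne, zero_mul]

theorem det_posMat_inBlock {l : SpecialLinearGroup (Fin n) ℤ} (h : InBlock l) :
    0 < (posMat (rl l)ᵀ).det :=
  det_posMat_block (fun i j hij => by
    rw [transpose_apply, h.rl_apply _ _ hij.symm, one_apply, one_apply]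
    simp [eq_comm]) (by rw [det_transpose, det_rl])

end Forms

section Pd
variable {n : ℕ}

theorem abs_quad_le (M : Matrix (Fin n) (Fin n) ℝ) (v : Fin n → ℝ) :
    |v ⬝ᵥ (M *ᵥ v)| ≤ (∑ i, ∑ j, |M i j|) * (v ⬝ᵥ v) := by
  have hsq : ∀ i, v i * v i ≤ v ⬝ᵥ v := fun i =>
    Finset.single_le_sum (f := fun i => v i * v i) (fun i _ => mul_self_nonneg _) (mem_univ i)
  have h2 : ∀ i j, |v i * (M i j * v j)| ≤ |M i j| * (v ⬝ᵥ v) := by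
    intro i j
    have : |v i| * |v j| ≤ v ⬝ᵥ v := by
      have h1 := hsq i
      have h2 := hsq j
      nlinarith [sq_nonneg (|v i| - |v j|), abs_mul_abs_self (v i), abs_mul_abs_self (v j)]
    calc |v i * (M i j * v j)| = |M i j| * (|v i| * |v j|) := by
          rw [abs_mul, abs_mul]; ring
      _ ≤ _ := mul_le_mul_of_nonneg_left this (abs_nonneg _)
  simp only [Finset.sum_mul]
  simp only [dotProduct, mulVec, Finset.mul_sum] at h2 ⊢
  exact (Finset.abs_sum_le_sum_abs _ _).trans (Finset.sum_le_sum fun i _ =>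
    (Finset.abs_sum_le_sum_abs _ _).trans (Finset.sum_le_sum fun j _ => h2 i j))

theorem exists_quad_le (M : Matrix (Fin n) (Fin n) ℝ) :
    ∃ C > 0, ∀ v, |v ⬝ᵥ (M *ᵥ v)| ≤ C * (v ⬝ᵥ v) := by
  refine ⟨1 + ∑ i, ∑ j, |M i j|, by positivity, fun v => (abs_quad_le M v).trans ?_⟩
  have hvv : 0 ≤ v ⬝ᵥ v := Finset.sum_nonneg fun i _ => mul_self_nonneg _
  linarith

/-- Symmetric and uniformly positive definite. -/
def Pd (S : Matrix (Fin n) (Fin n) ℝ) : Prop :=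
  Sᵀ = S ∧ ∃ ε > 0, ∀ v, ε * (v ⬝ᵥ v) ≤ v ⬝ᵥ (S *ᵥ v)

theorem quad_conj (g S : Matrix (Fin n) (Fin n) ℝ) (u v : Fin n → ℝ) :
    u ⬝ᵥ ((gᵀ * S * g) *ᵥ v) = (g *ᵥ u) ⬝ᵥ (S *ᵥ (g *ᵥ v)) := by
  rw [← mulVec_mulVec, ← mulVec_mulVec, dotProduct_mulVec, vecMul_transpose]

theorem Pd.conj {S g g' : Matrix (Fin n) (Fin n) ℝ} (hS : Pd S) (h : g' * g = 1) :
    Pd (gᵀ * S * g) := by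
  obtain ⟨h1, ε, hε, h2⟩ := hS
  obtain ⟨C, hC, h3⟩ := exists_quad_le (g'ᵀ * 1 * g')
  refine ⟨by rw [transpose_mul, transpose_mul, h1, transpose_transpose, mul_assoc], ε / C,
    by positivity, fun v => ?_⟩
  rw [quad_conj]
  have h4 := (le_abs_self _).trans (h3 (g *ᵥ v))
  rw [quad_conj, mulVec_mulVec, h, one_mulVec, one_mulVec] at h4
  refine le_trans ?_ (h2 (g *ᵥ v))
  rw [div_mul_eq_mul_div, div_le_iff₀ hC]
  nlinarith

/-- The form is block orthogonal in the given basis. -/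
def Orth (S h : Matrix (Fin n) (Fin n) ℝ) : Prop :=
  ∀ e : Fin (numPos n), (hᵀ * S * h) (row e) (col e) = 0

theorem Orth.apply {S h : Matrix (Fin n) (Fin n) ℝ} (ho : Orth S h) (hS : Sᵀ = S) {i j : Fin n}
    (hij : i ≠ j) (h2 : 2 ≤ (i : ℕ) ∨ 2 ≤ (j : ℕ)) : (hᵀ * S * h) i j = 0 := by
  have hs : (hᵀ * S * h)ᵀ = hᵀ * S * h := by
    rw [transpose_mul, transpose_mul, hS, transpose_transpose, mul_assoc]
  rcases lt_or_gt_of_ne hij with hl | hl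
  · have hl' : (i : ℕ) < j := hl
    obtain ⟨e, rfl, rfl⟩ := exists_pos (a := i) (b := j) ⟨hl, by omega⟩
    exact ho e
  · have hl' : (j : ℕ) < i := hl
    obtain ⟨e, rfl, rfl⟩ := exists_pos (a := j) (b := i) ⟨hl, by omega⟩
    rw [← hs]
    exact ho e

theorem one_le_dot_int {v : Fin n → ℤ} (hv : v ≠ 0) :
    1 ≤ (fun i => (v i : ℝ)) ⬝ᵥ (fun i => (v i : ℝ)) := by
  obtain ⟨i, hi⟩ := Function.ne_iff.mp hv
  have h1 : (1 : ℝ) ≤ (v i : ℝ) * v i := by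
    have : (1 : ℤ) ≤ v i * v i := mul_self_pos.mpr hi
    exact_mod_cast this
  exact h1.trans (Finset.single_le_sum (f := fun i => (v i : ℝ) * v i)
    (fun i _ => mul_self_nonneg _) (mem_univ i))

theorem orth_bound {S : Matrix (Fin n) (Fin n) ℝ} (hS : Sᵀ = S) {ε C : ℝ} (hε : 0 < ε)
    (h1 : ∀ v, ε * (v ⬝ᵥ v) ≤ v ⬝ᵥ (S *ᵥ v)) (h2 : ∀ v, v ⬝ᵥ (S *ᵥ v) ≤ C * (v ⬝ᵥ v))
    {g : SpecialLinearGroup (Fin n) ℤ} (ho : Orth S (rl g)) {j : Fin n} (hj : 2 ≤ (j : ℕ))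
    (a : Fin n) : ε * (rl g a j * rl g a j) ≤ C ∧ ε * (rl g⁻¹ j a * rl g⁻¹ j a) ≤ C := by
  set v : Fin n → ℝ := fun a => rl g a j with hv
  set w : Fin n → ℝ := fun a => rl g⁻¹ j a with hw
  set d := ((rl g)ᵀ * S * rl g) j j with hd
  have hv' : v = rl g *ᵥ Pi.single j 1 := by ext a; simp [hv]
  have hcol : ((rl g)ᵀ * S * rl g) *ᵥ Pi.single j 1 = d • Pi.single j 1 := by
    ext i
    by_cases hij : i = j
    · subst hij; simp [hd]
    · simp [hij, ho.apply hS hij (Or.inr hj)]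
  have hSv : S *ᵥ v = d • w := by
    have : S = (rl g⁻¹)ᵀ * ((rl g)ᵀ * S * rl g) * rl g⁻¹ := by
      have e1 : (rl g⁻¹)ᵀ * (rl g)ᵀ = 1 := by rw [← transpose_mul, rl_mul_inv, transpose_one]
      calc S = ((rl g⁻¹)ᵀ * (rl g)ᵀ) * S * (rl g * rl g⁻¹) := by
            rw [e1, rl_mul_inv, one_mul, mul_one]
        _ = _ := by simp only [mul_assoc]
    rw [this, hv', mulVec_mulVec, mul_assoc _ (rl g⁻¹), rl_inv_mul, mul_one, ← mulVec_mulVec,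
      hcol, mulVec_smul]
    congr 1
    ext a
    simp [hw]
  have hwv : w ⬝ᵥ v = 1 := by
    have := congrFun (congrFun (rl_inv_mul g) j) j
    rw [one_apply_eq] at this
    exact this
  have hvS : v ⬝ᵥ (S *ᵥ v) = d := by
    rw [hSv, dotProduct_smul, dotProduct_comm, hwv, smul_eq_mul, mul_one]
  have hwS : w ⬝ᵥ (S *ᵥ v) = d * (w ⬝ᵥ w) := by rw [hSv, dotProduct_smul, smul_eq_mul]
  have hSw : v ⬝ᵥ (S *ᵥ w) = d * (w ⬝ᵥ w) := by
    rw [dotProduct_mulVec, ← mulVec_transpose, hS, hSv, smul_dotProduct, smul_eq_mul]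
  have hw1 : 1 ≤ w ⬝ᵥ w := one_le_dot_int (v := fun a => (g⁻¹).1 j a) fun h0 => by
    have : w = 0 := by ext a; simpa [hw] using congrFun h0 a
    rw [this, zero_dotProduct] at hwv
    exact zero_ne_one hwv
  have hv1 : 1 ≤ v ⬝ᵥ v := one_le_dot_int (v := fun a => g.1 a j) fun h0 => by
    have : v = 0 := by ext a; simpa [hv] using congrFun h0 a
    rw [this, dotProduct_zero] at hwv
    exact zero_ne_one hwv
  have hpos : 0 ≤ (w - (w ⬝ᵥ w) • v) ⬝ᵥ (S *ᵥ (w - (w ⬝ᵥ w) • v)) :=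
    le_trans (mul_nonneg hε.le (Finset.sum_nonneg fun i _ => mul_self_nonneg _)) (h1 _)
  rw [mulVec_sub, mulVec_smul, sub_dotProduct, dotProduct_sub, dotProduct_sub, smul_dotProduct,
    smul_dotProduct, dotProduct_smul, dotProduct_smul, hwS, hSw, hvS] at hpos
  simp only [smul_eq_mul] at hpos
  have h3 := h2 w
  have h4 := h1 v
  rw [hvS] at h4
  have h5 : d * (w ⬝ᵥ w) ≤ C := by
    have : d * (w ⬝ᵥ w) * (w ⬝ᵥ w) ≤ C * (w ⬝ᵥ w) := by nlinarith
    exact le_of_mul_le_mul_right this (by linarith)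
  have h6 : ε * (v ⬝ᵥ v) * (w ⬝ᵥ w) ≤ C :=
    (mul_le_mul_of_nonneg_right h4 (by linarith)).trans h5
  have h7 : v a * v a ≤ v ⬝ᵥ v :=
    Finset.single_le_sum (f := fun i => v i * v i) (fun i _ => mul_self_nonneg _) (mem_univ a)
  have h8 : w a * w a ≤ w ⬝ᵥ w :=
    Finset.single_le_sum (f := fun i => w i * w i) (fun i _ => mul_self_nonneg _) (mem_univ a)
  have h9 : ε * (v ⬝ᵥ v) ≤ C := by
    have : ε * (v ⬝ᵥ v) * 1 ≤ ε * (v ⬝ᵥ v) * (w ⬝ᵥ w) :=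
      mul_le_mul_of_nonneg_left hw1 (by positivity)
    linarith
  have h10 : ε * (w ⬝ᵥ w) ≤ C := by
    have : ε * (w ⬝ᵥ w) * 1 ≤ ε * (w ⬝ᵥ w) * (v ⬝ᵥ v) :=
      mul_le_mul_of_nonneg_left hv1 (by positivity)
    linarith
  exact ⟨(mul_le_mul_of_nonneg_left h7 hε.le).trans h9,
    (mul_le_mul_of_nonneg_left h8 hε.le).trans h10⟩

theorem InBlock.mul {a b : SpecialLinearGroup (Fin n) ℤ} (ha : InBlock a) (hb : InBlock b) :
    InBlock (a * b) := by
  intro i j hij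
  change (a.1 * b.1) i j = _
  rw [Matrix.mul_apply]
  rcases hij with hi | hj
  · simp only [ha i _ (Or.inl hi), one_apply, ite_mul, one_mul, zero_mul, Finset.sum_ite_eq,
      mem_univ, if_true]
    rw [hb i j (Or.inl hi), one_apply]
  · simp only [hb _ j (Or.inr hj), one_apply, mul_ite, mul_one, mul_zero, Finset.sum_ite_eq',
      mem_univ, if_true]
    rw [ha i j (Or.inr hj), one_apply]

theorem InBlock.one : InBlock (1 : SpecialLinearGroup (Fin n) ℤ) := fun _ _ _ => rfl

/-- The elements of the congruence subgroup acting on the first two basis vectors only. -/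
def blockSub (n p : ℕ) : Subgroup (congruenceSubgroup n p) where
  carrier := {l | InBlock l.1 ∧ InBlock l.1⁻¹}
  one_mem' := ⟨InBlock.one, by rw [Subgroup.coe_one, inv_one]; exact InBlock.one⟩
  mul_mem' {a b} ha hb := ⟨ha.1.mul hb.1, by
    rw [Subgroup.coe_mul, _root_.mul_inv_rev]; exact hb.2.mul ha.2⟩
  inv_mem' {a} ha := ⟨ha.2, by rw [Subgroup.coe_inv, inv_inv]; exact ha.1⟩

theorem inBlock_inv_mul {a b : SpecialLinearGroup (Fin n) ℤ}
    (h1 : ∀ i j : Fin n, 2 ≤ (j : ℕ) → a.1 i j = b.1 i j)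
    (h2 : ∀ i j : Fin n, 2 ≤ (i : ℕ) → (a⁻¹).1 i j = (b⁻¹).1 i j) : InBlock (a⁻¹ * b) := by
  have key : ∀ c : SpecialLinearGroup (Fin n) ℤ, (c⁻¹).1 * c.1 = 1 := fun c =>
    congrArg Subtype.val (inv_mul_cancel c)
  intro i j hij
  change ((a⁻¹).1 * b.1) i j = _
  rcases hij with hi | hj
  · rw [← key b, Matrix.mul_apply, Matrix.mul_apply]
    exact Finset.sum_congr rfl fun c _ => by rw [h2 i c hi]
  · rw [← key a, Matrix.mul_apply, Matrix.mul_apply]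
    exact Finset.sum_congr rfl fun c _ => by rw [h1 c j hj]

theorem finite_orth {p N : ℕ} (S : Fin N → Matrix (Fin n) (Fin n) ℝ) (hS : ∀ i, Pd (S i)) :
    {q : congruenceSubgroup n p ⧸ blockSub n p | ∃ c : Fin N → ℝ, (∀ i, 0 ≤ c i) ∧ 0 < ∑ i, c i ∧
      Orth (∑ i, c i • S i) (rl q.out.1)}.Finite := by
  choose hsym ε hε hl using hS
  choose C hC hu using fun i => exists_quad_le (S i)
  obtain ⟨ε₀, hε₀, hεi⟩ : ∃ ε₀ > 0, ∀ i, ε₀ ≤ ε i := by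
    rcases isEmpty_or_nonempty (Fin N) with h | h
    · exact ⟨1, one_pos, fun i => h.elim i⟩
    · obtain ⟨i, hi⟩ := Finite.exists_min ε
      exact ⟨ε i, hε i, hi⟩
  have hC0 : ∀ i, C i ≤ ∑ i, C i := fun i =>
    Finset.single_le_sum (fun i _ => (hC i).le) (mem_univ i)
  set C₀ := ∑ i, C i
  obtain ⟨B, hB⟩ := exists_nat_gt (1 + C₀ / ε₀)
  let Φ : congruenceSubgroup n p ⧸ blockSub n p → Fin n → Fin n → ℤ × ℤ := fun q j a =>
    if 2 ≤ (j : ℕ) then (q.out.1.1 a j, (q.out.1⁻¹).1 j a) else 0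
  have hΦ : Function.Injective Φ := by
    intro q q' h
    have h' : ∀ j a : Fin n, 2 ≤ (j : ℕ) → q.out.1.1 a j = q'.out.1.1 a j ∧
        (q.out.1⁻¹).1 j a = (q'.out.1⁻¹).1 j a := fun j a hj => by
      have := congrFun (congrFun h j) a
      simp only [Φ, if_pos hj, Prod.mk.injEq] at this
      exact this
    have h1 : InBlock (q.out.1⁻¹ * q'.out.1) :=
      inBlock_inv_mul (fun i j hj => (h' j i hj).1) fun i j hi => (h' i j hi).2
    have h2 : InBlock (q'.out.1⁻¹ * q.out.1) :=
      inBlock_inv_mul (fun i j hj => (h' j i hj).1.symm) fun i j hi => (h' i j hi).2.symm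
    rw [← q.out_eq', ← q'.out_eq']
    refine Quotient.sound' (QuotientGroup.leftRel_apply.mpr ⟨h1, ?_⟩)
    simpa using h2
  refine ((Set.finite_Icc (fun _ _ => (-(B : ℤ), -(B : ℤ)) : Fin n → Fin n → ℤ × ℤ)
    (fun _ _ => ((B : ℤ), (B : ℤ)))).preimage hΦ.injOn).subset ?_
  rintro q ⟨c, hc0, hc1, ho⟩
  have hquad : ∀ v : Fin n → ℝ, v ⬝ᵥ ((∑ i, c i • S i) *ᵥ v) =
      ∑ i, c i * (v ⬝ᵥ (S i *ᵥ v)) := fun v => by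
    rw [sum_mulVec, dotProduct_sum]
    exact Finset.sum_congr rfl fun i _ => by rw [smul_mulVec, dotProduct_smul, smul_eq_mul]
  have hvv : ∀ v : Fin n → ℝ, 0 ≤ v ⬝ᵥ v := fun v =>
    Finset.sum_nonneg fun i _ => mul_self_nonneg _
  have hb : ∀ j a : Fin n, 2 ≤ (j : ℕ) → _ := fun j a hj => orth_bound (C := (∑ i, c i) * C₀)
    (ε := (∑ i, c i) * ε₀) (by
      rw [transpose_sum]
      exact Finset.sum_congr rfl fun i _ => by rw [transpose_smul, hsym])
    (by positivity) (fun v => by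
      rw [hquad, mul_assoc, Finset.sum_mul]
      refine Finset.sum_le_sum fun i _ => mul_le_mul_of_nonneg_left ?_ (hc0 i)
      exact (mul_le_mul_of_nonneg_right (hεi i) (hvv v)).trans (hl i v))
    (fun v => by
      rw [hquad, mul_assoc, Finset.sum_mul]
      refine Finset.sum_le_sum fun i _ => mul_le_mul_of_nonneg_left ?_ (hc0 i)
      exact ((le_abs_self _).trans (hu i v)).trans (mul_le_mul_of_nonneg_right (hC0 i) (hvv v)))
    ho hj a
  have hquad : ∀ z : ℤ, (∑ i, c i) * ε₀ * ((z : ℝ) * z) ≤ (∑ i, c i) * C₀ →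
      -(B : ℤ) ≤ z ∧ z ≤ B := by
    intro z hz
    have h1 : (z : ℝ) * z ≤ C₀ / ε₀ := by
      rw [le_div_iff₀ hε₀]
      have : (∑ i, c i) * ((z : ℝ) * z * ε₀) ≤ (∑ i, c i) * C₀ := by linarith
      exact le_of_mul_le_mul_left this hc1
    have h2 : (z : ℝ) * z < B := by linarith
    have h3 : z * z < B := by exact_mod_cast h2
    constructor <;> nlinarith
  have hcoord : ∀ j a : Fin n, (-(B : ℤ), -(B : ℤ)) ≤ Φ q j a ∧ Φ q j a ≤ ((B : ℤ), (B : ℤ)) := by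
    intro j a
    by_cases hj : 2 ≤ (j : ℕ)
    · simp only [Φ, if_pos hj]
      have h1 := hquad _ (hb j a hj).1
      have h2 := hquad _ (hb j a hj).2
      exact ⟨⟨h1.1, h2.1⟩, ⟨h1.2, h2.2⟩⟩
    · simp only [Φ, if_neg hj]
      refine ⟨⟨?_, ?_⟩, ⟨?_, ?_⟩⟩ <;> simp
  exact ⟨fun j a => (hcoord j a).1, fun j a => (hcoord j a).2⟩

end Pd

section Glob
variable {n p : ℕ} {ι : Type*}

/-- The linear form `A ↦ pv M A`. -/
noncomputable def pvLin (M : Matrix (Fin n) (Fin n) ℝ) :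
    Matrix (Fin n) (Fin n) ℝ →ₗ[ℝ] (Fin (numPos n) → ℝ) where
  toFun := pv M
  map_add' A B := by
    ext e
    simp only [pv, sy, transpose_add, Pi.add_apply]
    rw [← Matrix.add_apply, ← Matrix.add_mul, ← Matrix.mul_add, add_add_add_comm]
  map_smul' r A := by
    ext e
    simp only [pv, sy, transpose_smul, Pi.smul_apply, RingHom.id_apply, ← smul_add,
      Matrix.mul_smul, Matrix.smul_mul, Matrix.smul_apply]

theorem pvLin_surjective {M M' : Matrix (Fin n) (Fin n) ℝ} (h : M' * M = 1) :
    Function.Surjective (pvLin M) := by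
  intro Y
  let B : Matrix (Fin n) (Fin n) ℝ := of fun i j => ∑ e, if row e = i ∧ col e = j then Y e else 0
  refine ⟨M'ᵀ * B * M', ?_⟩
  have h1 : Mᵀ * M'ᵀ = 1 := by rw [← transpose_mul, h, transpose_one]
  have h2 : Mᵀ * (M'ᵀ * B * M') * M = B := by
    calc Mᵀ * (M'ᵀ * B * M') * M = (Mᵀ * M'ᵀ) * B * (M' * M) := by simp only [mul_assoc]
      _ = B := by rw [h1, h, one_mul, mul_one]
  have h3 : Mᵀ * (M'ᵀ * B * M')ᵀ * M = Bᵀ := by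
    conv_rhs => rw [← h2]
    simp only [transpose_mul, transpose_transpose, mul_assoc]
  ext e
  change (Mᵀ * sy (M'ᵀ * B * M') * M) (row e) (col e) = _
  rw [sy, Matrix.mul_add, Matrix.add_mul, h2, h3, Matrix.add_apply, transpose_apply]
  have h4 : B (row e) (col e) = Y e := by
    simp only [B, of_apply]
    rw [Finset.sum_eq_single e]
    · simp
    · intro e' _ hne
      rw [if_neg]
      exact fun hh => hne (pos_injective hh.1 hh.2)
    · simp
  have h5 : B (col e) (row e) = 0 := by
    simp only [B, of_apply]
    refine Finset.sum_eq_zero fun e' _ => if_neg fun hh => ?_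
    have h1 := row_lt_col e
    have h2 := row_lt_col e'
    rw [hh.1, hh.2] at h2
    exact lt_asymm h1 h2
  rw [h4, h5, add_zero]

variable (x : ι → Matrix (Fin n) (Fin n) ℝ)

/-- The degree attached to a coset representative `q` and a list of translated coloured forms. -/
noncomputable def term (q : congruenceSubgroup n p) :
    List (congruenceSubgroup n p × ι) → ℤ :=
  onList (numPos n + 1) fun z => deg fun i => pv (rl ((z i).1⁻¹ * q).1) (x (z i).2)

theorem term_mul {q l : congruenceSubgroup n p} (hl : l ∈ blockSub n p)
    (z : List (congruenceSubgroup n p × ι)) : term x (q * l) z = term x q z := by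
  by_cases hz : z.length = numPos n + 1
  · obtain ⟨z, rfl⟩ := exists_ofFn_of_length hz
    rw [term, term, onList_ofFn, onList_ofFn,
      ← deg_smul_det (fun i => pv (rl ((z i).1⁻¹ * q).1) (x (z i).2)) _
        (det_posMat_inBlock hl.1)]
    congr 1
    ext1 i
    rw [← pv_block _ _ hl.1, ← rl_mul, ← mul_assoc]
    rfl
  · rw [term, term, onList_of_length_ne hz, onList_of_length_ne hz]

theorem term_out (q : congruenceSubgroup n p) (z : List (congruenceSubgroup n p × ι)) :
    term x (q : congruenceSubgroup n p ⧸ blockSub n p).out z = term x q z := by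
  obtain ⟨l, hl⟩ := QuotientGroup.mk_out_eq_mul (blockSub n p) q
  rw [hl, term_mul x l.2]

theorem term_translate (γ q : congruenceSubgroup n p) (z : List (congruenceSubgroup n p × ι)) :
    term x q (z.map fun v => (γ * v.1, v.2)) = term x (γ⁻¹ * q) z := by
  by_cases hz : z.length = numPos n + 1
  · obtain ⟨z, rfl⟩ := exists_ofFn_of_length hz
    rw [List.map_ofFn, term, term, onList_ofFn, onList_ofFn]
    congr 1
    ext1 i
    simp only [Function.comp_apply, _root_.mul_inv_rev, mul_assoc]
  · rw [term, term, onList_of_length_ne hz, onList_of_length_ne (by simpa using hz)]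

theorem term_support (hx : ∀ i, Pd (sy (x i))) (z : List (congruenceSubgroup n p × ι)) :
    (Function.support fun q : congruenceSubgroup n p ⧸ blockSub n p =>
      term x q.out z).Finite := by
  by_cases hz : z.length = numPos n + 1
  · obtain ⟨z, rfl⟩ := exists_ofFn_of_length hz
    let g : Fin (numPos n + 1) → SpecialLinearGroup (Fin n) ℤ := fun i => (z i).1.1⁻¹
    refine (finite_orth (p := p) (fun i => (rl (g i))ᵀ * sy (x (z i).2) * rl (g i))
      fun i => (hx _).conj (rl_inv_mul (g i))).subset fun q hq => ?_
    rw [Function.mem_support, term, onList_ofFn] at hq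
    obtain ⟨c, hc, h0⟩ := exists_pos_relation_of_deg_ne_zero hq
    refine ⟨c, fun i => (hc i).le, Finset.sum_pos (fun i _ => hc i) univ_nonempty, fun e => ?_⟩
    rw [← h0 e, Matrix.mul_sum, Matrix.sum_mul, Matrix.sum_apply]
    refine Finset.sum_congr rfl fun i _ => ?_
    rw [Matrix.mul_smul, Matrix.smul_mul, Matrix.smul_apply, smul_eq_mul, pv]
    congr 1
    have : rl ((z i).1⁻¹ * q.out).1 = rl (g i) * rl q.out.1 := rl_mul _ _
    rw [this, transpose_mul]
    simp only [mul_assoc]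
  · refine Set.Finite.subset Set.finite_empty fun q hq => ?_
    exact hq (onList_of_length_ne hz)

/-- The sum of all degrees. -/
noncomputable def glob (z : List (congruenceSubgroup n p × ι)) : ℤ :=
  ∑ᶠ q : congruenceSubgroup n p ⧸ blockSub n p, term x q.out z

theorem glob_translate (γ : congruenceSubgroup n p) (z : List (congruenceSubgroup n p × ι)) :
    glob x (z.map fun v => (γ * v.1, v.2)) = glob x z := by
  rw [glob, glob, ← finsum_comp_equiv (MulAction.toPerm γ)]
  refine finsum_congr fun q => ?_
  rw [MulAction.toPerm_apply]
  have : γ • q = ((γ * q.out : congruenceSubgroup n p) :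
      congruenceSubgroup n p ⧸ blockSub n p) := by
    conv_lhs => rw [← q.out_eq']
    rfl
  rw [this, term_out, term_translate, inv_mul_cancel_left]

/-- Linear independence of all translated coordinates of forms with distinct colours. -/
def GenericForms (n p : ℕ) {ι : Type*} (x : ι → Matrix (Fin n) (Fin n) ℝ) : Prop :=
  ∀ c : Fin (numPos n) → ι, Function.Injective c → ∀ α : Fin (numPos n) → congruenceSubgroup n p,
    LinearIndependent ℝ fun a => pv (rl (α a).1) (x (c a))

theorem glob_bd (hx : ∀ i, Pd (sy (x i))) (hg : GenericForms n p x)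
    {c : Chain (congruenceSubgroup n p × ι)} (hc : c ∈ Supp fun l => (l.map Prod.snd).Nodup) :
    ev (glob x) (bd c) = 0 := by
  have h1 : ∀ q, ev (term x q) (bd c) = 0 := fun q => by
    refine eq_of_supp hc (ev (term x q) ∘ₗ bd) 0 fun l hn => ?_
    by_cases hl : l.length = numPos n + 2
    · obtain ⟨z, rfl⟩ := exists_ofFn_of_length hl
      rw [List.map_ofFn, List.nodup_ofFn] at hn
      have h := sum_deg_of_linearIndependent
        (fun i => pv (rl ((z i).1⁻¹ * q).1) (x (z i).2)) fun c hc =>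
          hg (fun a => (z (c a)).2) (hn.comp hc) fun a => (z (c a)).1⁻¹ * q
      simp only [LinearMap.comp_apply, bd_pt, bdL_ofFn, map_sum, map_smul, ev_pt, term,
        onList_ofFn, smul_eq_mul, LinearMap.zero_apply]
      exact h
    · have h1 := bd_mem (mem_ch_univ (l := l))
      simp only [LinearMap.comp_apply, LinearMap.zero_apply]
      rw [ev_congr (F' := fun _ => 0) h1]
      · rw [show (fun _ : List (congruenceSubgroup n p × ι) => (0 : ℤ)) = 0 from rfl]; simp [ev]
      · intro s hs
        refine onList_of_length_ne ?_
        have := hs.1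
        rcases l with _ | ⟨x, l⟩
        · simp at this; simp [this]
        · simp at this hl; omega
  rw [show glob x = fun l => ∑ᶠ q : congruenceSubgroup n p ⧸ blockSub n p, term x q.out l from rfl,
    ev_finsum (P := fun _ => True) (fun _ _ => trivial) _ fun l _ => term_support x hx l]
  exact finsum_eq_zero_of_forall_eq_zero fun q => h1 _

theorem exists_genericForms [Countable ι] (U : ι → Set (Matrix (Fin n) (Fin n) ℝ))
    (hU : ∀ i, IsOpen (U i)) (hne : ∀ i, (U i).Nonempty) :
    ∃ x : ι → Matrix (Fin n) (Fin n) ℝ, (∀ i, x i ∈ U i) ∧ GenericForms n p x := by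
  have : Countable (SpecialLinearGroup (Fin n) ℤ) :=
    (Subtype.val_injective (p := fun A : Fin n → Fin n → ℤ => Matrix.det A = 1)).countable
  obtain ⟨x, h1, h2⟩ := exists_generic (W := Fin n → Fin n → ℝ) (A := congruenceSubgroup n p)
    (k := numPos n)
    (fun α => pvLin (rl α.1)) (fun α => pvLin_surjective (rl_inv_mul α.1)) U hU hne
  exact ⟨x, h1, h2⟩

end Glob

section Adm
variable {n : ℕ}

/-- The weight of a coordinate. -/
noncomputable def tw (t : ℝ) (j : ℕ) : ℝ := t ^ (j - 1)

theorem one_le_tw {t : ℝ} (ht : 1 ≤ t) (j : ℕ) : 1 ≤ tw t j := one_le_pow₀ ht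

theorem tw_mono {t : ℝ} (ht : 1 ≤ t) {i j : ℕ} (h : i ≤ j) : tw t i ≤ tw t j :=
  pow_le_pow_right₀ ht (by omega)

theorem mul_tw_le {t : ℝ} (ht : 1 ≤ t) {i j : ℕ} (h : i < j) (hj : 2 ≤ j) :
    t * tw t i ≤ tw t j := by
  rw [tw, tw, ← pow_succ']
  exact pow_le_pow_right₀ ht (by omega)

/-- The value of a quadratic form. -/
def qf (S : Matrix (Fin n) (Fin n) ℝ) (v : Fin n → ℝ) : ℝ := v ⬝ᵥ (S *ᵥ v)

theorem qf_conj (g S : Matrix (Fin n) (Fin n) ℝ) (v : Fin n → ℝ) :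
    qf (gᵀ * S * g) v = qf S (g *ᵥ v) := quad_conj g S v v

theorem qf_eq_sum (S : Matrix (Fin n) (Fin n) ℝ) (v : Fin n → ℝ) :
    qf S v = ∑ i, ∑ j, v i * (S i j * v j) := by
  simp only [qf, dotProduct, mulVec, Finset.mul_sum]

theorem qf_single (S : Matrix (Fin n) (Fin n) ℝ) (a : Fin n) : qf S (Pi.single a 1) = S a a := by
  simp [qf]

/-- Forms close to a very lopsided diagonal one, up to a bounded change of basis. -/
structure Adm (C t : ℝ) (S : Matrix (Fin n) (Fin n) ℝ) : Prop where
  symm : Sᵀ = S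
  low : ∀ (v : Fin n → ℤ) (j : Fin n), v j ≠ 0 → (∀ l, j < l → v l = 0) →
    9 / 5 * tw t j ≤ qf S fun i => (v i : ℝ)
  up : ∀ a b : Fin n, a ≤ b → |S a b| ≤ C * tw t a
  diag : ∀ a : Fin n, (a : ℕ) < 2 → S a a ≤ 11 / 5
  off : ∀ a b : Fin n, (a : ℕ) < 2 → (b : ℕ) < 2 → a ≠ b → 1 / 2 ≤ S a b
  blk : ∀ v : Fin n → ℝ, (∀ l : Fin n, 2 ≤ (l : ℕ) → v l = 0) → 1 / 2 * (v ⬝ᵥ v) ≤ qf S v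

theorem qf_sum {N : ℕ} (c : Fin N → ℝ) (S : Fin N → Matrix (Fin n) (Fin n) ℝ) (v : Fin n → ℝ) :
    qf (∑ i, c i • S i) v = ∑ i, c i * qf (S i) v := by
  rw [qf, sum_mulVec, dotProduct_sum]
  exact Finset.sum_congr rfl fun i _ => by rw [smul_mulVec, dotProduct_smul, smul_eq_mul, qf]

theorem Adm.sum {C t : ℝ} {N : ℕ} {c : Fin N → ℝ} {S : Fin N → Matrix (Fin n) (Fin n) ℝ}
    (hS : ∀ i, Adm C t (S i)) (hc : ∀ i, 0 ≤ c i) (h1 : ∑ i, c i = 1) :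
    Adm C t (∑ i, c i • S i) := by
  have conv : ∀ (f : Fin N → ℝ) (b : ℝ), (∀ i, b ≤ f i) → b ≤ ∑ i, c i * f i := by
    intro f b h
    calc b = ∑ i, c i * b := by rw [← Finset.sum_mul, h1, one_mul]
      _ ≤ _ := Finset.sum_le_sum fun i _ => mul_le_mul_of_nonneg_left (h i) (hc i)
  have conv' : ∀ (f : Fin N → ℝ) (b : ℝ), (∀ i, f i ≤ b) → ∑ i, c i * f i ≤ b := by
    intro f b h
    calc _ ≤ ∑ i, c i * b := Finset.sum_le_sum fun i _ => mul_le_mul_of_nonneg_left (h i) (hc i)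
      _ = b := by rw [← Finset.sum_mul, h1, one_mul]
  have entry : ∀ a b, (∑ i, c i • S i) a b = ∑ i, c i * S i a b := fun a b => by
    rw [Matrix.sum_apply]; rfl
  constructor
  · rw [transpose_sum]
    exact Finset.sum_congr rfl fun i _ => by rw [transpose_smul, (hS i).symm]
  · intro v j h h'
    rw [qf_sum]
    exact conv _ _ fun i => (hS i).low v j h h'
  · intro a b hab
    rw [entry, abs_le]
    exact ⟨conv _ _ fun i => (abs_le.mp ((hS i).up a b hab)).1,
      conv' _ _ fun i => (abs_le.mp ((hS i).up a b hab)).2⟩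
  · intro a ha
    rw [entry]
    exact conv' _ _ fun i => (hS i).diag a ha
  · intro a b ha hb hab
    rw [entry]
    exact conv _ _ fun i => (hS i).off a b ha hb hab
  · intro v hv
    rw [qf_sum]
    exact conv _ _ fun i => (hS i).blk v hv

theorem Adm.low' {C t : ℝ} {S : Matrix (Fin n) (Fin n) ℝ} (hS : Adm C t S) (ht : 1 ≤ t)
    {v : Fin n → ℤ} (hv : v ≠ 0) : 9 / 5 ≤ qf S fun i => (v i : ℝ) := by
  classical
  obtain ⟨i, hi⟩ := Function.ne_iff.mp hv
  have hne : (univ.filter fun i => v i ≠ 0).Nonempty := ⟨i, by simpa using hi⟩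
  have hj := Finset.max'_mem _ hne
  set j := (univ.filter fun i => v i ≠ 0).max' hne
  have := hS.low v j (by simpa using hj) fun l hl => by
    by_contra h
    exact absurd (Finset.le_max' (univ.filter fun i => v i ≠ 0) l (by simpa using h))
      (not_le.mpr hl)
  have h1 := one_le_tw ht (j : ℕ)
  linarith

theorem Adm.nonneg {C t : ℝ} {S : Matrix (Fin n) (Fin n) ℝ} (hS : Adm C t S) (ht : 1 ≤ t)
    (v : Fin n → ℤ) : 0 ≤ qf S fun i => (v i : ℝ) := by
  by_cases hv : v = 0
  · subst hv; simp [qf]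
  · have := hS.low' ht hv
    linarith

theorem qf_split {D : Matrix (Fin n) (Fin n) ℝ}
    (hD : ∀ i j : Fin n, i ≠ j → 2 ≤ (i : ℕ) ∨ 2 ≤ (j : ℕ) → D i j = 0) (v : Fin n → ℝ) :
    qf D v = qf D (fun j => if (j : ℕ) < 2 then v j else 0) +
      ∑ j : Fin n, if 2 ≤ (j : ℕ) then D j j * (v j * v j) else 0 := by
  rw [qf_eq_sum, qf_eq_sum, ← Finset.sum_add_distrib]
  refine Finset.sum_congr rfl fun i _ => ?_
  by_cases hi : 2 ≤ (i : ℕ)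
  · rw [if_pos hi, if_neg (by omega), Finset.sum_eq_single i]
    · simp; ring
    · intro j _ hj
      rw [hD i j hj.symm (Or.inl hi)]; ring
    · simp
  · rw [if_neg hi, if_pos (by omega), add_zero]
    refine Finset.sum_congr rfl fun j _ => ?_
    by_cases hj : 2 ≤ (j : ℕ)
    · rw [hD i j (fun h => hi (h ▸ hj)) (Or.inr hj)]; ring
    · rw [if_pos (by omega)]

/-- The shape of the bases diagonalizing an admissible form. -/
def Compat {R : Type*} [CommRing R] (m : Matrix (Fin n) (Fin n) R) : Prop :=
  (∀ l a : Fin n, 2 ≤ (l : ℕ) → (a : ℕ) < 2 → m l a = 0) ∧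
  ∃ σ : Equiv.Perm (Fin n), (∀ a : Fin n, 2 ≤ (a : ℕ) → 2 ≤ (σ a : ℕ)) ∧
    ∀ a : Fin n, 2 ≤ (a : ℕ) → (∀ l, a < l → m l (σ a) = 0) ∧ (m a (σ a) = 1 ∨ m a (σ a) = -1)

theorem Compat.map {R R' : Type*} [CommRing R] [CommRing R'] {m : Matrix (Fin n) (Fin n) R}
    (h : Compat m) (f : R →+* R') : Compat (m.map f) := by
  obtain ⟨h1, σ, h2, h3⟩ := h
  refine ⟨fun l a hl ha => by simp [h1 l a hl ha], σ, h2, fun a ha => ⟨fun l hl => by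
    simp [(h3 a ha).1 l hl], ?_⟩⟩
  rcases (h3 a ha).2 with h | h
  · left; simp [h]
  · right; simp [h]

section Shape
variable {C t : ℝ} {S : Matrix (Fin n) (Fin n) ℝ} {h : SpecialLinearGroup (Fin n) ℤ}

theorem rl_apply (g : SpecialLinearGroup (Fin n) ℤ) (i j : Fin n) : rl g i j = (g.1 i j : ℝ) := rfl

theorem eq_conj_inv (S : Matrix (Fin n) (Fin n) ℝ) (h : SpecialLinearGroup (Fin n) ℤ) :
    S = (rl h⁻¹)ᵀ * ((rl h)ᵀ * S * rl h) * rl h⁻¹ := by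
  have e1 : (rl h⁻¹)ᵀ * (rl h)ᵀ = 1 := by rw [← transpose_mul, rl_mul_inv, transpose_one]
  calc S = ((rl h⁻¹)ᵀ * (rl h)ᵀ) * S * (rl h * rl h⁻¹) := by
        rw [e1, rl_mul_inv, one_mul, mul_one]
    _ = _ := by simp only [mul_assoc]

theorem conj_diag (S : Matrix (Fin n) (Fin n) ℝ) (h : SpecialLinearGroup (Fin n) ℤ) (j : Fin n) :
    ((rl h)ᵀ * S * rl h) j j = qf S fun i => (h.1 i j : ℝ) := by
  refine (qf_single _ j).symm.trans ?_
  rw [qf_conj]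
  congr 1
  ext i
  simp

theorem diag_expand (ho : Orth S (rl h)) (hS : Sᵀ = S) (a : Fin n) :
    S a a = qf S (fun i => ((h.1 *ᵥ fun j => if (j : ℕ) < 2 then (h⁻¹).1 j a else 0) i : ℤ)) +
      ∑ j : Fin n, if 2 ≤ (j : ℕ) then
        (qf S fun i => (h.1 i j : ℝ)) * (((h⁻¹).1 j a : ℝ) * ((h⁻¹).1 j a : ℝ)) else 0 := by
  refine (qf_single S a).symm.trans ?_
  conv_lhs => rw [eq_conj_inv S h, qf_conj,
    qf_split (fun i j hij h2 => ho.apply hS hij h2), qf_conj]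
  congr 1
  · congr 1
    ext i
    simp only [mulVec, dotProduct, Int.cast_sum, Int.cast_mul]
    refine Finset.sum_congr rfl fun j _ => ?_
    congr 1
    split_ifs
    · exact congrFun (mulVec_single_one (rl h⁻¹) a) j
    · simp
  · refine Finset.sum_congr rfl fun j _ => ?_
    rw [conj_diag]
    simp

theorem mulVec_ne_zero (h : SpecialLinearGroup (Fin n) ℤ) {v : Fin n → ℤ} (hv : v ≠ 0) :
    h.1 *ᵥ v ≠ 0 := by
  intro h0
  apply hv
  have h1 : (h⁻¹).1 * h.1 = 1 := congrArg Subtype.val (inv_mul_cancel h)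
  rw [← one_mulVec v, ← h1, ← mulVec_mulVec, h0, mulVec_zero]

theorem col_ne_zero (h : SpecialLinearGroup (Fin n) ℤ) (j : Fin n) : (fun i => h.1 i j) ≠ 0 := by
  have := mulVec_ne_zero h (v := Pi.single j 1) (by simp)
  intro h0
  apply this
  ext i
  simpa using congrFun h0 i

theorem Adm.term_le (hS : Adm C t S) (ht : 1 ≤ t) (ho : Orth S (rl h)) {j a : Fin n}
    (hj : 2 ≤ (j : ℕ)) (hK : (h⁻¹).1 j a ≠ 0) : qf S (fun i => (h.1 i j : ℝ)) ≤ S a a := by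
  have key : ∀ i : Fin n, 0 ≤ if 2 ≤ (i : ℕ) then (qf S fun l => (h.1 l i : ℝ)) *
      (((h⁻¹).1 i a : ℝ) * ((h⁻¹).1 i a : ℝ)) else 0 := fun i => by
    split_ifs
    · exact mul_nonneg (hS.nonneg ht _) (mul_self_nonneg _)
    · rfl
  have h1 := Finset.single_le_sum (f := fun i : Fin n => if 2 ≤ (i : ℕ) then
    (qf S fun l => (h.1 l i : ℝ)) * (((h⁻¹).1 i a : ℝ) * ((h⁻¹).1 i a : ℝ)) else 0)
    (fun i _ => key i) (mem_univ j)
  rw [if_pos hj] at h1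
  have h2 : (1 : ℝ) ≤ ((h⁻¹).1 j a : ℝ) * ((h⁻¹).1 j a : ℝ) := by
    have : (1 : ℤ) ≤ (h⁻¹).1 j a * (h⁻¹).1 j a := mul_self_pos.mpr hK
    exact_mod_cast this
  have h3 := hS.nonneg ht fun i => h.1 i j
  rw [diag_expand ho hS.symm a]
  have h4 := hS.nonneg ht (h.1 *ᵥ fun j => if (j : ℕ) < 2 then (h⁻¹).1 j a else 0)
  nlinarith

theorem Adm.col_eq_zero (hS : Adm C t S) (ht : 1 ≤ t) (ho : Orth S (rl h)) {j a : Fin n}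
    (hj : 2 ≤ (j : ℕ)) (ha : (a : ℕ) < 2) (hK : (h⁻¹).1 j a ≠ 0) {i : Fin n} (hi : i ≠ j) :
    (h⁻¹).1 i a = 0 := by
  by_contra hi0
  have hd := hS.diag a ha
  rw [diag_expand ho hS.symm a] at hd
  have hsq : ∀ m, (h⁻¹).1 m a ≠ 0 → 2 ≤ (m : ℕ) → 9 / 5 ≤ (if 2 ≤ (m : ℕ) then
      (qf S fun l => (h.1 l m : ℝ)) * (((h⁻¹).1 m a : ℝ) * ((h⁻¹).1 m a : ℝ)) else 0) := by
    intro m hm hm2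
    rw [if_pos hm2]
    have h2 : (1 : ℝ) ≤ ((h⁻¹).1 m a : ℝ) * ((h⁻¹).1 m a : ℝ) := by
      have : (1 : ℤ) ≤ (h⁻¹).1 m a * (h⁻¹).1 m a := mul_self_pos.mpr hm
      exact_mod_cast this
    have h3 := hS.low' ht (col_ne_zero h m)
    nlinarith
  have key : ∀ i : Fin n, 0 ≤ if 2 ≤ (i : ℕ) then (qf S fun l => (h.1 l i : ℝ)) *
      (((h⁻¹).1 i a : ℝ) * ((h⁻¹).1 i a : ℝ)) else 0 := fun i => by
    split_ifs
    · exact mul_nonneg (hS.nonneg ht _) (mul_self_nonneg _)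
    · rfl
  by_cases hi2 : 2 ≤ (i : ℕ)
  · have h1 := Finset.add_le_sum (f := fun i : Fin n => if 2 ≤ (i : ℕ) then
      (qf S fun l => (h.1 l i : ℝ)) * (((h⁻¹).1 i a : ℝ) * ((h⁻¹).1 i a : ℝ)) else 0)
      (fun i _ => key i) (mem_univ i) (mem_univ j) hi
    have h2 := hsq i hi0 hi2
    have h3 := hsq j hK hj
    have h4 := hS.nonneg ht (h.1 *ᵥ fun j => if (j : ℕ) < 2 then (h⁻¹).1 j a else 0)
    linarith
  · have h1 := Finset.single_le_sum (f := fun i : Fin n => if 2 ≤ (i : ℕ) then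
      (qf S fun l => (h.1 l i : ℝ)) * (((h⁻¹).1 i a : ℝ) * ((h⁻¹).1 i a : ℝ)) else 0)
      (fun i _ => key i) (mem_univ j)
    have h3 := hsq j hK hj
    have h4 := hS.low' ht (v := h.1 *ᵥ fun j => if (j : ℕ) < 2 then (h⁻¹).1 j a else 0)
      (mulVec_ne_zero h fun h0 => hi0 (by
        have := congrFun h0 i
        simpa [show (i : ℕ) < 2 by omega] using this))
    linarith

theorem Adm.inv_block (hS : Adm C t S) (ht : 1 ≤ t) (ho : Orth S (rl h)) {j a : Fin n}
    (hj : 2 ≤ (j : ℕ)) (ha : (a : ℕ) < 2) : (h⁻¹).1 j a = 0 := by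
  by_contra hK
  have hb' : 1 - (a : ℕ) < n := by have := j.2; omega
  obtain ⟨b, hb⟩ : ∃ b : Fin n, (b : ℕ) = 1 - (a : ℕ) := ⟨⟨_, hb'⟩, rfl⟩
  have hab : a ≠ b := fun h => by rw [h] at hb ha; omega
  have hcol := fun i hi => hS.col_eq_zero ht ho hj ha hK (i := i) hi
  have hoff := hS.off a b ha (by omega) hab
  have hKb : (h⁻¹).1 j b ≠ 0 := by
    intro h0
    have : S a b = 0 := by
      rw [eq_conj_inv S h, Matrix.mul_apply]
      refine Finset.sum_eq_zero fun m _ => ?_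
      rw [Matrix.mul_apply, Finset.sum_mul]
      refine Finset.sum_eq_zero fun i _ => ?_
      by_cases hi : i = j
      · subst hi
        by_cases hm : m = i
        · subst hm
          rw [rl_apply h⁻¹ m b, h0]; simp
        · rw [ho.apply hS.symm (Ne.symm hm) (Or.inl hj)]; ring
      · rw [transpose_apply, rl_apply, hcol i hi]; simp
    linarith
  have hcolb := fun i hi => hS.col_eq_zero ht ho hj (by omega) hKb (i := i) hi
  have h1 : h.1 * (h⁻¹).1 = 1 := congrArg Subtype.val (mul_inv_cancel h)
  have e1 := congrFun (congrFun h1 b) a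
  have e2 := congrFun (congrFun h1 b) b
  rw [Matrix.mul_apply, Finset.sum_eq_single j (fun i _ hi => by rw [hcol i hi, mul_zero])
    (by simp), one_apply_ne hab.symm] at e1
  rw [Matrix.mul_apply, Finset.sum_eq_single j (fun i _ hi => by rw [hcolb i hi, mul_zero])
    (by simp), one_apply_eq] at e2
  rcases mul_eq_zero.mp e1 with h | h
  · rw [h, zero_mul] at e2; exact zero_ne_one e2
  · exact hK h

theorem Adm.col_bound (hS : Adm C t S) (ht : 1 ≤ t) (htC : C < 9 / 5 * t) (ho : Orth S (rl h))
    {j a : Fin n} (hj : 2 ≤ (j : ℕ)) (hK : (h⁻¹).1 j a ≠ 0) (ha : 2 ≤ (a : ℕ)) {l : Fin n}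
    (hl : a < l) : h.1 l j = 0 := by
  classical
  by_contra hne0
  have hne : (univ.filter fun i => h.1 i j ≠ 0).Nonempty := ⟨l, by simpa using hne0⟩
  have hm := Finset.max'_mem _ hne
  have hlm := Finset.le_max' (univ.filter fun i => h.1 i j ≠ 0) l (by simpa using hne0)
  set m := (univ.filter fun i => h.1 i j ≠ 0).max' hne
  have h1 := hS.low (fun i => h.1 i j) m (by simpa using hm) fun i hi => by
    by_contra hh
    exact absurd (Finset.le_max' (univ.filter fun i => h.1 i j ≠ 0) i (by simpa using hh))
      (not_le.mpr hi)
  have h2 := hS.term_le ht ho hj hK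
  have h3 := (le_abs_self _).trans (hS.up a a le_rfl)
  have ham : (a : ℕ) < m := lt_of_lt_of_le hl hlm
  have h4 := mul_tw_le ht ham (by omega)
  have h5 := one_le_tw ht (a : ℕ)
  nlinarith

theorem blockTriangular_inv {α : Type*} [LinearOrder α] (b : Fin n → α)
    (h : SpecialLinearGroup (Fin n) ℤ) (hb : BlockTriangular h.1 b) :
    BlockTriangular (h⁻¹).1 b := by
  have h1 : (h⁻¹).1 * h.1 = 1 := congrArg Subtype.val (inv_mul_cancel h)
  have h2 : h.1 * (h⁻¹).1 = 1 := congrArg Subtype.val (mul_inv_cancel h)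
  let i : Invertible h.1 := ⟨(h⁻¹).1, h1, h2⟩
  have := blockTriangular_inv_of_blockTriangular hb
  rwa [Matrix.inv_eq_left_inv h1] at this

theorem Adm.compat (hS : Adm C t S) (ht : 1 ≤ t) (htC : C < 9 / 5 * t) (ho : Orth S (rl h)) :
    Compat h.1 := by
  have hlow : ∀ l a : Fin n, 2 ≤ (l : ℕ) → (a : ℕ) < 2 → h.1 l a = 0 := by
    have hb : BlockTriangular (h⁻¹).1 fun i : Fin n => min (i : ℕ) 2 / 2 := by
      intro i j hij
      change min (j : ℕ) 2 / 2 < min (i : ℕ) 2 / 2 at hij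
      exact hS.inv_block ht ho (by omega) (by omega)
    have := blockTriangular_inv _ _ hb
    rw [inv_inv] at this
    intro l a hl ha
    exact this (show min (a : ℕ) 2 / 2 < min (l : ℕ) 2 / 2 by omega)
  refine ⟨hlow, ?_⟩
  obtain ⟨σ, hσ⟩ : ∃ σ : Equiv.Perm (Fin n), ∀ a, (h⁻¹).1 (σ a) a ≠ 0 := by
    by_contra! hc
    have : (h⁻¹).1.det = 0 := by
      rw [det_apply]
      refine Finset.sum_eq_zero fun σ _ => ?_
      obtain ⟨a, ha⟩ := hc σ
      have h0 : ∏ i, (h⁻¹).1 (σ i) i = 0 := Finset.prod_eq_zero (mem_univ a) ha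
      exact (congrArg (fun x : ℤ => Equiv.Perm.sign σ • x) h0).trans (smul_zero _)
    rw [(h⁻¹).2] at this
    exact one_ne_zero this
  have hσ1 : ∀ a : Fin n, (a : ℕ) < 2 → (σ a : ℕ) < 2 := fun a ha => by
    by_contra hh
    exact hσ a (hS.inv_block ht ho (by omega) ha)
  have hσ2 : ∀ a : Fin n, 2 ≤ (a : ℕ) → 2 ≤ (σ a : ℕ) := by
    intro a ha
    by_contra hh
    have := Equiv.Perm.perm_symm_on_of_perm_on_finite (f := σ) hσ1 (show (σ a : ℕ) < 2 by omega)
    rw [Equiv.symm_apply_apply] at this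
    omega
  refine ⟨σ, hσ2, fun a ha => ⟨fun l hl => hS.col_bound ht htC ho (hσ2 a ha) (hσ a) ha hl, ?_⟩⟩
  have h1 : (h⁻¹).1 * h.1 = 1 := congrArg Subtype.val (inv_mul_cancel h)
  have h2 : h.1 * (h⁻¹).1 = 1 := congrArg Subtype.val (mul_inv_cancel h)
  let A : Matrix (Fin n) (Fin n) ℤ := h.1.submatrix id σ
  let B : Matrix (Fin n) (Fin n) ℤ := (h⁻¹).1.submatrix σ id
  have hBA : B * A = 1 := by
    have : B * A = ((h⁻¹).1 * h.1).submatrix σ σ := by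
      ext i j; simp [A, B, Matrix.mul_apply]
    rw [this, h1, submatrix_one_equiv]
  have hAB : A * B = 1 := mul_eq_one_comm.mp hBA
  have hA : BlockTriangular A fun i : Fin n => max (i : ℕ) 1 := by
    intro i j hij
    change h.1 i (σ j) = 0
    change max (j : ℕ) 1 < max (i : ℕ) 1 at hij
    by_cases hj : 2 ≤ (j : ℕ)
    · exact hS.col_bound ht htC ho (hσ2 j hj) (hσ j) hj (show (j : ℕ) < i by omega)
    · exact hlow _ _ (by omega) (hσ1 j (by omega))
  have hB : BlockTriangular B fun i : Fin n => max (i : ℕ) 1 := by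
    let i : Invertible A := ⟨B, hBA, hAB⟩
    have := blockTriangular_inv_of_blockTriangular hA
    rwa [Matrix.inv_eq_left_inv hBA] at this
  have h3 := congrFun (congrFun hBA a) a
  rw [Matrix.mul_apply, one_apply_eq, Finset.sum_eq_single a] at h3
  · exact Int.isUnit_iff.mp (IsUnit.of_mul_eq_one _ ((mul_comm _ _).trans h3))
  · intro l _ hl
    have hl' : (l : ℕ) ≠ a := fun h => hl (Fin.ext h)
    rcases lt_or_gt_of_ne hl' with hlt | hgt
    · rw [hB (show max (l : ℕ) 1 < max (a : ℕ) 1 by omega), zero_mul]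
    · rw [hA (show max (a : ℕ) 1 < max (l : ℕ) 1 by omega), mul_zero]
  · simp

end Shape
end Adm

section Unipotent
variable {n p : ℕ}

theorem pattern_inv {R : Type*} [CommRing R] {A B : Matrix (Fin n) (Fin n) R}
    (hA : ∀ i j, ¬ IsPos i j → A i j = (1 : Matrix (Fin n) (Fin n) R) i j) (h : A * B = 1)
    (i j : Fin n) (hij : ¬ IsPos i j) : B i j = (1 : Matrix (Fin n) (Fin n) R) i j := by
  have h' : B * A = 1 := mul_eq_one_comm.mp h
  have hT : BlockTriangular A id := fun i j hij => by
    rw [hA i j (fun h => lt_asymm h.1 hij), one_apply_ne (show j < i from hij).ne']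
  have hB : BlockTriangular B id := by
    let i : Invertible A := ⟨B, h', h⟩
    have := blockTriangular_inv_of_blockTriangular hT
    rwa [Matrix.inv_eq_left_inv h'] at this
  rw [← h, Matrix.mul_apply, Finset.sum_eq_single i, hA i i fun h => h.1.false, one_apply_eq,
    one_mul]
  · intro l _ hl
    by_cases hjl : j < l
    · rw [hB hjl, mul_zero]
    · have hil : ¬ IsPos i l := fun h => hij ⟨lt_of_lt_of_le h.1 (not_lt.mp hjl),
        h.2.trans (not_lt.mp hjl)⟩
      rw [hA i l hil, one_apply_ne hl.symm, zero_mul]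
  · simp

theorem det_pattern {R : Type*} [CommRing R] {A : Matrix (Fin n) (Fin n) R}
    (hA : ∀ i j, ¬ IsPos i j → A i j = (1 : Matrix (Fin n) (Fin n) R) i j) : A.det = 1 := by
  have hT : BlockTriangular A id := fun i j hij => by
    rw [hA i j (fun h => lt_asymm h.1 hij), one_apply_ne (show j < i from hij).ne']
  rw [det_of_isUpperTriangular hT]
  exact Finset.prod_eq_one fun i _ => by rw [hA i i fun h => h.1.false, one_apply_eq]

theorem UniPat.inv {x : SpecialLinearGroup (Fin n) ℤ} (h : UniPat x.1) : UniPat (x⁻¹).1 :=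
  pattern_inv h (congrArg Subtype.val (mul_inv_cancel x))

theorem InBlock.inv {x : SpecialLinearGroup (Fin n) ℤ} (h : InBlock x) : InBlock x⁻¹ := by
  intro i j hij
  have h1 : (x⁻¹).1 * x.1 = 1 := congrArg Subtype.val (inv_mul_cancel x)
  have h2 : x.1 * (x⁻¹).1 = 1 := congrArg Subtype.val (mul_inv_cancel x)
  rcases hij with hi | hj
  · rw [← h2, Matrix.mul_apply]
    simp only [h i _ (Or.inl hi), one_apply, ite_mul, one_mul, zero_mul, Finset.sum_ite_eq,
      mem_univ, if_true]
  · rw [← h1, Matrix.mul_apply]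
    simp only [h _ j (Or.inr hj), one_apply, mul_ite, mul_one, mul_zero, Finset.sum_ite_eq',
      mem_univ, if_true]

/-- A compatible permutation that only moves indices down is the identity. -/
theorem perm_eq_of_le {σ : Equiv.Perm (Fin n)} (h2 : ∀ a : Fin n, 2 ≤ (a : ℕ) → 2 ≤ (σ a : ℕ))
    (hle : ∀ a : Fin n, 2 ≤ (a : ℕ) → σ a ≤ a) (a : Fin n) (ha : 2 ≤ (a : ℕ)) : σ a = a := by
  induction hN : (a : ℕ) using Nat.strong_induction_on generalizing a with
  | _ N ih =>
    subst hN
    rcases (hle a ha).lt_or_eq with h | h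
    · exact σ.injective (ih (σ a) h (σ a) (h2 a ha) rfl)
    · exact h

theorem exists_factor (hp : 3 ≤ p) {h : congruenceSubgroup n p} (hc : Compat h.1.1) :
    ∃ ν : congruenceSubgroup n p, ν.1 ∈ radical n p ∧ ν⁻¹ * h ∈ blockSub n p := by
  have : Fact (1 < p) := ⟨by omega⟩
  obtain ⟨h1, σ, h2, h3⟩ := hc
  have hmod := fun i j => dvd_of_mem_congruence h.2 i j
  have hσ : ∀ a : Fin n, 2 ≤ (a : ℕ) → σ a = a := perm_eq_of_le h2 fun a ha => by
    by_contra hlt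
    have := (h3 a ha).1 _ (not_le.mp hlt)
    have h4 := hmod (σ a) (σ a)
    rw [show ((h.1 : Matrix (Fin n) (Fin n) ℤ) (σ a) (σ a) : ℤ) = 0 from this, one_apply_eq] at h4
    simp at h4
  have hlow : ∀ a : Fin n, 2 ≤ (a : ℕ) → ∀ l, a < l → h.1.1 l a = 0 := fun a ha l hl => by
    have := (h3 a ha).1 l hl
    rwa [hσ a ha] at this
  have hdiag : ∀ a : Fin n, 2 ≤ (a : ℕ) → h.1.1 a a = 1 := fun a ha => by
    have h4 := (h3 a ha).2
    rw [hσ a ha] at h4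
    refine h4.resolve_right fun h5 => ?_
    have h6 := hmod a a
    rw [show ((h.1 : Matrix (Fin n) (Fin n) ℤ) a a : ℤ) = -1 from h5, one_apply_eq] at h6
    have h7 : ((2 : ℕ) : ZMod p) = 0 := by
      push_cast at h6 ⊢
      linear_combination -h6
    rw [ZMod.natCast_eq_zero_iff] at h7
    exact absurd (Nat.le_of_dvd two_pos h7) (by omega)
  let A : Matrix (Fin n) (Fin n) ℤ := of fun i j =>
    if (j : ℕ) < 2 then (1 : Matrix (Fin n) (Fin n) ℤ) i j else h.1.1 i j
  have hA : UniPat A := by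
    intro i j hij
    by_cases hj : (j : ℕ) < 2
    · simp only [A, of_apply, if_pos hj]
    · simp only [A, of_apply, if_neg hj]
      rcases lt_trichotomy i j with hl | rfl | hl
      · exact absurd ⟨hl, by omega⟩ hij
      · rw [hdiag _ (by omega), one_apply_eq]
      · rw [hlow j (by omega) i hl, one_apply_ne hl.ne']
  let ν : SpecialLinearGroup (Fin n) ℤ := ⟨A, det_pattern hA⟩
  have hνΓ : ν ∈ congruenceSubgroup n p := mem_congruence_iff.mpr fun i j => by
    change ((A i j : ℤ) : ZMod p) = _
    by_cases hj : (j : ℕ) < 2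
    · simp only [A, of_apply, if_pos hj, one_apply]
      split_ifs <;> simp
    · simp only [A, of_apply, if_neg hj]
      exact hmod i j
  have hB : InBlock (ν⁻¹ * h.1) := by
    have h1' : (ν⁻¹).1 * A = 1 := congrArg Subtype.val (inv_mul_cancel ν)
    have hpat : UniPat (ν⁻¹).1 := UniPat.inv (x := ν) hA
    intro i j hij
    change ((ν⁻¹).1 * h.1.1) i j = _
    by_cases hj : (j : ℕ) < 2
    · have hi : 2 ≤ (i : ℕ) := hij.resolve_right (by omega)
      rw [one_apply_ne (fun h => by rw [h] at hi; omega), Matrix.mul_apply]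
      refine Finset.sum_eq_zero fun l _ => ?_
      by_cases hl : (l : ℕ) < 2
      · rw [hpat i l (fun h => by have := h.2; omega),
          one_apply_ne (fun h => by rw [h] at hi; omega), zero_mul]
      · rw [h1 l j (by omega) hj, mul_zero]
    · rw [← h1', Matrix.mul_apply, Matrix.mul_apply]
      refine Finset.sum_congr rfl fun l _ => ?_
      simp only [A, of_apply, if_neg hj]
  exact ⟨⟨ν, hνΓ⟩, ⟨hνΓ, hA, UniPat.inv (x := ν) hA⟩, hB, hB.inv⟩

theorem exists_entry_bound (n : ℕ) {C : ℝ} (hC : 0 ≤ C) : ∃ β : ℝ, ∀ t, 1 ≤ t →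
    ∀ S : Matrix (Fin n) (Fin n) ℝ, Adm C t S → ∀ ν : SpecialLinearGroup (Fin n) ℤ, UniPat ν.1 →
      Orth S (rl ν) → ∀ l a, |(ν.1 l a : ℝ)| ≤ β := by
  suffices H : ∀ N : ℕ, ∃ β : ℝ, 1 ≤ β ∧ ∀ t, 1 ≤ t →
      ∀ S : Matrix (Fin n) (Fin n) ℝ, Adm C t S → ∀ ν : SpecialLinearGroup (Fin n) ℤ,
        UniPat ν.1 → Orth S (rl ν) → ∀ l a : Fin n, (a : ℕ) < N → |(ν.1 l a : ℝ)| ≤ β by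
    obtain ⟨β, -, h⟩ := H n
    exact ⟨β, fun t ht S hS ν hν ho l a => h t ht S hS ν hν ho l a a.2⟩
  intro N
  induction N with
  | zero => exact ⟨1, le_rfl, fun t ht S hS ν hν ho l a ha => absurd ha (by omega)⟩
  | succ N ih =>
    obtain ⟨β, hβ1, hβ⟩ := ih
    set κ : ℝ := 2 * n * C + C * n * β with hκ
    have hκ0 : 0 ≤ κ := by positivity
    refine ⟨β + 1 + n * (β * κ), by have : 0 ≤ n * (β * κ) := by positivity
                                    linarith, fun t ht S hS ν hν ho l a ha => ?_⟩
    have hadd : 0 ≤ n * (β * κ) := by positivity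
    rcases Nat.lt_or_ge a N with haN | haN
    · have := hβ t ht S hS ν hν ho l a haN
      linarith
    have haN : (a : ℕ) = N := by omega
    have hK : UniPat (ν⁻¹).1 := hν.inv
    have hD := fun (i j : Fin n) (hij : i ≠ j) h2 => ho.apply hS.symm hij h2
    have hrel : (rl ν)ᵀ * S = ((rl ν)ᵀ * S * rl ν) * rl ν⁻¹ := by
      rw [mul_assoc _ (rl ν), rl_mul_inv, mul_one]
    -- bounds for the rows of the inverse above `a`
    have hrow : ∀ m : Fin n, m < a → |((ν⁻¹).1 m a : ℝ)| ≤ κ := by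
      intro m hma
      have hma' : (m : ℕ) < a := hma
      by_cases ha2 : (a : ℕ) < 2
      · rw [hK m a (fun h => by have := h.2; omega), one_apply_ne hma.ne]
        simpa using hκ0
      by_cases hm : 2 ≤ (m : ℕ)
      · have e1 := congrFun (congrFun hrel m) a
        rw [Matrix.mul_apply, Matrix.mul_apply (N := rl ν⁻¹)] at e1
        replace e1 := e1.trans (Finset.sum_eq_single m
          (fun i _ hi => by rw [hD m i hi.symm (Or.inl hm), zero_mul]) (by simp))
        rw [conj_diag, rl_apply] at e1
        have hlow := hS.low (fun i => ν.1 i m) m (by rw [hν.apply_self]; exact one_ne_zero)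
          fun l hl => by
            rw [hν l m (fun h => lt_asymm h.1 hl), one_apply_ne hl.ne']
        have hT := one_le_tw ht (m : ℕ)
        have hub : |∑ j, (rl ν)ᵀ m j * S j a| ≤ n * (β * (C * tw t m)) := by
          refine (Finset.abs_sum_le_sum_abs _ _).trans ?_
          refine (Finset.sum_le_card_nsmul _ _ (β * (C * tw t m)) fun j _ => ?_).trans
            (by simp)
          rw [abs_mul, transpose_apply, rl_apply]
          by_cases hjm : j ≤ m
          · refine mul_le_mul (hβ t ht S hS ν hν ho j m (by omega)) ?_ (abs_nonneg _) (by linarith)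
            exact (hS.up j a (hjm.trans hma.le)).trans
              (mul_le_mul_of_nonneg_left (tw_mono ht hjm) hC)
          · rw [hν j m (fun h => hjm h.1.le), one_apply_ne (fun h => hjm h.le)]
            simp only [Int.cast_zero, abs_zero, zero_mul]
            positivity
        rw [e1, abs_mul, abs_of_nonneg (hS.nonneg ht _)] at hub
        have h5 : tw t m * |((ν⁻¹).1 m a : ℝ)| ≤ tw t m * (C * n * β) := by
          have := mul_le_mul_of_nonneg_right hlow (abs_nonneg ((ν⁻¹).1 m a : ℝ))
          have h0 : 0 ≤ tw t m * |((ν⁻¹).1 m a : ℝ)| := by positivity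
          nlinarith
        have h6 := le_of_mul_le_mul_left h5 (by linarith)
        have : 0 ≤ 2 * n * C := by positivity
        linarith
      · let w : Fin n → ℝ := fun m => if (m : ℕ) < 2 then ((ν⁻¹).1 m a : ℝ) else 0
        have hblk := hS.blk w fun l hl => if_neg (by omega)
        have hSw : ∀ i : Fin n, (i : ℕ) < 2 → (S *ᵥ w) i = S i a := by
          intro i hi
          have hcol : ∀ j : Fin n, (j : ℕ) < 2 → rl ν *ᵥ Pi.single j 1 = Pi.single j 1 := by
            intro j hj
            ext l
            rw [mulVec_single_one]
            change rl ν l j = _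
            rw [rl_apply, hν l j (fun h => by have := h.2; omega), one_apply, Pi.single_apply]
            split_ifs <;> simp
          have hent : ∀ B : Matrix (Fin n) (Fin n) ℝ, ∀ j, ((rl ν)ᵀ * B) i j = B i j := by
            intro B j
            rw [Matrix.mul_apply, Finset.sum_eq_single i]
            · rw [transpose_apply, rl_apply, hν.apply_self, Int.cast_one, one_mul]
            · intro l _ hl
              rw [transpose_apply, rl_apply, hν l i (fun h => by have := h.2; omega),
                one_apply_ne hl, Int.cast_zero, zero_mul]
            · simp
          have e1 := congrFun (congrFun hrel i) a
          rw [hent, Matrix.mul_apply] at e1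
          rw [e1]
          change ∑ j, S i j * w j = _
          refine Finset.sum_congr rfl fun j _ => ?_
          by_cases hj : (j : ℕ) < 2
          · simp only [w, if_pos hj]
            congr 1
            rw [mul_assoc, hent, Matrix.mul_apply, Finset.sum_eq_single j]
            · rw [rl_apply, hν.apply_self, Int.cast_one, mul_one]
            · intro l _ hl
              rw [rl_apply, hν l j (fun h => by have := h.2; omega),
                one_apply_ne hl, Int.cast_zero, mul_zero]
            · simp
          · simp only [w, if_neg hj]
            rw [hD i j (fun h => hj (h ▸ hi)) (Or.inr (by omega))]
            simp
        have hub : qf S w ≤ C * ∑ i, |w i| := by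
          rw [qf, dotProduct, Finset.mul_sum]
          refine Finset.sum_le_sum fun i _ => ?_
          by_cases hi : (i : ℕ) < 2
          · rw [hSw i hi]
            have h1 := hS.up i a (show (i : ℕ) ≤ a by omega)
            rw [tw, show (i : ℕ) - 1 = 0 by omega, pow_zero, mul_one] at h1
            calc w i * S i a ≤ |w i * S i a| := le_abs_self _
              _ = |S i a| * |w i| := by rw [abs_mul, mul_comm]
              _ ≤ _ := mul_le_mul_of_nonneg_right h1 (abs_nonneg _)
          · have h0 : w i = 0 := if_neg hi
            simp [h0]
        have hcs := sq_sum_le_card_mul_sum_sq (s := (univ : Finset (Fin n))) (f := fun i => |w i|)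
        simp only [sq_abs, card_univ, Fintype.card_fin] at hcs
        have hww : ∑ i, w i ^ 2 = w ⬝ᵥ w := by simp only [dotProduct, sq]
        rw [hww] at hcs
        set M := ∑ i, |w i|
        have hM0 : 0 ≤ M := Finset.sum_nonneg fun i _ => abs_nonneg _
        have hM : M ≤ 2 * n * C := by
          rcases hM0.eq_or_lt with h0 | h0
          · rw [← h0]; positivity
          · have h1 : M * M ≤ 2 * n * C * M := by
              have : (n : ℝ) * (w ⬝ᵥ w) ≤ n * (2 * (C * M)) :=
                mul_le_mul_of_nonneg_left (by linarith) (by positivity)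
              nlinarith
            exact le_of_mul_le_mul_right h1 h0
        have hwm : |w m| ≤ M := Finset.single_le_sum (f := fun i => |w i|)
          (fun i _ => abs_nonneg _) (mem_univ m)
        simp only [w, if_pos (show (m : ℕ) < 2 by omega)] at hwm
        have : 0 ≤ C * n * β := by positivity
        linarith
    by_cases hla : l = a
    · subst hla
      rw [hν.apply_self]
      simp only [Int.cast_one, abs_one]
      linarith
    have h2 : ν.1 * (ν⁻¹).1 = 1 := congrArg Subtype.val (mul_inv_cancel ν)
    have e2 := congrFun (congrFun h2 l) a
    rw [one_apply_ne hla, Matrix.mul_apply, ← Finset.add_sum_erase _ _ (mem_univ a),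
      hK.apply_self, mul_one] at e2
    have e3 : (ν.1 l a : ℝ) = -∑ m ∈ univ.erase a, (ν.1 l m : ℝ) * ((ν⁻¹).1 m a : ℝ) := by
      have : ν.1 l a = -∑ m ∈ univ.erase a, ν.1 l m * (ν⁻¹).1 m a := by linarith
      rw [this]; push_cast; rfl
    rw [e3, abs_neg]
    have : |∑ m ∈ univ.erase a, (ν.1 l m : ℝ) * ((ν⁻¹).1 m a : ℝ)| ≤ n * (β * κ) := by
      refine (Finset.abs_sum_le_sum_abs _ _).trans ?_
      refine (Finset.sum_le_card_nsmul _ _ (β * κ) fun m hm => ?_).trans ?_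
      · rw [abs_mul]
        rcases lt_trichotomy m a with hlt | heq | hgt
        · have : (m : ℕ) < a := hlt
          exact mul_le_mul (hβ t ht S hS ν hν ho l m (by omega)) (hrow m hlt) (abs_nonneg _)
            (by linarith)
        · exact absurd heq (Finset.ne_of_mem_erase hm)
        · rw [hK m a (fun h => lt_asymm h.1 hgt), one_apply_ne hgt.ne']
          simp only [Int.cast_zero, abs_zero, mul_zero]
          positivity
      · rw [nsmul_eq_mul]
        refine mul_le_mul_of_nonneg_right ?_ (by positivity)
        exact_mod_cast (Finset.card_le_univ _).trans (by simp)
    linarith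

end Unipotent

end CodimOne

namespace CodimOne
open Finset Matrix Filter Topology

section Base
variable {n : ℕ}

/-- Real matrices supported, off the diagonal, on the positions, and with unit diagonal. -/
def Pat (A : Matrix (Fin n) (Fin n) ℝ) : Prop :=
  ∀ i j, ¬ IsPos i j → A i j = (1 : Matrix (Fin n) (Fin n) ℝ) i j

theorem UniPat.rl {ν : SpecialLinearGroup (Fin n) ℤ} (h : UniPat ν.1) : Pat (rl ν) := by
  intro i j hij
  rw [rl_apply, h i j hij, one_apply, one_apply]
  split_ifs <;> simp

theorem Pat.apply_self {A : Matrix (Fin n) (Fin n) ℝ} (h : Pat A) (i : Fin n) : A i i = 1 := by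
  rw [h i i fun h => h.1.false, one_apply_eq]

theorem Pat.le {A : Matrix (Fin n) (Fin n) ℝ} (h : Pat A) {i j : Fin n} (hij : A i j ≠ 0) :
    i ≤ j := by
  by_contra hlt
  exact hij (by rw [h i j fun h => hlt h.1.le, one_apply_ne (fun h => hlt h.le)])

theorem Pat.isPos {A : Matrix (Fin n) (Fin n) ℝ} (h : Pat A) {i j : Fin n} (hij : A i j ≠ 0)
    (hne : i ≠ j) : IsPos i j := by
  by_contra hp
  exact hij (by rw [h i j hp, one_apply_ne hne])

theorem Pat.mul {A B : Matrix (Fin n) (Fin n) ℝ} (hA : Pat A) (hB : Pat B) : Pat (A * B) := by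
  intro i j hij
  rw [Matrix.mul_apply, Finset.sum_eq_single i, hA.apply_self, one_mul, hB i j hij]
  · intro l _ hl
    by_contra hne
    obtain ⟨h1, h2⟩ := mul_ne_zero_iff.mp hne
    have h3 := hA.isPos h1 hl.symm
    have h4 := hB.le h2
    exact hij ⟨h3.1.trans_le h4, h3.2.trans h4⟩
  · simp

theorem exists_pat (s : Fin (numPos n) → ℝ) : ∃ R ρ : Matrix (Fin n) (Fin n) ℝ,
    Pat R ∧ Pat ρ ∧ ρ * R = 1 ∧ ∀ e, R (row e) (col e) = s e := by
  classical
  let R : Matrix (Fin n) (Fin n) ℝ := of fun i j =>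
    if h : IsPos i j then s (exists_pos h).choose else (1 : Matrix (Fin n) (Fin n) ℝ) i j
  have hR : Pat R := fun i j hij => by simp only [R, of_apply, dif_neg hij]
  have hu : IsUnit R.det := by rw [det_pattern hR]; exact isUnit_one
  refine ⟨R, R⁻¹, hR, pattern_inv hR (mul_nonsing_inv R hu), nonsing_inv_mul R hu, fun e => ?_⟩
  have h := isPos e
  simp only [R, of_apply, dif_pos h]
  have hne := (exists_pos h).choose_spec
  rw [pos_injective hne.1 hne.2]

/-- A lopsided form: hexagonal on the first block, diagonal with fast growing weights after. -/
noncomputable def base (t : ℝ) : Matrix (Fin n) (Fin n) ℝ := of fun i j =>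
  if i = j then 2 * tw t i else if (i : ℕ) < 2 ∧ (j : ℕ) < 2 then 1 else 0

theorem base_self (t : ℝ) (i : Fin n) : base t i i = 2 * tw t i := if_pos rfl

theorem base_eq_zero (t : ℝ) {i j : Fin n} (h : i ≠ j) (h2 : 2 ≤ (i : ℕ) ∨ 2 ≤ (j : ℕ)) :
    base t i j = 0 := by
  rw [base, of_apply, if_neg h, if_neg (by omega)]

theorem base_symm (t : ℝ) : (base t : Matrix (Fin n) (Fin n) ℝ)ᵀ = base t := by
  ext i j
  simp only [transpose_apply, base, of_apply]
  by_cases h : i = j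
  · subst h; rfl
  · simp only [if_neg h, if_neg (Ne.symm h), and_comm]

theorem abs_base_le {t : ℝ} (ht : 1 ≤ t) (i j : Fin n) : |base t i j| ≤ 2 * tw t i := by
  have h1 := one_le_tw ht (i : ℕ)
  rw [base, of_apply]
  split_ifs
  · rw [abs_of_nonneg (by linarith)]
  · rw [abs_one]; linarith
  · rw [abs_zero]; linarith

theorem qf_base (t : ℝ) (v : Fin n → ℝ) : qf (base t) v = ∑ i : Fin n, tw t i * (v i * v i) +
    ((∑ i : Fin n, if (i : ℕ) < 2 then v i else 0) ^ 2 +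
      ∑ i : Fin n, if (i : ℕ) < 2 then 0 else tw t i * (v i * v i)) := by
  have h1 : qf (base t - diagonal fun i : Fin n => tw t i) v =
      (∑ i : Fin n, if (i : ℕ) < 2 then v i else 0) ^ 2 +
        ∑ i : Fin n, if (i : ℕ) < 2 then 0 else tw t i * (v i * v i) := by
    rw [qf_eq_sum, sq, Finset.sum_mul_sum, ← Finset.sum_add_distrib]
    refine Finset.sum_congr rfl fun i _ => ?_
    by_cases hi : (i : ℕ) < 2
    · rw [if_pos hi, if_pos hi, add_zero]
      refine Finset.sum_congr rfl fun j _ => ?_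
      by_cases hij : i = j
      · subst hij
        rw [if_pos hi, Matrix.sub_apply, base_self, diagonal_apply_eq, tw,
          show (i : ℕ) - 1 = 0 by omega]
        ring
      · rw [Matrix.sub_apply, diagonal_apply_ne _ hij, base, of_apply, if_neg hij]
        by_cases hj : (j : ℕ) < 2
        · rw [if_pos hj, if_pos ⟨hi, hj⟩]; ring
        · rw [if_neg hj, if_neg (fun h => hj h.2)]; ring
    · simp only [if_neg hi, zero_mul, Finset.sum_const_zero, zero_add]
      rw [Finset.sum_eq_single i]
      · rw [Matrix.sub_apply, base_self, diagonal_apply_eq]; ring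
      · intro j _ hj
        rw [Matrix.sub_apply, base_eq_zero t hj.symm (Or.inl (by omega)),
          diagonal_apply_ne _ hj.symm]
        ring
      · simp
  have h2 : qf (base t - diagonal fun i : Fin n => tw t i) v =
      qf (base t) v - ∑ i : Fin n, tw t i * (v i * v i) := by
    rw [qf, sub_mulVec, dotProduct_sub, qf]
    congr 1
    refine Finset.sum_congr rfl fun i _ => ?_
    rw [mulVec_diagonal]; ring
  linarith

theorem tw_mul_nonneg {t : ℝ} (ht : 1 ≤ t) (j : ℕ) (x : ℝ) : 0 ≤ tw t j * (x * x) :=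
  mul_nonneg (zero_le_one.trans (one_le_tw ht j)) (mul_self_nonneg x)

theorem le_qf_base {t : ℝ} (ht : 1 ≤ t) (v : Fin n → ℝ) :
    ∑ i : Fin n, tw t i * (v i * v i) ≤ qf (base t) v := by
  rw [qf_base]
  refine le_add_of_nonneg_right (add_nonneg (sq_nonneg _) (Finset.sum_nonneg fun i _ => ?_))
  split_ifs
  · exact le_rfl
  · exact tw_mul_nonneg ht _ _

theorem pd_base {t : ℝ} (ht : 1 ≤ t) : Pd (base t : Matrix (Fin n) (Fin n) ℝ) := by
  refine ⟨base_symm t, 1, one_pos, fun v => le_trans ?_ (le_qf_base ht v)⟩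
  rw [one_mul]
  refine Finset.sum_le_sum fun i _ => ?_
  have := one_le_tw ht (i : ℕ)
  nlinarith [mul_self_nonneg (v i)]

/-- On integral vectors the form is at least twice the weight of the last coordinate. -/
theorem two_tw_le_qf_base {t : ℝ} (ht : 1 ≤ t) {w : Fin n → ℝ} {v : Fin n → ℤ} {j : Fin n}
    (hj : v j ≠ 0) (hv : ∀ l, j < l → v l = 0) (hw : w j = v j)
    (hw' : (j : ℕ) < 2 → ∀ i, w i = v i) : 2 * tw t j ≤ qf (base t) w := by
  have hsq : 1 ≤ v j ^ 2 := by
    have := pow_pos (abs_pos.mpr hj) 2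
    rw [sq_abs] at this
    omega
  by_cases h2 : (j : ℕ) < 2
  · have h0 : ∀ i : Fin n, ¬ (i : ℕ) < 2 → v i = 0 := fun i hi =>
      hv i (show (j : ℕ) < i by omega)
    have e : qf (base t) w = (((∑ i, v i ^ 2) + (∑ i, v i) ^ 2 : ℤ) : ℝ) := by
      rw [qf_base]
      push_cast
      rw [← add_assoc, Finset.sum_eq_zero (f := fun i : Fin n =>
        if (i : ℕ) < 2 then 0 else tw t i * (w i * w i)), add_zero]
      · congr 1
        · refine Finset.sum_congr rfl fun i _ => ?_
          rw [hw' h2]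
          by_cases hi : (i : ℕ) < 2
          · rw [tw, show (i : ℕ) - 1 = 0 by omega]; ring
          · simp [h0 i hi]
        · congr 1
          refine Finset.sum_congr rfl fun i _ => ?_
          rw [hw' h2]
          by_cases hi : (i : ℕ) < 2
          · rw [if_pos hi]
          · simp [h0 i hi]
      · intro i _
        rw [hw' h2]
        split_ifs with hi
        · rfl
        · simp [h0 i hi]
    have heven : Even ((∑ i, v i ^ 2) + (∑ i, v i) ^ 2) := by
      rw [Int.even_add, Int.even_pow' two_ne_zero, ← Int.even_add, ← Finset.sum_add_distrib]
      refine Finset.even_sum _ fun i _ => ?_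
      rw [sq, ← mul_add_one]
      exact Int.even_mul_succ_self _
    have h1 : 1 ≤ ∑ i, v i ^ 2 :=
      hsq.trans (Finset.single_le_sum (f := fun i => v i ^ 2) (fun i _ => sq_nonneg _) (mem_univ j))
    have h3 := sq_nonneg (∑ i, v i)
    obtain ⟨m, hm⟩ := heven
    rw [e, tw, show (j : ℕ) - 1 = 0 by omega, pow_zero, mul_one]
    exact_mod_cast (by omega : (2 : ℤ) ≤ (∑ i, v i ^ 2) + (∑ i, v i) ^ 2)
  · have h3 := Finset.single_le_sum (f := fun i : Fin n => tw t i * (w i * w i))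
      (fun i _ => tw_mul_nonneg ht _ _) (mem_univ j)
    have h4 := Finset.single_le_sum
      (f := fun i : Fin n => if (i : ℕ) < 2 then 0 else tw t i * (w i * w i))
      (fun i _ => by
        split_ifs
        · exact le_rfl
        · exact tw_mul_nonneg ht _ _) (mem_univ j)
    simp only [if_neg h2] at h4
    have h5 : tw t j ≤ tw t j * (w j * w j) := by
      have : (1 : ℝ) ≤ (v j : ℝ) ^ 2 := by exact_mod_cast hsq
      rw [hw]
      nlinarith [one_le_tw ht (j : ℕ)]
    rw [qf_base]
    nlinarith [sq_nonneg (∑ i : Fin n, if (i : ℕ) < 2 then w i else 0)]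

theorem eventually_qf_ge {S : Matrix (Fin n) (Fin n) ℝ} (hS : Pd S) :
    ∀ᶠ S' in 𝓝 S, ∀ v, 9 / 10 * qf S v ≤ qf S' v := by
  obtain ⟨-, ε, hε, h⟩ := hS
  have hc : Continuous fun S' : Matrix (Fin n) (Fin n) ℝ => ∑ i, ∑ j, |(S' - S) i j| := by
    simp only [Matrix.sub_apply]
    fun_prop
  have h0 : (∑ i, ∑ j, |(S - S) i j|) < ε / 10 := by simp; positivity
  filter_upwards [hc.continuousAt.eventually_lt continuousAt_const h0] with S' hS' v
  have h1 := (neg_abs_le _).trans' (neg_le_neg (abs_quad_le (S' - S) v))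
  rw [sub_mulVec, dotProduct_sub] at h1
  have h2 : 0 ≤ v ⬝ᵥ v := Finset.sum_nonneg fun i _ => mul_self_nonneg _
  have h3 := h v
  have h4 := mul_le_mul_of_nonneg_right hS'.le h2
  rw [qf, qf]
  linarith

/-- The base point of the family of forms. -/
noncomputable def baseForm (ρ : Matrix (Fin n) (Fin n) ℝ) (t : ℝ) : Matrix (Fin n) (Fin n) ℝ :=
  (1 / 2 : ℝ) • (ρᵀ * base t * ρ)

theorem sy_baseForm (ρ : Matrix (Fin n) (Fin n) ℝ) (t : ℝ) :
    sy (baseForm ρ t) = ρᵀ * base t * ρ := by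
  have h : (ρᵀ * base t * ρ)ᵀ = ρᵀ * base t * ρ := by
    rw [transpose_mul, transpose_mul, base_symm, transpose_transpose, mul_assoc]
  rw [sy, baseForm, transpose_smul, h, ← add_smul]
  norm_num

theorem continuous_sy : Continuous (sy : Matrix (Fin n) (Fin n) ℝ → Matrix (Fin n) (Fin n) ℝ) := by
  unfold sy
  fun_prop

theorem conj_apply (Q S : Matrix (Fin n) (Fin n) ℝ) (a b : Fin n) :
    (Qᵀ * S * Q) a b = ∑ l, ∑ m, Q l a * (S l m * Q m b) := by
  rw [mul_assoc, Matrix.mul_apply]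
  refine Finset.sum_congr rfl fun l _ => ?_
  rw [Matrix.mul_apply, Finset.mul_sum]
  rfl

theorem Pat.mulVec_eq {Q : Matrix (Fin n) (Fin n) ℝ} (hQ : Pat Q) {v : Fin n → ℝ} {j : Fin n}
    (hv : ∀ l, j < l → v l = 0) (i : Fin n) (hi : i = j ∨ (j : ℕ) < 2) : (Q *ᵥ v) i = v i := by
  rw [mulVec, dotProduct, Finset.sum_eq_single i, hQ.apply_self, one_mul]
  · intro l _ hl
    by_cases hlj : j < l
    · rw [hv l hlj, mul_zero]
    · rw [hQ i l, one_apply_ne hl.symm, zero_mul]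
      intro h
      rcases hi with rfl | hi
      · exact hlj h.1
      · have h1 : ¬ ((j : ℕ) < l) := hlj
        have := h.2
        omega
  · simp

set_option maxHeartbeats 1000000 in
theorem eventually_adm {ρ ρ' : Matrix (Fin n) (Fin n) ℝ} (hρ : Pat ρ) (hρ' : ρ' * ρ = 1)
    (N : Finset (SpecialLinearGroup (Fin n) ℤ)) (hN : ∀ ν ∈ N, UniPat ν.1) :
    ∃ C : ℝ, 0 ≤ C ∧ ∀ t, 1 ≤ t → ∀ᶠ x in 𝓝 (baseForm ρ t),
      Pd (sy x) ∧ ∀ ν ∈ N, Adm C t ((rl ν)ᵀ * sy x * rl ν) := by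
  classical
  obtain ⟨D, hD⟩ : ∃ D : ℝ, ∀ ν ∈ N, ∀ i j, |(ρ * rl ν) i j| ≤ D := by
    refine ⟨∑ ν ∈ N, ∑ i, ∑ j, |(ρ * rl ν) i j|, fun ν hν i j => ?_⟩
    refine le_trans ?_ (Finset.single_le_sum
      (f := fun ν => ∑ i, ∑ j, |(ρ * rl ν) i j|) (fun _ _ => by positivity) hν)
    refine le_trans ?_ (Finset.single_le_sum
      (f := fun i => ∑ j, |(ρ * rl ν) i j|) (fun _ _ => by positivity) (mem_univ i))
    exact Finset.single_le_sum
      (f := fun j => |(ρ * rl ν) i j|) (fun _ _ => by positivity) (mem_univ j)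
  refine ⟨n * (n * (2 * D ^ 2)) + 1, by positivity, fun t ht => ?_⟩
  have hpd : Pd (sy (baseForm ρ t)) := by
    rw [sy_baseForm]
    exact (pd_base ht).conj hρ'
  have hcs := (continuous_sy (n := n)).continuousAt (x := baseForm ρ t)
  have hq := hcs.eventually (eventually_qf_ge hpd)
  have hent : ∀ (ν : SpecialLinearGroup (Fin n) ℤ) (a b : Fin n),
      Continuous fun x : Matrix (Fin n) (Fin n) ℝ => ((rl ν)ᵀ * sy x * rl ν) a b := by
    intro ν a b
    have := continuous_sy (n := n)
    fun_prop
  have hval : ∀ ν : SpecialLinearGroup (Fin n) ℤ, (rl ν)ᵀ * sy (baseForm ρ t) * rl ν =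
      (ρ * rl ν)ᵀ * base t * (ρ * rl ν) := fun ν => by
    rw [sy_baseForm, transpose_mul]; simp only [mul_assoc]
  have hpat : ∀ ν ∈ N, Pat (ρ * rl ν) := fun ν hν => hρ.mul (hN ν hν).rl
  -- the values at the base point
  have hblk : ∀ ν ∈ N, ∀ a b : Fin n, (a : ℕ) < 2 → (b : ℕ) < 2 →
      ((rl ν)ᵀ * sy (baseForm ρ t) * rl ν) a b = base t a b := by
    intro ν hν a b ha hb
    have hc : ∀ l c : Fin n, (c : ℕ) < 2 → (ρ * rl ν) l c = (1 : Matrix (Fin n) (Fin n) ℝ) l c :=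
      fun l c hc => hpat ν hν l c fun h => by have := h.2; omega
    rw [hval, conj_apply, Finset.sum_eq_single a, Finset.sum_eq_single b, hc _ _ ha, hc _ _ hb,
      one_apply_eq, one_apply_eq, one_mul, mul_one]
    · intro m _ hm
      rw [hc _ _ hb, one_apply_ne hm, mul_zero, mul_zero]
    · simp
    · intro l _ hl
      simp only [hc l a ha, one_apply_ne hl, zero_mul, Finset.sum_const_zero]
    · simp
  have hup : ∀ ν ∈ N, ∀ a b : Fin n, |((rl ν)ᵀ * sy (baseForm ρ t) * rl ν) a b| <
      (n * (n * (2 * D ^ 2)) + 1) * tw t a := by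
    intro ν hν a b
    have hT := one_le_tw ht (a : ℕ)
    have h1 : |((rl ν)ᵀ * sy (baseForm ρ t) * rl ν) a b| ≤ n * (n * (2 * D ^ 2 * tw t a)) := by
      rw [hval, conj_apply]
      refine (Finset.abs_sum_le_sum_abs _ _).trans ?_
      refine (Finset.sum_le_card_nsmul _ _ (n * (2 * D ^ 2 * tw t a)) fun l _ => ?_).trans (by simp)
      refine (Finset.abs_sum_le_sum_abs _ _).trans ?_
      refine (Finset.sum_le_card_nsmul _ _ (2 * D ^ 2 * tw t a) fun m _ => ?_).trans (by simp)
      by_cases h0 : (ρ * rl ν) l a = 0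
      · rw [h0, zero_mul, abs_zero]; positivity
      · have hla : (l : ℕ) ≤ a := (hpat ν hν).le h0
        rw [abs_mul, abs_mul]
        have h2 := hD ν hν l a
        have h3 := hD ν hν m b
        have hD0 : 0 ≤ D := (abs_nonneg _).trans h2
        have h4 := (abs_base_le ht l m).trans
          (mul_le_mul_of_nonneg_left (tw_mono ht hla) two_pos.le)
        calc _ ≤ D * ((2 * tw t a) * D) := mul_le_mul h2 (mul_le_mul h4 h3 (abs_nonneg _)
              (by positivity)) (by positivity) hD0
          _ = _ := by ring
    linarith
  have e1 : ∀ᶠ x in 𝓝 (baseForm ρ t), ∀ ν ∈ N, ∀ a b : Fin n,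
      |((rl ν)ᵀ * sy x * rl ν) a b| < (n * (n * (2 * D ^ 2)) + 1) * tw t a := by
    rw [Finset.eventually_all]
    refine fun ν hν => eventually_all.mpr fun a => eventually_all.mpr fun b => ?_
    exact (hent ν a b).abs.continuousAt.eventually_lt continuousAt_const (hup ν hν a b)
  have e2 : ∀ᶠ x in 𝓝 (baseForm ρ t), ∀ ν ∈ N, ∀ a : Fin n, (a : ℕ) < 2 →
      ((rl ν)ᵀ * sy x * rl ν) a a < 11 / 5 := by
    rw [Finset.eventually_all]
    refine fun ν hν => eventually_all.mpr fun a => ?_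
    by_cases ha : (a : ℕ) < 2
    · have := (hent ν a a).continuousAt.eventually_lt
        (continuousAt_const (x := baseForm ρ t) (y := (11 / 5 : ℝ))) (by
          rw [hblk ν hν a a ha ha, base_self, tw, show (a : ℕ) - 1 = 0 by omega]; norm_num)
      exact this.mono fun x h _ => h
    · exact Eventually.of_forall fun x h => absurd h ha
  have e3 : ∀ᶠ x in 𝓝 (baseForm ρ t), ∀ ν ∈ N, ∀ a b : Fin n, (a : ℕ) < 2 → (b : ℕ) < 2 → a ≠ b →
      1 / 2 < ((rl ν)ᵀ * sy x * rl ν) a b := by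
    rw [Finset.eventually_all]
    refine fun ν hν => eventually_all.mpr fun a => eventually_all.mpr fun b => ?_
    by_cases h : (a : ℕ) < 2 ∧ (b : ℕ) < 2 ∧ a ≠ b
    · have := (continuousAt_const (x := baseForm ρ t) (y := (1 / 2 : ℝ))).eventually_lt
        (hent ν a b).continuousAt (by
          rw [hblk ν hν a b h.1 h.2.1, base, of_apply, if_neg h.2.2, if_pos ⟨h.1, h.2.1⟩]; norm_num)
      exact this.mono fun x h _ _ _ => h
    · exact Eventually.of_forall fun x h1 h2 h3 => absurd ⟨h1, h2, h3⟩ h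
  filter_upwards [hq, e1, e2, e3] with x hq e1 e2 e3
  refine ⟨⟨sy_symm x, ?_⟩, fun ν hν => ⟨?_, ?_, fun a b _ => (e1 ν hν a b).le,
    fun a ha => (e2 ν hν a ha).le, fun a b ha hb hab => (e3 ν hν a b ha hb hab).le, ?_⟩⟩
  · obtain ⟨-, ε, hε, h⟩ := hpd
    refine ⟨9 / 10 * ε, by positivity, fun v => ?_⟩
    have h1 := h v
    have h2 := hq v
    rw [qf, qf] at h2
    linarith
  · rw [transpose_mul, transpose_mul, sy_symm, transpose_transpose, mul_assoc]
  · intro v j hj hv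
    have h0 := hq (rl ν *ᵥ fun i => (v i : ℝ))
    rw [qf_conj]
    have h1 : qf (sy (baseForm ρ t)) (rl ν *ᵥ fun i => (v i : ℝ)) =
        qf (base t) ((ρ * rl ν) *ᵥ fun i => (v i : ℝ)) := by
      rw [sy_baseForm, qf_conj, mulVec_mulVec]
    have hv' : ∀ l, j < l → (v l : ℝ) = 0 := fun l hl => by rw [hv l hl, Int.cast_zero]
    have h2 := two_tw_le_qf_base ht (w := (ρ * rl ν) *ᵥ fun i => (v i : ℝ)) hj hv
      ((hpat ν hν).mulVec_eq hv' j (Or.inl rfl))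
      fun h i => (hpat ν hν).mulVec_eq hv' i (Or.inr h)
    linarith
  · intro v hv
    have h0 := hq (rl ν *ᵥ v)
    rw [qf_conj]
    have h1 : qf (sy (baseForm ρ t)) (rl ν *ᵥ v) = qf (base t) ((ρ * rl ν) *ᵥ v) := by
      rw [sy_baseForm, qf_conj, mulVec_mulVec]
    have hQ : (ρ * rl ν) *ᵥ v = v := by
      ext i
      rw [mulVec, dotProduct, Finset.sum_eq_single i, (hpat ν hν).apply_self, one_mul]
      · intro l _ hl
        by_cases h2 : 2 ≤ (l : ℕ)
        · rw [hv l h2, mul_zero]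
        · rw [hpat ν hν i l fun h => h2 h.2, one_apply_ne hl.symm, zero_mul]
      · simp
    rw [hQ] at h1
    have h2 : v ⬝ᵥ v ≤ qf (base t) v := by
      refine le_trans (Finset.sum_le_sum fun i _ => ?_) (le_qf_base ht v)
      have := one_le_tw ht (i : ℕ)
      nlinarith [mul_self_nonneg (v i)]
    have h3 : 0 ≤ v ⬝ᵥ v := Finset.sum_nonneg fun i _ => mul_self_nonneg _
    linarith

end Base

section Limit
variable {n : ℕ}

theorem tendsto_base_div {l r : Fin n} (h : IsPos l r) (m : Fin n) :
    Tendsto (fun t : ℝ => base t l m / (2 * tw t r)) atTop (𝓝 0) := by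
  refine squeeze_zero_norm' ?_ tendsto_inv_atTop_zero
  filter_upwards [eventually_ge_atTop 1] with t ht
  have hr := one_le_tw ht (r : ℕ)
  have h1 := abs_base_le ht l m
  have h2 := mul_tw_le ht (show (l : ℕ) < r from h.1) h.2
  rw [Real.norm_eq_abs, abs_div, abs_of_nonneg (by linarith : 0 ≤ 2 * tw t r),
    div_le_iff₀ (by linarith), inv_mul_eq_div, le_div_iff₀ (by linarith)]
  nlinarith

theorem exists_err {R ρ M : Matrix (Fin n) (Fin n) ℝ} (hR : Pat R) (hρ : Pat ρ) (h : ρ * R = 1)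
    (hM : Pat M) : ∃ err : ℝ → Fin (numPos n) → ℝ, Tendsto err atTop (𝓝 0) ∧
      ∀ t, 1 ≤ t → pv M (baseForm ρ t) = (posMat (base t) * posMat ρ) *ᵥ
        ((fun e => (M - R) (row e) (col e)) + err t) := by
  classical
  set P := ρ * M with hP
  have hPp : Pat P := hρ.mul hM
  let E : ℝ → Matrix (Fin n) (Fin n) ℝ := fun t => of fun a c =>
    ∑ l ∈ univ.erase a, ∑ m, P l a * (base t l m / (2 * tw t a) * P m c)
  have hE : ∀ a c, Tendsto (fun t => E t a c) atTop (𝓝 0) := by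
    intro a c
    have : (0 : ℝ) = ∑ l ∈ univ.erase a, ∑ m : Fin n, P l a * (0 * P m c) := by simp
    rw [this]
    refine tendsto_finsetSum _ fun l hl => tendsto_finsetSum _ fun m _ => ?_
    by_cases h0 : P l a = 0
    · simp only [h0, zero_mul]; exact tendsto_const_nhds
    · exact ((tendsto_base_div (hPp.isPos h0 (Finset.ne_of_mem_erase hl)) m).mul_const
        _).const_mul _
  have hdet : IsUnit (posMat ρ).det := by
    refine isUnit_iff_ne_zero.mpr (det_posMat_unipotent (fun i j hij => ?_) hρ.apply_self).ne'
    rw [hρ i j fun h => lt_asymm hij h.1, one_apply_ne hij.ne']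
  refine ⟨fun t => (posMat ρ)⁻¹ *ᵥ fun e => E t (row e) (col e), ?_, fun t ht => ?_⟩
  · have h1 : Tendsto (fun t => fun e : Fin (numPos n) => E t (row e) (col e)) atTop (𝓝 0) :=
      tendsto_pi_nhds.mpr fun e => hE _ _
    have h2 : Continuous fun v : Fin (numPos n) → ℝ => (posMat ρ)⁻¹ *ᵥ v := by fun_prop
    have h3 := (h2.tendsto 0).comp h1
    rwa [mulVec_zero] at h3
  have hsum : posMat ρ *ᵥ ((fun e => (M - R) (row e) (col e)) +
      (posMat ρ)⁻¹ *ᵥ fun e => E t (row e) (col e)) = fun e => (P + E t) (row e) (col e) := by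
    rw [mulVec_add, mulVec_mulVec, mul_nonsing_inv _ hdet, one_mulVec]
    ext e
    rw [Pi.add_apply, posMat_mulVec, Matrix.add_apply]
    congr 1
    have h1 : (ρ * (M - R)) (row e) (col e) = P (row e) (col e) := by
      rw [Matrix.mul_sub, h, Matrix.sub_apply, one_apply_ne (row_lt_col e).ne, sub_zero]
    rw [← h1, Matrix.mul_apply]
    refine Finset.sum_congr rfl fun a _ => ?_
    split_ifs with hpos
    · rfl
    · rw [Matrix.sub_apply, hM _ _ hpos, hR _ _ hpos, sub_self, mul_zero]
  rw [← mulVec_mulVec, hsum]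
  ext e
  rw [posMat_mulVec]
  have hrc := row_lt_col e
  have hpos := isPos e
  set r := row e
  set c := col e
  have h1 : pv M (baseForm ρ t) e =
      (Pᵀ * (base t : Matrix (Fin n) (Fin n) ℝ) * P : Matrix (Fin n) (Fin n) ℝ) r c := by
    rw [pv, sy_baseForm, hP, transpose_mul]; simp only [mul_assoc]; rfl
  have htr : tw t r ≠ 0 := (zero_lt_one.trans_le (one_le_tw ht _)).ne'
  rw [h1, conj_apply, ← Finset.add_sum_erase _ _ (mem_univ r)]
  have h2 : ∀ a, (if IsPos a c then base t r a * (P + E t) a c else 0) =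
      base t r a * P a c + if IsPos a c then base t r a * E t a c else 0 := by
    intro a
    split_ifs with h
    · rw [Matrix.add_apply, mul_add]
    · rw [add_zero, hPp a c h]
      by_cases hac : a = c
      · rw [hac, base_eq_zero t hrc.ne (Or.inr hpos.2), zero_mul]
      · rw [one_apply_ne hac, mul_zero]
  simp only [h2]
  rw [Finset.sum_add_distrib]
  congr 1
  · simp only [hPp.apply_self, one_mul]
  by_cases hr : 2 ≤ (r : ℕ)
  · refine Eq.trans ?_ (Finset.sum_eq_single r (fun a _ ha => ?_) (by simp)).symm
    · rw [if_pos hpos, base_self]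
      simp only [E, of_apply, Finset.mul_sum]
      refine Finset.sum_congr rfl fun l _ => Finset.sum_congr rfl fun m _ => ?_
      field_simp
    · rw [base_eq_zero t ha.symm (Or.inl hr), zero_mul, ite_self]
  · have hz : ∀ a : Fin n, ¬ 2 ≤ (a : ℕ) → ∀ l ∈ univ.erase a, P l a = 0 := fun a ha l hl => by
      rw [hPp l a fun h => ha h.2, one_apply_ne (Finset.ne_of_mem_erase hl)]
    rw [Finset.sum_eq_zero, Finset.sum_eq_zero]
    · intro a _
      by_cases ha : 2 ≤ (a : ℕ)
      · rw [base_eq_zero t (fun hh => hr (by rw [hh]; exact ha)) (Or.inr ha), zero_mul, ite_self]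
      · have : E t a c = 0 := by
          simp only [E, of_apply]
          exact Finset.sum_eq_zero fun l hl => by simp [hz a ha l hl]
        rw [this, mul_zero, ite_self]
    · intro l hl
      simp [hz r hr l hl]

theorem Pd.posDef {S : Matrix (Fin n) (Fin n) ℝ} (hS : Pd S) : S.PosDef := by
  obtain ⟨h1, ε, hε, h⟩ := hS
  refine PosDef.of_dotProduct_mulVec_pos ?_ fun v hv => ?_
  · rw [IsHermitian, conjTranspose_eq_transpose_of_trivial, h1]
  · rw [star_trivial]
    refine lt_of_lt_of_le (mul_pos hε ?_) (h v)
    refine lt_of_le_of_ne (Finset.sum_nonneg fun i _ => mul_self_nonneg _) fun h0 => hv ?_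
    exact dotProduct_self_eq_zero.mp h0.symm

/-- Far out in the family, the degrees near the base point are the degrees of the limit. -/
theorem eventually_deg_pv {R ρ : Matrix (Fin n) (Fin n) ℝ} (hR : Pat R) (hρ : Pat ρ)
    (h : ρ * R = 1) {M : Fin (numPos n + 1) → Matrix (Fin n) (Fin n) ℝ} (hM : ∀ i, Pat (M i))
    (hy : WeaklyGeneric fun i e => (M i - R) (row e) (col e)) :
    ∀ᶠ t in atTop, ∃ U ∈ 𝓝 (baseForm ρ t), ∀ X : Fin (numPos n + 1) → Matrix (Fin n) (Fin n) ℝ,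
      (∀ i, X i ∈ U) → deg (fun i => pv (M i) (X i)) =
        deg fun i e => (M i - R) (row e) (col e) := by
  set y : Fin (numPos n + 1) → Fin (numPos n) → ℝ := fun i e => (M i - R) (row e) (col e)
  choose err herr hpv using fun i => exists_err hR hρ h (hM i)
  have ht : Tendsto (fun t => fun i => y i + err i t) atTop (𝓝 y) := by
    refine tendsto_pi_nhds.mpr fun i => ?_
    have := (herr i).const_add (y i)
    rwa [add_zero] at this
  filter_upwards [ht.eventually (eventually_deg_eq hy).eventually_nhds, eventually_ge_atTop 1]
    with t h1 ht
  set B : Matrix (Fin (numPos n)) (Fin (numPos n)) ℝ := posMat (base t) * posMat ρ with hB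
  have hdet : 0 < B.det := by
    rw [hB, det_mul]
    refine mul_pos (det_posMat_posDef (pd_base ht).posDef)
      (det_posMat_unipotent (fun i j hij => ?_) hρ.apply_self)
    rw [hρ i j fun h => lt_asymm hij h.1, one_apply_ne hij.ne']
  have hu : IsUnit B.det := isUnit_iff_ne_zero.mpr hdet.ne'
  have hinv : 0 < (B⁻¹).det := by
    rw [det_nonsing_inv, Ring.inverse_eq_inv']
    exact inv_pos.mpr hdet
  have hc : Continuous fun X : Fin (numPos n + 1) → Matrix (Fin n) (Fin n) ℝ =>
      fun i => B⁻¹ *ᵥ pv (M i) (X i) := by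
    have h1 : ∀ i, Continuous fun A : Matrix (Fin n) (Fin n) ℝ => pv (M i) A := fun i => by
      have := continuous_sy (n := n)
      unfold pv
      fun_prop
    refine continuous_pi fun i => ?_
    have h2 : Continuous fun v : Fin (numPos n) → ℝ => B⁻¹ *ᵥ v := by fun_prop
    exact h2.comp ((h1 i).comp (continuous_apply i))
  have hval : (fun i => B⁻¹ *ᵥ pv (M i) (baseForm ρ t)) = fun i => y i + err i t := by
    ext1 i
    rw [hpv i t ht, mulVec_mulVec, nonsing_inv_mul _ hu, one_mulVec]
  have h2 : ∀ᶠ X in 𝓝 (fun _ : Fin (numPos n + 1) => baseForm ρ t),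
      deg (fun i => B⁻¹ *ᵥ pv (M i) (X i)) = deg y :=
    (hc.tendsto _).eventually (by rw [hval]; exact h1)
  rw [nhds_pi, Filter.Eventually, Filter.mem_pi] at h2
  obtain ⟨I, hI, u, hu, hsub⟩ := h2
  refine ⟨⋂ i ∈ I, u i, (Filter.biInter_mem hI).mpr fun i _ => hu i, fun X hX => ?_⟩
  have h3 : X ∈ I.pi u := fun i hi => Set.mem_iInter₂.mp (hX i) i hi
  have h4 := hsub h3
  rw [Set.mem_ofPred_eq, deg_smul_det _ _ hinv] at h4
  exact h4

end Limit

section Open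
variable {n p : ℕ}

theorem radical_le : radical n p ≤ congruenceSubgroup n p := fun _ hx => hx.1

/-- The degree of a list of coloured elements of the radical in a given basis. -/
noncomputable def rdeg (x : ℕ → Matrix (Fin n) (Fin n) ℝ) (h : SpecialLinearGroup (Fin n) ℤ) :
    List (radical n p × ℕ) → ℤ :=
  onList (numPos n + 1) fun v => deg fun i => pv (rl ((v i).1.1⁻¹ * h)) (x (v i).2)

theorem rdeg_mul (x : ℕ → Matrix (Fin n) (Fin n) ℝ) (h : SpecialLinearGroup (Fin n) ℤ)
    {b : congruenceSubgroup n p} (hb : b ∈ blockSub n p) (l : List (radical n p × ℕ)) :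
    rdeg x (h * b.1) l = rdeg x h l := by
  by_cases hl : l.length = numPos n + 1
  · obtain ⟨v, rfl⟩ := exists_ofFn_of_length hl
    rw [rdeg, rdeg, onList_ofFn, onList_ofFn,
      ← deg_smul_det (fun i => pv (rl ((v i).1.1⁻¹ * h)) (x (v i).2)) _
        (det_posMat_inBlock hb.1)]
    congr 1
    ext1 i
    rw [← pv_block _ _ hb.1, ← rl_mul, ← mul_assoc]
  · rw [rdeg, rdeg, onList_of_length_ne hl, onList_of_length_ne hl]

theorem rdeg_out (x : ℕ → Matrix (Fin n) (Fin n) ℝ) (g : SpecialLinearGroup (Fin n) ℤ)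
    (q : congruenceSubgroup n p) (l : List (radical n p × ℕ)) :
    rdeg x (g * (q : congruenceSubgroup n p ⧸ blockSub n p).out.1) l = rdeg x (g * q.1) l := by
  obtain ⟨b, hb⟩ := QuotientGroup.mk_out_eq_mul (blockSub n p) q
  rw [hb, Subgroup.coe_mul, ← mul_assoc, rdeg_mul x _ b.2]

/-- A nonzero degree yields an admissible form diagonalized by the basis. -/
theorem exists_orth_of_rdeg {C t : ℝ} {N : Finset (SpecialLinearGroup (Fin n) ℤ)}
    {x : ℕ → Matrix (Fin n) (Fin n) ℝ}
    (hx : ∀ i, ∀ ν ∈ N, Adm C t ((rl ν)ᵀ * sy (x i) * rl ν))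
    {h : SpecialLinearGroup (Fin n) ℤ} {l : List (radical n p × ℕ)}
    (hl : ∀ v ∈ l, (v.1.1)⁻¹ ∈ N) (hd : rdeg x h l ≠ 0) :
    ∃ S, Adm C t S ∧ Orth S (rl h) := by
  have hlen : l.length = numPos n + 1 := by
    by_contra h'
    exact hd (onList_of_length_ne h')
  obtain ⟨v, rfl⟩ := exists_ofFn_of_length hlen
  rw [rdeg, onList_ofFn] at hd
  obtain ⟨c, hc, h0⟩ := exists_pos_relation_of_deg_ne_zero hd
  set σ := ∑ i, c i
  have hσ : 0 < σ := Finset.sum_pos (fun i _ => hc i) univ_nonempty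
  refine ⟨∑ i, (c i / σ) • ((rl (v i).1.1⁻¹)ᵀ * sy (x (v i).2) * rl (v i).1.1⁻¹),
    Adm.sum (fun i => hx _ _ (hl _ (List.mem_ofFn.mpr ⟨i, rfl⟩)))
      (fun i => (div_pos (hc i) hσ).le) ?_, fun e => ?_⟩
  · rw [← Finset.sum_div, div_self hσ.ne']
  · rw [Matrix.mul_sum, Matrix.sum_mul, Matrix.sum_apply]
    have h1 := congrArg (fun r => σ⁻¹ * r) (h0 e)
    simp only [mul_zero, Finset.mul_sum] at h1
    rw [← h1]
    refine Finset.sum_congr rfl fun i _ => ?_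
    rw [Matrix.mul_smul, Matrix.smul_mul, Matrix.smul_apply, smul_eq_mul, pv,
      div_eq_inv_mul, mul_assoc σ⁻¹]
    congr 2
    have : rl ((v i).1.1⁻¹ * h) = rl (v i).1.1⁻¹ * rl h := rl_mul _ _
    rw [this, transpose_mul]
    simp only [mul_assoc]

theorem eventually_rdeg (hp : 0 < p) {s : ℕ → ℝ} (hT : (tower n p hp s).Generic)
    {R ρ : Matrix (Fin n) (Fin n) ℝ} (hR : Pat R) (hρ : Pat ρ) (h : ρ * R = 1)
    (hs : ∀ e : Fin (numPos n), R (row e) (col e) = s e)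
    (l : List (radical n p × ℕ)) (ν : radical n p) :
    ∀ᶠ t in atTop, ∃ U ∈ 𝓝 (baseForm ρ t), ∀ x : ℕ → Matrix (Fin n) (Fin n) ℝ,
      (∀ i, x i ∈ U) → rdeg x ν.1 l =
        (tower n p hp s).degL (numPos n) ((l.map Prod.fst).map fun m => ν⁻¹ * m) := by
  by_cases hl : l.length = numPos n + 1
  · obtain ⟨v, rfl⟩ := exists_ofFn_of_length hl
    have hval : (fun (i : Fin (numPos n + 1)) e =>
        (rl ((v i).1.1⁻¹ * ν.1) - R) (row e) (col e)) =
        fun i => (tower n p hp s).vec (numPos n) (ν⁻¹ * (v i).1) := by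
      ext i e
      rw [Matrix.sub_apply, hs, Tower.vec, tower_Y, coord, dif_pos e.2, im]
      simp
    have hM : ∀ i, Pat (rl ((v i).1.1⁻¹ * ν.1)) := fun i =>
      UniPat.rl ((v i).1⁻¹ * ν).2.2.1
    have hy : WeaklyGeneric fun (i : Fin (numPos n + 1)) e =>
        (rl ((v i).1.1⁻¹ * ν.1) - R) (row e) (col e) := by
      rw [hval]
      exact (hT.noRelation le_rfl _).weaklyGeneric
    filter_upwards [eventually_deg_pv hR hρ h hM hy] with t ht
    obtain ⟨U, hU, H⟩ := ht
    refine ⟨U, hU, fun x hx => ?_⟩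
    rw [rdeg, onList_ofFn, List.map_ofFn, List.map_ofFn, Tower.degL, onList_ofFn,
      H (fun i => x (v i).2) fun i => hx _, hval]
    rfl
  · refine Eventually.of_forall fun t => ⟨Set.univ, univ_mem, fun x _ => ?_⟩
    rw [rdeg, Tower.degL, onList_of_length_ne hl, onList_of_length_ne (by simpa using hl)]

theorem exists_nhds_forall {I X : Type*} [TopologicalSpace X] {a : X} (s : Finset I)
    {P : I → (ℕ → X) → Prop}
    (h : ∀ i ∈ s, ∃ U ∈ 𝓝 a, ∀ x : ℕ → X, (∀ j, x j ∈ U) → P i x) :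
    ∃ U ∈ 𝓝 a, ∀ x : ℕ → X, (∀ j, x j ∈ U) → ∀ i ∈ s, P i x := by
  have h' : ∀ i, ∃ U ∈ 𝓝 a, ∀ x : ℕ → X, (∀ j, x j ∈ U) → i ∈ s → P i x := fun i => by
    by_cases hi : i ∈ s
    · obtain ⟨U, hU, H⟩ := h i hi
      exact ⟨U, hU, fun x hx _ => H x hx⟩
    · exact ⟨Set.univ, univ_mem, fun x _ h => absurd h hi⟩
  choose U hU H using h'
  exact ⟨⋂ i ∈ s, U i, (biInter_finset_mem s).mpr fun i _ => hU i, fun x hx i hi =>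
    H i x (fun j => Set.mem_iInter₂.mp (hx j) i hi) hi⟩

theorem finite_entry_le (β : ℝ) :
    {ν : radical n p | ∀ l a, |(ν.1.1 l a : ℝ)| ≤ β}.Finite := by
  have h1 : {z : ℤ | |(z : ℝ)| ≤ β}.Finite := by
    refine (Set.finite_Icc (-⌈β⌉) ⌈β⌉).subset fun z hz => ?_
    have h2 := abs_le.mp (show |(z : ℝ)| ≤ β from hz)
    have h3 := Int.le_ceil β
    constructor
    · have : ((-⌈β⌉ : ℤ) : ℝ) ≤ z := by push_cast; linarith
      exact_mod_cast this
    · have : (z : ℝ) ≤ (⌈β⌉ : ℤ) := by linarith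
      exact_mod_cast this
  have h2 : {A : Fin n → Fin n → ℤ | ∀ l, A l ∈ {w : Fin n → ℤ | ∀ a, w a ∈
      {z : ℤ | |(z : ℝ)| ≤ β}}}.Finite :=
    Set.Finite.pi' fun _ => Set.Finite.pi' fun _ => h1
  refine Set.Finite.of_finite_image (f := fun ν : radical n p => (ν.1.1 : Fin n → Fin n → ℤ))
    (h2.subset ?_) ?_
  · rintro _ ⟨ν, hν, rfl⟩
    exact hν
  · intro a _ b _ hab
    exact Subtype.ext (Subtype.ext hab)

theorem coset_injective : Function.Injective fun ν : radical n p =>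
    ((⟨ν.1, radical_le ν.2⟩ : congruenceSubgroup n p) : congruenceSubgroup n p ⧸ blockSub n p) := by
  intro a b hab
  have h1 := QuotientGroup.eq.mp hab
  have h2 : InBlock (a⁻¹ * b : radical n p).1 := h1.1
  have h3 : UniPat (a⁻¹ * b : radical n p).1.1 := (a⁻¹ * b).2.2.1
  have h4 : (a⁻¹ * b : radical n p) = 1 := by
    refine Subtype.ext (Subtype.ext ?_)
    ext i j
    by_cases hij : IsPos i j
    · exact h2 i j (Or.inr hij.2)
    · exact h3 i j hij
  exact inv_mul_eq_one.mp h4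

theorem map_mul_of_mem (g : SpecialLinearGroup (Fin n) ℤ) {q : SpecialLinearGroup (Fin n) ℤ}
    (hq : q ∈ congruenceSubgroup n p) :
    (g * q).1.map (Int.castRingHom (ZMod p)) = g.1.map (Int.castRingHom (ZMod p)) := by
  have h1 : SpecialLinearGroup.map (Int.castRingHom (ZMod p)) (g * q) =
      SpecialLinearGroup.map (Int.castRingHom (ZMod p)) g := by
    rw [map_mul, MonoidHom.mem_ker.mp hq, mul_one]
  exact congrArg Subtype.val h1

/-- The local contribution of the forms near the base form to the pairing with the cycle of the
radical. -/
theorem exists_open (hp : 3 ≤ p) : ∃ U : Set (Matrix (Fin n) (Fin n) ℝ), IsOpen U ∧ U.Nonempty ∧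
    (∀ X ∈ U, Pd (sy X)) ∧ ∃ z ∈ Ch (Set.univ : Set (radical n p)) (numPos n + 1),
      bd z ∈ Ann (⊤ : Subgroup (radical n p)) ∧
      ∀ x : ℕ → Matrix (Fin n) (Fin n) ℝ, (∀ i, x i ∈ U) →
        ∀ g : SpecialLinearGroup (Fin n) ℤ,
        (¬ Compat (g.1.map (Int.castRingHom (ZMod p))) →
          ev (fun l => ∑ᶠ q : congruenceSubgroup n p ⧸ blockSub n p, rdeg x (g * q.out.1) l)
            (subdiv (fun i m => (m, i)) (numPos n + 1) z) = 0) ∧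
        (g = 1 →
          ev (fun l => ∑ᶠ q : congruenceSubgroup n p ⧸ blockSub n p, rdeg x (g * q.out.1) l)
            (subdiv (fun i m => (m, i)) (numPos n + 1) z) = 1) := by
  classical
  have hp0 : 0 < p := by omega
  obtain ⟨s, hT, z, hz, hbz, hone⟩ := exists_radical_cycle n p hp0
  set T := tower n p hp0 s
  set y : Chain (radical n p × ℕ) := subdiv (fun i m => (m, i)) (numPos n + 1) z with hydef
  have hy : y ∈ Supp fun l => l ∈ y.support := fun l hl => hl
  obtain ⟨R, ρ, hR, hρ, hρR, hRs⟩ := exists_pat fun e : Fin (numPos n) => s e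
  let N : Finset (SpecialLinearGroup (Fin n) ℤ) :=
    y.support.biUnion fun l => (l.map fun v => v.1.1⁻¹).toFinset
  have hN : ∀ l ∈ y.support, ∀ v ∈ l, v.1.1⁻¹ ∈ N := fun l hl v hv =>
    Finset.mem_biUnion.mpr ⟨l, hl, List.mem_toFinset.mpr (List.mem_map_of_mem hv)⟩
  have hNU : ∀ ν ∈ N, UniPat ν.1 := by
    intro ν hν
    obtain ⟨l, _, h⟩ := Finset.mem_biUnion.mp hν
    obtain ⟨v, _, rfl⟩ := List.mem_map.mp (List.mem_toFinset.mp h)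
    exact v.1.2.2.2
  obtain ⟨C, hC0, hC⟩ := eventually_adm hρ (mul_eq_one_comm.mp hρR) N hNU
  obtain ⟨β, hβ⟩ := exists_entry_bound n hC0
  have hKtop : ∀ ν : radical n p, ν ∈ T.K (numPos n) := fun ν => by
    rw [show T.K (numPos n) = ⊤ from filt_top]; trivial
  have hBfin : ({ν : radical n p | ∀ l a, |(ν.1.1 l a : ℝ)| ≤ β} ∪ ⋃ l ∈ y.support,
      {ν | T.degL (numPos n) ((l.map Prod.fst).map fun m => ν⁻¹ * m) ≠ 0}).Finite := by
    refine (finite_entry_le β).union (Set.Finite.biUnion (Finset.finite_toSet _) fun l _ => ?_)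
    have h1 := Tower.support_finite (T := T) le_rfl (T.degL_nil (numPos n))
      (fun _ => T.mixed_of_degL) (l.map Prod.fst)
    refine (h1.image Subtype.val).subset fun ν hν => ⟨⟨ν, hKtop ν⟩, hν, rfl⟩
  obtain ⟨t, ht1, htC, ht⟩ := ((eventually_ge_atTop (1 : ℝ)).and
    ((eventually_gt_atTop (C * (5 / 9))).and
    ((Finset.eventually_all (y.support ×ˢ hBfin.toFinset)).mpr fun i _ =>
      eventually_rdeg hp0 hT hR hρ hρR hRs i.1 i.2))).exists
  have htC' : C < 9 / 5 * t := by linarith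
  obtain ⟨U₁, hU₁, H₁⟩ := exists_nhds_forall _ ht
  refine ⟨interior (U₁ ∩ {X | Pd (sy X) ∧ ∀ ν ∈ N, Adm C t ((rl ν)ᵀ * sy X * rl ν)}),
    isOpen_interior, ⟨_, mem_interior_iff_mem_nhds.mpr (inter_mem hU₁ (hC t ht1))⟩,
    fun X hX => (interior_subset hX).2.1, z, hz, hbz, fun x hx g => ?_⟩
  have hx1 : ∀ i, x i ∈ U₁ := fun i => (interior_subset (hx i)).1
  have hx2 : ∀ i, ∀ ν ∈ N, Adm C t ((rl ν)ᵀ * sy (x i) * rl ν) := fun i =>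
    (interior_subset (hx i)).2.2
  have hcompat : ∀ l ∈ y.support, ∀ h, rdeg x h l ≠ 0 → Compat h.1 := by
    intro l hl h hd
    obtain ⟨S, hS, ho⟩ := exists_orth_of_rdeg hx2 (hN l hl) hd
    exact hS.compat ht1 htC' ho
  constructor
  · intro hg
    rw [ev_congr (F' := fun _ => 0) hy]
    · rw [show (fun _ : List (radical n p × ℕ) => (0 : ℤ)) = 0 from rfl]; simp [ev]
    · refine fun l hl => finsum_eq_zero_of_forall_eq_zero fun q => ?_
      by_contra hne
      refine hg ?_
      rw [← map_mul_of_mem g q.out.2]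
      exact (hcompat l hl _ hne).map _
  · rintro rfl
    rw [ev_congr (F' := fun l => T.avg (numPos n) (T.degL (numPos n)) (l.map Prod.fst)) hy]
    · rw [← ev_mapL (T.avg (numPos n) (T.degL (numPos n))) Prod.fst, hydef,
        mapL_subdiv (v' := fun _ m => m) (a := fun m : radical n p => m) (fun _ _ => rfl)]
      rw [show mapL (fun m : radical n p => m) z = z from mapL_id z]
      exact hone
    · intro l hl
      let φ := fun ν : radical n p => ((⟨ν.1, radical_le ν.2⟩ : congruenceSubgroup n p) :
        congruenceSubgroup n p ⧸ blockSub n p)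
      have h1 : ∀ q : congruenceSubgroup n p ⧸ blockSub n p,
          rdeg x (1 * q.out.1) l ≠ 0 → q ∈ Set.range φ := by
        intro q hq
        rw [one_mul] at hq
        obtain ⟨ν, hν, hb⟩ := exists_factor hp (hcompat l hl _ hq)
        refine ⟨⟨ν.1, hν⟩, ?_⟩
        conv_rhs => rw [← q.out_eq']
        exact QuotientGroup.eq.mpr hb
      calc ∑ᶠ q : congruenceSubgroup n p ⧸ blockSub n p, rdeg x (1 * q.out.1) l
          = ∑ᶠ q ∈ Set.range φ, rdeg x (1 * q.out.1) l := by
            rw [← finsum_mem_univ]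
            exact finsum_mem_inter_support_eq _ _ _ (by
              ext q
              exact ⟨fun h => ⟨h1 q h.2, h.2⟩, fun h => ⟨trivial, h.2⟩⟩)
        _ = ∑ᶠ ν : radical n p, rdeg x ν.1 l := by
            rw [finsum_mem_range coset_injective]
            refine finsum_congr fun ν => ?_
            rw [rdeg_out, one_mul]
        _ = ∑ᶠ ν : radical n p,
            T.degL (numPos n) ((l.map Prod.fst).map fun m => ν⁻¹ * m) := by
            refine finsum_congr fun ν => ?_
            by_cases hν : ν ∈ hBfin.toFinset
            · exact H₁ x hx1 (l, ν) (Finset.mem_product.mpr ⟨hl, hν⟩)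
            · rw [Set.Finite.mem_toFinset, Set.mem_union, not_or] at hν
              have h2 : T.degL (numPos n) ((l.map Prod.fst).map fun m => ν⁻¹ * m) = 0 := by
                by_contra h3
                exact hν.2 (Set.mem_iUnion₂.mpr ⟨l, hl, h3⟩)
              rw [h2]
              by_contra h3
              obtain ⟨S, hS, ho⟩ := exists_orth_of_rdeg hx2 (hN l hl) h3
              exact hν.1 (hβ t ht1 S hS ν.1 ν.2.2.1 ho)
        _ = T.avg (numPos n) (T.degL (numPos n)) (l.map Prod.fst) :=
            (finsum_comp_equiv (Equiv.subtypeUnivEquiv hKtop)).symm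

end Open

end CodimOne

namespace CodimOne
open Finset Matrix

section Cochain
variable {n p : ℕ}

instance : (congruenceSubgroup n p).Normal := MonoidHom.normal_ker _

/-- Conjugates of elements of the radical. -/
def cj (g : SpecialLinearGroup (Fin n) ℤ) (ν : radical n p) : congruenceSubgroup n p :=
  ⟨g * ν.1 * g⁻¹, Subgroup.Normal.conj_mem inferInstance _ (radical_le ν.2) g⟩

theorem cj_mul (g : SpecialLinearGroup (Fin n) ℤ) (a b : radical n p) :
    cj g (a * b) = cj g a * cj g b := by
  refine Subtype.ext ?_
  simp only [cj, Subgroup.coe_mul]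
  group

theorem pv_mul (G M A : Matrix (Fin n) (Fin n) ℝ) : pv (G * M) A = pv M (Gᵀ * A * G) := by
  ext e
  have h1 : sy (Gᵀ * A * G) = Gᵀ * sy A * G := by
    simp only [sy, transpose_mul, transpose_transpose, Matrix.mul_add, Matrix.add_mul, mul_assoc]
  rw [pv, pv, h1, transpose_mul]
  simp only [mul_assoc]

/-- Distinct colours, with bounded index. -/
def Coloured {Z T : Type*} (m : ℕ) (s : List (Z × (T × ℕ))) : Prop :=
  (s.map Prod.snd).Nodup ∧ ∀ w ∈ s, w.2.2 < m

theorem Coloured.cons {Z T : Type*} {m : ℕ} {s : List (Z × (T × ℕ))}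
    (hs : Coloured m s) {v : Z × (T × ℕ)} (hv : v.2.2 = m) : Coloured (m + 1) (v :: s) := by
  refine ⟨List.nodup_cons.mpr ⟨fun hmem => ?_, hs.1⟩, fun w hw => ?_⟩
  · obtain ⟨w, hw, he⟩ := List.mem_map.mp hmem
    have := hs.2 w hw
    rw [he, hv] at this
    exact lt_irrefl _ this
  · rcases List.mem_cons.mp hw with rfl | hw
    · omega
    · exact (hs.2 w hw).trans (Nat.lt_succ_self m)

theorem subdiv_coloured {X Z T : Type*} {v : ℕ → X → Z × (T × ℕ)} (hv : ∀ n x, (v n x).2.2 = n)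
    (m : ℕ) : ∀ c : Chain X, subdiv v m c ∈ Supp (Coloured m) := by
  induction m with
  | zero =>
    intro c
    refine mem_of_supp (P := fun _ => True) (fun _ _ => trivial) _ _ fun l _ => ?_
    have h : subdiv v 0 (pt l) = pt [] := by simp [subdiv]
    rw [h]
    exact pt_mem_supp (P := Coloured 0) ⟨List.nodup_nil, fun _ h => absurd h List.not_mem_nil⟩
  | succ m ih =>
    intro c
    have hc : c ∈ Supp fun _ => True := fun _ _ => trivial
    change step (v m) (subdiv v m ∘ₗ bd) c ∈ Supp (Coloured (m + 1))
    refine step_mem (P := fun _ => True) (Q := Coloured m) (R := Coloured (m + 1)) (V := v m)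
      (ψ := subdiv v m ∘ₗ bd) (fun l _ => ih _) (fun x s hs => ?_) hc
    exact Coloured.cons hs (hv m x)

theorem coneHtpy_coloured {X Z T : Type*} {v v₁ v₂ : ℕ → X → Z × (T × ℕ)}
    (hv : ∀ n x, (v n x).2.2 = n) (hv₁ : ∀ n x, (v₁ n x).2.2 = n) (hv₂ : ∀ n x, (v₂ n x).2.2 = n)
    (m : ℕ) : ∀ c : Chain X,
      coneHtpy v (fun i => subdiv v₁ i - subdiv v₂ i) m c ∈ Supp (Coloured (m + 1)) := by
  induction m with
  | zero => exact fun c => Submodule.zero_mem _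
  | succ m ih =>
    intro c
    have hc : c ∈ Supp fun _ => True := fun _ _ => trivial
    change step (v (m + 1)) (subdiv v₁ (m + 1) - subdiv v₂ (m + 1) -
      coneHtpy v (fun i => subdiv v₁ i - subdiv v₂ i) m ∘ₗ bd) c ∈ Supp (Coloured (m + 1 + 1))
    refine step_mem (P := fun _ => True) (Q := Coloured (m + 1)) (R := Coloured (m + 1 + 1))
      (V := v (m + 1)) (fun l _ => ?_) (fun x s hs => ?_) hc
    · exact Submodule.sub_mem _ (Submodule.sub_mem _ (subdiv_coloured hv₁ _ _)
        (subdiv_coloured hv₂ _ _)) (ih _)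
    · exact Coloured.cons hs (hv _ x)

/-- A cocycle detecting the unipotent radical but none of its conjugates by incompatible
matrices. -/
theorem exists_cochain (hp : 3 ≤ p) : ∃ c : List (congruenceSubgroup n p) → ℤ,
    (∀ γ l, c (l.map fun x => γ * x) = c l) ∧
    (∀ l : List (congruenceSubgroup n p), l.length = numPos n + 2 → ev c (bd (pt l)) = 0) ∧
    ∃ z ∈ Ch (Set.univ : Set (radical n p)) (numPos n + 1),
      bd z ∈ Ann (⊤ : Subgroup (radical n p)) ∧ ∀ g : SpecialLinearGroup (Fin n) ℤ,
        (¬ Compat ((g⁻¹).1.map (Int.castRingHom (ZMod p))) → ev c (mapL (cj g) z) = 0) ∧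
        (g = 1 → ev c (mapL (cj g) z) = 1) := by
  obtain ⟨U, hU, hUne, hPd, z, hz, hbz, hpair⟩ := exists_open (n := n) hp
  have : Countable (SpecialLinearGroup (Fin n) ℤ) :=
    (Subtype.val_injective (p := fun A : Fin n → Fin n → ℤ => Matrix.det A = 1)).countable
  let G : Option (SpecialLinearGroup (Fin n) ℤ) × ℕ → SpecialLinearGroup (Fin n) ℤ :=
    fun i => i.1.getD 1
  obtain ⟨x, hxU, hgen⟩ := exists_genericForms (n := n) (p := p)
    (fun i => {X | (rl (G i))ᵀ * X * rl (G i) ∈ U})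
    (fun i => hU.preimage (by fun_prop)) (fun i => by
      obtain ⟨X, hX⟩ := hUne
      refine ⟨(rl (G i)⁻¹)ᵀ * X * rl (G i)⁻¹, ?_⟩
      have h1 : (rl (G i))ᵀ * (rl (G i)⁻¹)ᵀ = 1 := by
        rw [← transpose_mul, rl_inv_mul, transpose_one]
      have h2 : (rl (G i))ᵀ * ((rl (G i)⁻¹)ᵀ * X * rl (G i)⁻¹) * rl (G i) = X := by
        calc _ = ((rl (G i))ᵀ * (rl (G i)⁻¹)ᵀ) * X * (rl (G i)⁻¹ * rl (G i)) := by
              simp only [mul_assoc]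
          _ = X := by rw [h1, rl_inv_mul, one_mul, mul_one]
      rw [Set.mem_ofPred_eq, h2]
      exact hX)
  have hx : ∀ i, Pd (sy (x i)) := fun i => by
    have h1 := (hPd _ (hxU i)).conj (rl_mul_inv (G i))
    have h2 : sy ((rl (G i))ᵀ * x i * rl (G i)) = (rl (G i))ᵀ * sy (x i) * rl (G i) := by
      simp only [sy, transpose_mul, transpose_transpose, Matrix.mul_add, Matrix.add_mul, mul_assoc]
    have h3 : (rl (G i)⁻¹)ᵀ * (rl (G i))ᵀ = 1 := by
      rw [← transpose_mul, rl_mul_inv, transpose_one]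
    rw [h2] at h1
    convert h1 using 1
    calc sy (x i) = ((rl (G i)⁻¹)ᵀ * (rl (G i))ᵀ) * sy (x i) * (rl (G i) * rl (G i)⁻¹) := by
          rw [h3, rl_mul_inv, one_mul, mul_one]
      _ = _ := by simp only [mul_assoc]
  let V : ℕ → congruenceSubgroup n p → congruenceSubgroup n p ×
    (Option (SpecialLinearGroup (Fin n) ℤ) × ℕ) := fun i γ => (γ, (none, i))
  have hzero : ∀ {m : ℕ} {w : Chain (congruenceSubgroup n p ×
      (Option (SpecialLinearGroup (Fin n) ℤ) × ℕ))}, w ∈ Supp (Coloured m) →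
      ev (glob x) (bd w) = 0 := fun hw =>
    glob_bd x hx hgen (supp_mono (fun _ hl => hl.1) hw)
  refine ⟨fun l => ev (glob x) (subdiv V (numPos n + 1) (pt l)), fun γ l => ?_, fun l hl => ?_,
    z, hz, hbz, fun g => ?_⟩
  · have h1 := mapL_subdiv (v := V) (v' := V) (a := fun x => γ * x)
      (b := fun w => (γ * w.1, w.2)) (fun _ _ => rfl) (numPos n + 1) (pt l)
    rw [mapL_pt] at h1
    beta_reduce
    rw [← h1, ev_mapL]
    exact congrArg (fun f => ev f _) (funext fun s => glob_translate x γ s)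
  · rw [← ev_linear, ← bd_subdiv_pt V (numPos n + 1) l hl]
    exact hzero (subdiv_coloured (fun _ _ => rfl) _ _)
  · let V₁ : ℕ → radical n p → congruenceSubgroup n p ×
      (Option (SpecialLinearGroup (Fin n) ℤ) × ℕ) := fun i ν => (cj g ν, (none, i))
    let V₂ : ℕ → radical n p → congruenceSubgroup n p ×
      (Option (SpecialLinearGroup (Fin n) ℤ) × ℕ) := fun i ν => (cj g ν, (some g, i))
    let act : radical n p → congruenceSubgroup n p ×
      (Option (SpecialLinearGroup (Fin n) ℤ) × ℕ) → congruenceSubgroup n p ×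
      (Option (SpecialLinearGroup (Fin n) ℤ) × ℕ) := fun ν w => (cj g ν * w.1, w.2)
    let β : radical n p × ℕ → congruenceSubgroup n p ×
      (Option (SpecialLinearGroup (Fin n) ℤ) × ℕ) := fun w => (cj g w.1, (some g, w.2))
    have h1 : ev (fun l => ev (glob x) (subdiv V (numPos n + 1) (pt l))) (mapL (cj g) z) =
        ev (glob x) (subdiv V₁ (numPos n + 1) z) := by
      rw [← ev_linear, ← mapL_subdiv (v := V₁) (a := cj g) (b := fun w => w) fun _ _ => rfl]
      rw [show ∀ w, mapL (fun w : congruenceSubgroup n p ×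
        (Option (SpecialLinearGroup (Fin n) ℤ) × ℕ) => w) w = w from fun w => mapL_id w]
    have h2 : ev (glob x) (subdiv V₁ (numPos n + 1) z - subdiv V₂ (numPos n + 1) z) = 0 :=
      ev_chainMap_eq_zero (K := ⊤) act (V := V₁) (D := fun i => subdiv V₁ i - subdiv V₂ i)
        (fun i a b => by simp only [V₁, act, cj_mul]) (by simp [subdiv])
        (fun m l hl => by
          simp only [LinearMap.sub_apply, map_sub, bd_subdiv_pt _ m l hl])
        (fun a m w => by
          rw [LinearMap.sub_apply, LinearMap.sub_apply, map_sub, lm,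
            mapL_subdiv (v := V₁) (v' := V₁) (a := fun b => a * b)
              (fun i b => by simp only [V₁, act, cj_mul]),
            mapL_subdiv (v := V₂) (v' := V₂) (a := fun b => a * b)
              (fun i b => by simp only [V₂, act, cj_mul])])
        (fun a _ l => glob_translate x (cj g a) l) hz hbz
        (hzero (coneHtpy_coloured (fun _ _ => rfl) (fun _ _ => rfl) (fun _ _ => rfl) _ _))
    rw [map_sub, sub_eq_zero] at h2
    have h3 : ev (glob x) (subdiv V₂ (numPos n + 1) z) =
        ev (fun l => glob x (l.map β)) (subdiv (fun i m => (m, i)) (numPos n + 1) z) := by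
      rw [← ev_mapL, mapL_subdiv (v' := V₂) (a := fun m => m) fun _ _ => rfl]
      rw [show mapL (fun m : radical n p => m) z = z from mapL_id z]
    have h4 : (fun l => glob x (l.map β)) = fun l => ∑ᶠ q : congruenceSubgroup n p ⧸ blockSub n p,
        rdeg (fun i => (rl g)ᵀ * x (some g, i) * rl g) (g⁻¹ * q.out.1) l := by
      ext l
      refine finsum_congr fun q => ?_
      by_cases hl : l.length = numPos n + 1
      · obtain ⟨v, rfl⟩ := exists_ofFn_of_length hl
        rw [List.map_ofFn, term, onList_ofFn, rdeg, onList_ofFn]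
        congr 1
        ext1 i
        rw [← pv_mul, ← rl_mul]
        congr 2
        simp only [β, Function.comp_apply, cj, Subgroup.coe_mul, Subgroup.coe_inv]
        group
      · rw [term, rdeg, onList_of_length_ne hl, onList_of_length_ne (by simpa using hl)]
    rw [h1, h2, h3, h4]
    have h5 := hpair (fun i => (rl g)ᵀ * x (some g, i) * rl g) (fun i => hxU (some g, i)) g⁻¹
    exact ⟨h5.1, fun hg => h5.2 (by rw [hg, inv_one])⟩

end Cochain

end CodimOne

namespace CodimOne
open Finset CategoryTheory

section Detect
variable {Γ : Type} [Group Γ]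

/-- The homogeneous cochain attached to an inhomogeneous one. -/
def homog (n : ℕ) (F : (Fin n → Γ) → ℤ) : List Γ → ℤ :=
  onList (n + 1) fun x => F fun i => (x i.castSucc)⁻¹ * x i.succ

/-- The inhomogeneous cochain attached to a homogeneous one. -/
def inhomog (n : ℕ) (c : List Γ → ℤ) (g : Fin n → Γ) : ℤ := c (List.ofFn (Fin.partialProd g))

theorem homog_invFun (n : ℕ) (F : (Fin n → Γ) → ℤ) : InvFun ⊤ (homog n F) := by
  refine ⟨fun γ _ l => ?_, onList_of_length_ne (by simp)⟩
  by_cases hl : l.length = n + 1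
  · obtain ⟨x, rfl⟩ := exists_ofFn_of_length hl
    rw [List.map_ofFn, homog, onList_ofFn, onList_ofFn]
    congr 1
    ext1 i
    simp only [Function.comp_apply]
    group
  · rw [homog, onList_of_length_ne hl, onList_of_length_ne (by simpa using hl)]

theorem homog_inhomog {n : ℕ} {c : List Γ → ℤ} (hc : ∀ γ l, c (l.map fun x => γ * x) = c l)
    (l : List Γ) (hl : l.length = n + 1) : homog n (inhomog n c) l = c l := by
  obtain ⟨x, rfl⟩ := exists_ofFn_of_length hl
  rw [homog, onList_ofFn, inhomog, ← hc (x 0), List.map_ofFn]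
  exact congrArg (fun y => c (List.ofFn y)) (Fin.partialProd_left_inv x)

theorem contractNth_differences {n : ℕ} (x : Fin (n + 2) → Γ) (j : Fin (n + 1)) (a : Fin n) :
    (x (j.succ.succAbove a.castSucc))⁻¹ * x (j.succ.succAbove a.succ) =
      Fin.contractNth j (fun a b => a * b) (fun i => (x i.castSucc)⁻¹ * x i.succ) a := by
  rw [← Fin.inv_partialProd_mul_eq_contractNth, Fin.succ_succAbove_succ]
  have h := Fin.partialProd_left_inv x
  conv_lhs => rw [← h]
  simp only [Pi.smul_apply, smul_eq_mul, mul_inv_rev]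
  group

theorem homog_d (n : ℕ) (F : (Fin n → Γ) → ℤ) (l : List Γ) (hl : l.length = n + 2) :
    homog (n + 1) (inhomogeneousCochains.d (Rep.trivial ℤ Γ ℤ) n F) l =
      ev (homog n F) (bd (pt l)) := by
  obtain ⟨x, rfl⟩ := exists_ofFn_of_length hl
  rw [bd_pt, bdL_ofFn, map_sum, Fin.sum_univ_succ, homog, onList_ofFn,
    inhomogeneousCochains.d_hom_apply]
  simp only [map_smul, ev_pt, homog, onList_ofFn, Fin.val_zero, pow_zero, one_smul,
    Fin.zero_succAbove, Fin.succ_castSucc, Fin.val_succ, smul_eq_mul, contractNth_differences]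
  rfl

theorem d_inhomog {n : ℕ} {c : List Γ → ℤ} (hc : ∀ γ l, c (l.map fun x => γ * x) = c l)
    (hd : ∀ l : List Γ, l.length = n + 2 → ev c (bd (pt l)) = 0) :
    inhomogeneousCochains.d (Rep.trivial ℤ Γ ℤ) n (inhomog n c) = 0 := by
  funext g
  have h := homog_d n (inhomog n c) (List.ofFn (Fin.partialProd g)) (by simp)
  rw [homog, onList_ofFn] at h
  have h2 : (fun i : Fin (n + 1) => (Fin.partialProd g i.castSucc)⁻¹ * Fin.partialProd g i.succ) =
      g :=
    funext fun i => Fin.partialProd_right_inv g i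
  rw [h2] at h
  refine h.trans (Eq.trans ?_ (hd (List.ofFn (Fin.partialProd g)) (by simp)))
  refine ev_congr (bd_mem (S := Set.univ) (L := n + 2) (pt_mem_supp ⟨by simp, by simp⟩)) ?_
  exact fun l hl => homog_inhomog hc l hl.1

theorem ev_homog_d_eq_zero (n : ℕ) (F : (Fin n → Γ) → ℤ) {ζ : Chain Γ}
    (hζ : ζ ∈ Ch Set.univ (n + 2)) (hb : bd ζ ∈ Ann (⊤ : Subgroup Γ)) :
    ev (homog (n + 1) (inhomogeneousCochains.d (Rep.trivial ℤ Γ ℤ) n F)) ζ = 0 := by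
  rw [← hb _ (homog_invFun n F), ev_linear]
  exact ev_congr hζ fun l hl => homog_d n F l hl.1

/-- Pairing of inhomogeneous cochains with chains. -/
noncomputable def pairing {ι : Type} (n : ℕ) (ζ : ι → Chain Γ) :
    ((Fin n → Γ) → ℤ) →ₗ[ℤ] (ι → ℤ) where
  toFun F i := ev (homog n F) (ζ i)
  map_add' F F' := by
    funext i
    have : (homog n (F + F')) = homog n F + homog n F' := by
      ext l
      simp only [homog, onList, Pi.add_apply]
      split <;> simp
    rw [this]
    simp [ev, Finsupp.linearCombination_apply, Finsupp.sum, mul_add, Finset.sum_add_distrib]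
  map_smul' a F := by
    funext i
    have : (homog n (a • F)) = a • homog n F := by
      ext l
      simp only [homog, onList, Pi.smul_apply]
      split <;> simp
    rw [this]
    simp [ev, Finsupp.linearCombination_apply, Finsupp.sum, Finset.mul_sum, mul_left_comm]

/-- Cocycles dual to cycles give a surjection from cohomology onto a free abelian group. -/
theorem exists_surjective_of_dual {ι : Type} [Fintype ι] [DecidableEq ι] (n : ℕ)
    (c : ι → List Γ → ℤ) (ζ : ι → Chain Γ) (hc : ∀ i γ l, c i (l.map fun x => γ * x) = c i l)
    (hd : ∀ i, ∀ l : List Γ, l.length = n + 3 → ev (c i) (bd (pt l)) = 0)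
    (hζ : ∀ i, ζ i ∈ Ch Set.univ (n + 2)) (hb : ∀ i, bd (ζ i) ∈ Ann (⊤ : Subgroup Γ))
    (hdual : ∀ i j, ev (c i) (ζ j) = if i = j then 1 else 0) :
    ∃ f : ↥(groupCohomology (Rep.trivial ℤ Γ ℤ) (n + 1)) →+ (ι → ℤ), Function.Surjective f := by
  let A := Rep.trivial ℤ Γ ℤ
  let φ : (groupCohomology.inhomogeneousCochains A).X (n + 1) ⟶ ModuleCat.of ℤ (ι → ℤ) :=
    ModuleCat.ofHom (pairing (n + 1) ζ)
  have hφ : (groupCohomology.inhomogeneousCochains A).d n (n + 1) ≫ φ = 0 := by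
    rw [groupCohomology.inhomogeneousCochains.d_def]
    ext F i
    exact ev_homog_d_eq_zero n F (hζ i) (hb i)
  let f := (groupCohomology.inhomogeneousCochains A).homologyι (n + 1) ≫
    (groupCohomology.inhomogeneousCochains A).descOpcycles φ n (by simp) hφ
  refine ⟨f.hom.toAddMonoidHom, fun v => ?_⟩
  let u : (Fin (n + 1) → Γ) → ℤ := ∑ i, v i • inhomog (n + 1) (c i)
  have hu : inhomogeneousCochains.d A (n + 1) u = 0 := by
    have h (i) : (inhomogeneousCochains.d A (n + 1)).hom (inhomog (n + 1) (c i)) = 0 :=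
      d_inhomog (hc i) (hd i)
    refine (map_sum (inhomogeneousCochains.d A (n + 1)).hom _ _).trans ?_
    refine Finset.sum_eq_zero fun i _ => ?_
    refine (map_smul (inhomogeneousCochains.d A (n + 1)).hom (v i) _).trans ?_
    rw [h, smul_zero]
  refine ⟨groupCohomology.π A (n + 1) (groupCohomology.cocyclesMk (A := A) u hu), ?_⟩
  have h1 : groupCohomology.π A (n + 1) ≫ f =
      groupCohomology.iCocycles A (n + 1) ≫ φ := by
    refine (HomologicalComplex.homology_π_ι_assoc _ _).trans ?_
    rw [HomologicalComplex.p_descOpcycles]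
  have h2 := congrArg (fun k => k.hom (groupCohomology.cocyclesMk (A := A) u hu)) h1
  refine h2.trans ?_
  refine (congrArg (pairing (n + 1) ζ) (groupCohomology.iCocycles_mk (A := A) u hu)).trans ?_
  funext j
  simp only [u, map_sum, map_smul]
  rw [Finset.sum_apply]
  have h3 : ∀ i, pairing (n + 1) ζ (inhomog (n + 1) (c i)) j = if i = j then 1 else 0 := fun i => by
    rw [← hdual i j]
    exact ev_congr (hζ j) fun l hl => homog_inhomog (hc i) l hl.1
  simp [h3]

end Detect

end CodimOne

namespace CodimOne
open Finset Matrix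

section Lift

theorem diag2n_eq_transvections {F ι : Type*} [Field F] [Fintype ι] [DecidableEq ι] {i j : ι}
    (hij : i ≠ j) (a : F) (ha : a ≠ 0) : SpecialLinearGroup.diag2n hij a ha =
      SpecialLinearGroup.transvection hij a * SpecialLinearGroup.transvection hij.symm (-a⁻¹) *
      SpecialLinearGroup.transvection hij a * (SpecialLinearGroup.transvection hij (-1) *
      SpecialLinearGroup.transvection hij.symm 1 * SpecialLinearGroup.transvection hij (-1)) := by
  refine Subtype.ext ?_
  have hw : ∀ (b b' : F), b * b' = 1 → transvection i j b * transvection j i (-b') *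
      transvection i j b = 1 - single i i 1 - single j j 1 + single i j b - single j i b' := by
    intro b b' hb
    have hb' : b' * b = 1 := by rw [mul_comm, hb]
    simp only [transvection, mul_add, add_mul, one_mul, mul_one, single_mul_single_same,
      single_mul_single_of_ne _ _ _ _ hij.symm, mul_neg, neg_mul, hb, hb', ← single_neg]
    abel
  have h1 := hw a a⁻¹ (mul_inv_cancel₀ ha)
  have h2 := hw (-1) (-1) (by ring)
  rw [neg_neg] at h2
  refine (SpecialLinearGroup.diag2n_coe hij a ha).trans
    (Eq.trans ?_ (congrArg₂ (fun x y => x * y) h1 h2).symm)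
  simp only [mul_add, add_mul, mul_sub, sub_mul, one_mul, mul_one, single_mul_single_same,
      single_mul_single_of_ne _ _ _ _ hij, single_mul_single_of_ne _ _ _ _ hij.symm,
      mul_neg, ← single_neg]
  ext k l
  simp only [diagonal_apply, Matrix.sub_apply, Matrix.add_apply, single_apply, one_apply,
    Matrix.neg_apply, Matrix.zero_apply]
  grind

/-- Reduction modulo a prime is surjective on special linear groups. -/
theorem map_intCast_surjective (p n : ℕ) [Fact p.Prime] (hn : 2 ≤ n) :
    Function.Surjective (SpecialLinearGroup.map (n := Fin n) (Int.castRingHom (ZMod p))) := by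
  have : Nontrivial (Fin n) := Fin.nontrivial_iff_two_le.mpr hn
  have ht : ∀ (i j : Fin n) (hij : i ≠ j) (a : ZMod p), SpecialLinearGroup.transvection hij a ∈
      (SpecialLinearGroup.map (n := Fin n) (Int.castRingHom (ZMod p))).range := by
    intro i j hij a
    obtain ⟨b, rfl⟩ := ZMod.intCast_surjective a
    refine ⟨SpecialLinearGroup.transvection hij b, Subtype.ext ?_⟩
    have h : (transvection i j b).map (Int.castRingHom (ZMod p)) =
        transvection i j ((b : ℤ) : ZMod p) := by
      ext k l
      simp only [transvection, map_apply, Matrix.add_apply, map_add, one_apply, single_apply]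
      split_ifs <;> simp
    exact h
  intro M
  refine SpecialLinearGroup.diagonal_transvection_induction'
    (fun M => M ∈ (SpecialLinearGroup.map (n := Fin n) (Int.castRingHom (ZMod p))).range) M
    (fun i j hij c hc => ?_) ht fun A B => Subgroup.mul_mem _
  rw [diag2n_eq_transvections]
  exact mul_mem (mul_mem (mul_mem (ht ..) (ht ..)) (ht ..))
    (mul_mem (mul_mem (ht ..) (ht ..)) (ht ..))

end Lift

section Separate
variable {F : Type*} [Field F] {m : ℕ}

/-- The coordinate plane spanned by the first two basis vectors. -/
def plane (F : Type*) [Field F] (m : ℕ) : Submodule F (Fin (m + 2) → F) where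
  carrier := {v | ∀ l : Fin (m + 2), 2 ≤ (l : ℕ) → v l = 0}
  add_mem' h h' l hl := by simp [h l hl, h' l hl]
  zero_mem' l _ := rfl
  smul_mem' c v h l hl := by simp [h l hl]

theorem finrank_plane : Module.finrank F (plane F m) = 2 := by
  let f := LinearMap.funLeft F F fun a : Fin m => a.succ.succ
  have hs : Function.Surjective f := LinearMap.funLeft_surjective_of_injective F F _
    ((Fin.succ_injective _).comp (Fin.succ_injective _))
  have hf : LinearMap.ker f = plane F m := by
    ext v
    refine ⟨fun h l hl => ?_, fun h => funext fun a => h a.succ.succ (by simp)⟩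
    have h1 := congrFun (LinearMap.mem_ker.mp h) ⟨l - 2, by omega⟩
    have h2 : (⟨l - 2, by omega⟩ : Fin m).succ.succ = l := Fin.ext (by simp; omega)
    rw [LinearMap.funLeft_apply, h2] at h1
    exact h1
  have h1 := LinearMap.finrank_range_add_finrank_ker f
  rw [LinearMap.range_eq_top.mpr hs, finrank_top, hf] at h1
  rw [Module.finrank_fin_fun, Module.finrank_fin_fun] at h1
  exact Nat.add_left_cancel h1

/-- Every plane is the image of the coordinate plane under a matrix of determinant one. -/
theorem exists_map_plane (W : Submodule F (Fin (m + 2) → F)) (hW : Module.finrank F W = 2) :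
    ∃ κ : SpecialLinearGroup (Fin (m + 2)) F, (plane F m).map (Matrix.mulVecLin κ.1) = W := by
  obtain ⟨V', hV⟩ := (plane F m).exists_isCompl
  obtain ⟨W', hW'⟩ := W.exists_isCompl
  have h1 := Submodule.finrank_add_eq_of_isCompl hV
  have h2 := Submodule.finrank_add_eq_of_isCompl hW'
  rw [finrank_plane] at h1
  rw [hW] at h2
  let e₁ : plane F m ≃ₗ[F] W := LinearEquiv.ofFinrankEq _ _ (by rw [finrank_plane, hW])
  let e₂ : V' ≃ₗ[F] W' := LinearEquiv.ofFinrankEq _ _ (by omega)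
  let e := (Submodule.prodEquivOfIsCompl _ _ hV).symm ≪≫ₗ e₁.prodCongr e₂ ≪≫ₗ
    Submodule.prodEquivOfIsCompl _ _ hW'
  have he : ∀ v ∈ plane F m, e v ∈ W := fun v hv => by
    have h3 : (Submodule.prodEquivOfIsCompl _ _ hV).symm v = ((⟨v, hv⟩ : plane F m), 0) :=
      Submodule.prodEquivOfIsCompl_symm_apply_left _ _ hV (⟨v, hv⟩ : plane F m)
    simp [e, h3]
  have hu : IsUnit (LinearMap.toMatrix' e.toLinearMap).det := by
    rw [LinearMap.det_toMatrix']
    exact e.isUnit_det'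
  let D : Fin (m + 2) → F := Fin.cons (LinearMap.toMatrix' e.toLinearMap).det⁻¹ fun _ => 1
  have hD : (diagonal D).det = (LinearMap.toMatrix' e.toLinearMap).det⁻¹ := by
    simp [D, Fin.prod_univ_succ]
  have hκ : (LinearMap.toMatrix' e.toLinearMap * diagonal D).det = 1 := by
    rw [det_mul, hD, mul_inv_cancel₀ hu.ne_zero]
  refine ⟨⟨_, hκ⟩, ?_⟩
  refine Submodule.eq_of_le_of_finrank_eq ?_ ?_
  · rintro _ ⟨v, hv, rfl⟩
    rw [mulVecLin_apply, ← mulVec_mulVec, LinearMap.toMatrix'_mulVec]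
    exact he _ fun l hl => by rw [mulVec_diagonal, hv l hl, mul_zero]
  · exact (LinearEquiv.finrank_map_eq (SpecialLinearGroup.toLin' ⟨_, hκ⟩) (plane F m)).trans
      (finrank_plane.trans hW.symm)

/-- Parameters for the lower unitriangular and diagonal parts. -/
abbrev TriParam (F : Type*) (m : ℕ) := (a : Fin m) → Fin a → F

/-- The diagonal entries. -/
noncomputable def diagEntry (d : Fin m → F) : Fin (m + 2) → F :=
  Fin.cons (∏ a, d a)⁻¹ (Fin.cons 1 d)

/-- A lower triangular matrix of determinant one. -/
noncomputable def triMat (t : TriParam F m) (d : Fin m → F) :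
    Matrix (Fin (m + 2)) (Fin (m + 2)) F :=
  of fun k l => if k = l then diagEntry d k else
    if h : 2 ≤ (l : ℕ) ∧ l < k then t ⟨k - 2, by omega⟩ ⟨l - 2, by have := h.2; simp; omega⟩ else 0

theorem triMat_self (t : TriParam F m) (d : Fin m → F) (k) : triMat t d k k = diagEntry d k := by
  simp [triMat]

theorem triMat_succ (t : TriParam F m) (d : Fin m → F) (a : Fin m) (b : Fin a) :
    triMat t d a.succ.succ (⟨b, b.2.trans a.2⟩ : Fin m).succ.succ = t a b := by
  have hlt : (⟨b, b.2.trans a.2⟩ : Fin m).succ.succ < a.succ.succ := by simp [Fin.lt_def]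
  rw [triMat, of_apply, if_neg hlt.ne', dif_pos ⟨by simp, hlt⟩]
  rfl

theorem triMat_of_lt (t : TriParam F m) (d : Fin m → F) {k l : Fin (m + 2)} (h : k < l) :
    triMat t d k l = 0 := by
  simp [triMat, h.ne, h.le.not_gt]

theorem triMat_of_lt_two (t : TriParam F m) (d : Fin m → F) {k l : Fin (m + 2)} (h : k ≠ l)
    (hl : (l : ℕ) < 2) :
    triMat t d k l = 0 := by
  simp [triMat, h, hl.not_ge]

theorem triMat_det (t : TriParam F m) (d : Fin m → F) (hd : ∀ a, d a ≠ 0) :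
    (triMat t d).det = 1 := by
  rw [det_of_isLowerTriangular _ fun k l h => triMat_of_lt t d h]
  simp only [triMat_self, diagEntry, Fin.prod_univ_succ, Fin.cons_zero, Fin.cons_succ, one_mul]
  exact inv_mul_cancel₀ (Finset.prod_ne_zero_iff.mpr fun a _ => hd a)

theorem diagEntry_ne_zero {d : Fin m → F} (hd : ∀ a, d a ≠ 0) (k) : diagEntry d k ≠ 0 := by
  refine Fin.cases ?_ (fun k => Fin.cases ?_ (fun k => ?_) k) k
  · exact inv_ne_zero (Finset.prod_ne_zero_iff.mpr fun a _ => hd a)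
  · simp [diagEntry]
  · simpa [diagEntry] using hd k

theorem triMat_mulVec_plane (t : TriParam F m) (d : Fin m → F) {v : Fin (m + 2) → F}
    (hv : v ∈ plane F m) : triMat t d *ᵥ v = fun k => diagEntry d k * v k := by
  funext k
  rw [mulVec, dotProduct, Finset.sum_eq_single k, triMat_self]
  · intro l _ hl
    by_cases h : (l : ℕ) < 2
    · rw [triMat_of_lt_two t d (Ne.symm hl) h, zero_mul]
    · rw [hv l (not_lt.mp h), mul_zero]
  · simp

theorem plane_le_of_compat {t t' : TriParam F m} {d d' : Fin m → F} (hd : ∀ a, d a ≠ 0)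
    {κ κ' X : Matrix (Fin (m + 2)) (Fin (m + 2)) F}
    (hX : κ' * triMat t' d' * X = κ * triMat t d)
    (h0 : ∀ l a : Fin (m + 2), 2 ≤ (l : ℕ) → (a : ℕ) < 2 → X l a = 0) :
    (plane F m).map (Matrix.mulVecLin κ) ≤ (plane F m).map (Matrix.mulVecLin κ') := by
  rintro _ ⟨v, hv, rfl⟩
  let w : Fin (m + 2) → F := fun k => (diagEntry d k)⁻¹ * v k
  have hw : w ∈ plane F m := fun l hl => by simp [w, hv l hl]
  have hXw : X *ᵥ w ∈ plane F m := by
    intro l hl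
    rw [mulVec, dotProduct]
    refine Finset.sum_eq_zero fun a _ => ?_
    by_cases h : (a : ℕ) < 2
    · rw [h0 l a hl h, zero_mul]
    · rw [hw a (not_lt.mp h), mul_zero]
  refine ⟨triMat t' d' *ᵥ (X *ᵥ w), ?_, ?_⟩
  · rw [SetLike.mem_coe, triMat_mulVec_plane t' d' hXw]
    exact fun l hl => by simp [hXw l hl]
  · rw [mulVecLin_apply, mulVecLin_apply, mulVec_mulVec, mulVec_mulVec, hX, ← mulVec_mulVec,
      triMat_mulVec_plane t d hw]
    congr 1
    funext k
    simp [w, diagEntry_ne_zero hd k]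

theorem triMat_inj_of_compat {t t' : TriParam F m} {d d' : Fin m → F} (hd : ∀ a, d a ≠ 0)
    (hd' : ∀ a, d' a ≠ 0) (hdd : ∀ a, d a = d' a ∨ d a = - d' a → d a = d' a)
    {X : Matrix (Fin (m + 2)) (Fin (m + 2)) F} (hX : triMat t' d' * X = triMat t d)
    (hc : Compat X) : t = t' ∧ d = d' := by
  have hlow : ∀ k l, k < l → X k l = 0 := by
    intro k l
    induction hN : (k : ℕ) using Nat.strong_induction_on generalizing k with
    | _ N ih =>
      subst hN
      intro hkl
      have h := congrFun (congrFun hX k) l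
      rw [mul_apply, triMat_of_lt _ _ hkl, Finset.sum_eq_single k, triMat_self] at h
      · exact (mul_eq_zero.mp h).resolve_left (diagEntry_ne_zero hd' k)
      · intro j _ hj
        rcases hj.lt_or_gt with h | h
        · rw [ih j h j rfl (h.trans hkl), mul_zero]
        · rw [triMat_of_lt _ _ h, zero_mul]
      · simp
  have hdiag : ∀ k, diagEntry d' k * X k k = diagEntry d k := by
    intro k
    have h := congrFun (congrFun hX k) k
    rw [mul_apply, Finset.sum_eq_single k, triMat_self, triMat_self] at h
    · exact h
    · intro l _ hl
      rcases hl.lt_or_gt with h | h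
      · rw [hlow l k h, mul_zero]
      · rw [triMat_of_lt _ _ h, zero_mul]
    · simp
  obtain ⟨-, σ, hσ2, hσ⟩ := hc
  have hσ1 : ∀ a : Fin (m + 2), 2 ≤ (a : ℕ) → σ a = a := perm_eq_of_le hσ2 fun a ha => by
    by_contra! hlt
    have h1 := hdiag (σ a)
    rw [(hσ a ha).1 _ hlt, mul_zero] at h1
    exact diagEntry_ne_zero hd _ h1.symm
  have hcol : ∀ a : Fin (m + 2), 2 ≤ (a : ℕ) → ∀ k, triMat t d k a = triMat t' d' k a * X a a := by
    intro a ha k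
    rw [← hX, mul_apply, Finset.sum_eq_single a]
    · intro l _ hl
      rcases hl.lt_or_gt with h | h
      · rw [hlow l a h, mul_zero]
      · have := (hσ a ha).1 l h
        rw [hσ1 a ha] at this
        rw [this, mul_zero]
    · simp
  have hdeq : ∀ a, d a = d' a := by
    intro a
    have h1 := hdiag a.succ.succ
    have h2 := (hσ a.succ.succ (by simp)).2
    rw [hσ1 _ (by simp)] at h2
    simp only [diagEntry, Fin.cons_succ] at h1
    refine hdd a ?_
    rcases h2 with h2 | h2 <;> rw [h2] at h1 <;> simp [← h1]
  refine ⟨?_, funext hdeq⟩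
  have hone : ∀ a : Fin m, X a.succ.succ a.succ.succ = 1 := fun a => by
    have h1 := hdiag a.succ.succ
    simp only [diagEntry, Fin.cons_succ, hdeq] at h1
    exact mul_left_cancel₀ (hd' a) (h1.trans (mul_one _).symm)
  funext a b
  have h := hcol ⟨b + 2, by omega⟩ (by simp) a.succ.succ
  have h3 : (⟨b + 2, by omega⟩ : Fin (m + 2)) = (⟨b, by omega⟩ : Fin m).succ.succ := rfl
  rwa [h3, hone, mul_one, triMat_succ, triMat_succ] at h

end Separate

section Final
variable {m p : ℕ}

/-- Indices of the detected classes: a plane, a lower unitriangular matrix, and diagonal entries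
up to sign. -/
abbrev ClassIndex (p m : ℕ) [Fact p.Prime] :=
  {W : Submodule (ZMod p) (Fin (m + 2) → ZMod p) // Module.finrank (ZMod p) W = 2} ×
    TriParam (ZMod p) m × (Fin m → Fin ((p - 1) / 2))

instance [Fact p.Prime] : Finite (Submodule (ZMod p) (Fin (m + 2) → ZMod p)) :=
  Finite.of_injective _ SetLike.coe_injective

theorem card_classIndex [Fact p.Prime] : Nat.card (ClassIndex p m) =
    p ^ Nat.choose m 2 * Nat.card {W : Submodule (ZMod p) (Fin (m + 2) → ZMod p) //
      Module.finrank (ZMod p) W = 2} * ((p - 1) / 2) ^ m := by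
  have h : Nat.card (TriParam (ZMod p) m) = p ^ Nat.choose m 2 := by
    rw [Nat.card_eq_fintype_card, Fintype.card_pi]
    simp only [Fintype.card_pi, ZMod.card, Finset.prod_const, Finset.card_univ, Fintype.card_fin]
    rw [Finset.prod_pow_eq_pow_sum, Fin.sum_univ_eq_sum_range (fun i => i), Finset.sum_range_id,
      Nat.choose_two_right]
  rw [Nat.card_prod, Nat.card_prod, h]
  simp only [Nat.card_eq_fintype_card (α := Fin m → Fin _), Fintype.card_pi, Finset.prod_const,
    Finset.card_univ, Fintype.card_fin]
  ring

/-- Representatives of units modulo sign. -/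
def signRep (e : Fin m → Fin ((p - 1) / 2)) (a : Fin m) : ZMod p := ((e a + 1 : ℕ) : ZMod p)

theorem signRep_ne_zero (e : Fin m → Fin ((p - 1) / 2)) (a : Fin m) : signRep (p := p) e a ≠ 0 := by
  rw [signRep, Ne, ZMod.natCast_eq_zero_iff]
  have := (e a).2
  exact fun h => absurd (Nat.le_of_dvd (by omega) h) (by omega)

theorem signRep_ne_neg (e e' : Fin m → Fin ((p - 1) / 2)) (a : Fin m) :
    signRep (p := p) e a ≠ - signRep e' a := by
  rw [Ne, eq_neg_iff_add_eq_zero, signRep, signRep, ← Nat.cast_add, ZMod.natCast_eq_zero_iff]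
  have := (e a).2
  have := (e' a).2
  exact fun h => absurd (Nat.le_of_dvd (by omega) h) (by omega)

theorem signRep_injective : Function.Injective (signRep : (Fin m → Fin ((p - 1) / 2)) → _) := by
  intro e e' h
  funext a
  have h1 := congrFun h a
  rw [signRep, signRep, ZMod.natCast_eq_natCast_iff'] at h1
  have := (e a).2
  have := (e' a).2
  rw [Nat.mod_eq_of_lt (by omega), Nat.mod_eq_of_lt (by omega)] at h1
  exact Fin.ext (by omega)

/-- Matrices indexed by `ClassIndex` whose quotients are pairwise incompatible. -/
theorem exists_incompatible [Fact p.Prime] : ∃ h : ClassIndex p m →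
    SpecialLinearGroup (Fin (m + 2)) (ZMod p), ∀ i j, Compat ((h j)⁻¹ * h i).1 → i = j := by
  choose κ hκ using fun W : {W : Submodule (ZMod p) (Fin (m + 2) → ZMod p) //
    Module.finrank (ZMod p) W = 2} => exists_map_plane W.1 W.2
  refine ⟨fun i => κ i.1 * ⟨triMat i.2.1 (signRep i.2.2), triMat_det _ _ (signRep_ne_zero _)⟩, ?_⟩
  rintro ⟨W, t, e⟩ ⟨W', t', e'⟩ hc
  let T : SpecialLinearGroup (Fin (m + 2)) (ZMod p) :=
    ⟨triMat t (signRep e), triMat_det _ _ (signRep_ne_zero _)⟩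
  let T' : SpecialLinearGroup (Fin (m + 2)) (ZMod p) :=
    ⟨triMat t' (signRep e'), triMat_det _ _ (signRep_ne_zero _)⟩
  let X := (κ W' * T')⁻¹ * (κ W * T)
  change Compat X.1 at hc
  have hX : κ W' * T' * X = κ W * T := mul_inv_cancel_left _ _
  have hle := plane_le_of_compat (signRep_ne_zero e) (congrArg Subtype.val hX) hc.1
  rw [hκ, hκ] at hle
  obtain rfl : W = W' := Subtype.ext (Submodule.eq_of_le_of_finrank_eq hle (W.2.trans W'.2.symm))
  rw [mul_assoc] at hX
  have hX' : T' * X = T := mul_left_cancel hX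
  obtain ⟨rfl, h2⟩ := triMat_inj_of_compat (signRep_ne_zero e) (signRep_ne_zero e')
    (fun a h => h.resolve_right (signRep_ne_neg e e' a))
    (congrArg Subtype.val hX') hc
  rw [signRep_injective h2]

theorem exists_surjective [Fact p.Prime] (hp : 3 ≤ p) (hm : 1 ≤ m) :
    ∃ f : ↥(groupCohomology (Rep.trivial ℤ (congruenceSubgroup (m + 2) p) ℤ) (numPos (m + 2))) →+
      (Fin (Nat.card (ClassIndex p m)) → ℤ), Function.Surjective f := by
  obtain ⟨k, hk⟩ : ∃ k, numPos (m + 2) = k + 1 := Nat.exists_eq_succ_of_ne_zero (by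
    rw [numPos_eq (by omega)]
    have : 6 ≤ (m + 2) * (m + 2 - 1) := Nat.mul_le_mul (by omega : 3 ≤ m + 2) (by omega : 2 ≤ m + 1)
    omega)
  obtain ⟨c, hc, hd, z, hz, hbz, hpair⟩ := exists_cochain (n := m + 2) hp
  obtain ⟨h, hh⟩ := exists_incompatible (m := m) (p := p)
  choose g hg using fun i => map_intCast_surjective p (m + 2) (by omega) (h i)
  rw [hk] at *
  let e := (Finite.equivFin (ClassIndex p m)).symm
  let cn (i : ClassIndex p m) : MulAut (congruenceSubgroup (m + 2) p) :=
    MulAut.conjNormal (g i)⁻¹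
  have hcn : ∀ i j ν, cn i (cj (g j) ν) = cj ((g i)⁻¹ * g j) ν := fun i j ν => Subtype.ext (by
    simp only [cn, MulAut.conjNormal_apply, cj]
    group)
  refine exists_surjective_of_dual k (fun i l => c (l.map (cn (e i))))
    (fun i => mapL (cj (g (e i))) z) ?_ ?_ ?_ ?_ ?_
  · intro i γ l
    rw [← hc (cn (e i) γ) (l.map _), List.map_map, List.map_map]
    simp only [Function.comp_def, map_mul]
  · intro i l hl
    rw [← ev_mapL, ← bd_mapL, mapL_pt]
    exact hd _ (by simpa using hl)
  · exact fun i => mapL_mem (fun l hl => ⟨by simpa using hl.1, by simp⟩) hz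
  · intro i F hF
    rw [bd_mapL, ev_mapL]
    refine hbz _ ⟨fun ν _ l => ?_, hF.2⟩
    beta_reduce
    rw [← hF.1 (cj (g (e i)) ν) trivial (l.map _), List.map_map, List.map_map]
    simp only [Function.comp_def, cj_mul]
  · intro i j
    have h1 : ev (fun l => c (l.map (cn (e i)))) (mapL (cj (g (e j))) z) =
        ev c (mapL (cj ((g (e i))⁻¹ * g (e j))) z) := by
      rw [← ev_mapL, mapL_mapL]
      simp only [hcn]
    refine h1.trans ?_
    split_ifs with hij
    · exact (hpair _).2 (by rw [hij, inv_mul_cancel])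
    · refine (hpair _).1 fun hC => hij ?_
      refine e.injective (hh _ _ ?_)
      have h2 : (h (e j))⁻¹ * h (e i) = SpecialLinearGroup.map (Int.castRingHom (ZMod p))
          ((g (e i))⁻¹ * g (e j))⁻¹ := by
        rw [_root_.mul_inv_rev, inv_inv, map_mul, map_inv, hg, hg]
      rw [h2]
      exact hC

end Final

end CodimOne

/-- For `p = 3` or `5` and `n ≥ 3`, the integral cohomology
`H^{n(n-1)/2 - 1}(Γ_n(p); ℤ)` surjects onto a free abelian group of rank
`p^{(n-2 choose 2)} · |Gr_2(𝔽_p^n)| · ((p-1)/2)^{n-2}`. -/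
theorem codim_one_integral_cohomology_congruence_surjects (p n : ℕ)
    (hp : p = 3 ∨ p = 5) (hn : 3 ≤ n) :
    ∃ f : ↥(groupCohomology (Rep.trivial ℤ ↥(congruenceSubgroup n p) ℤ)
            (n * (n - 1) / 2 - 1)) →+
          (Fin (p ^ Nat.choose (n - 2) 2 *
            Nat.card {W : Submodule (ZMod p) (Fin n → ZMod p) //
              Module.finrank (ZMod p) ↥W = 2} *
            ((p - 1) / 2) ^ (n - 2)) → ℤ),
      Function.Surjective f := by
  have : Fact p.Prime := ⟨by rcases hp with rfl | rfl <;> norm_num⟩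
  obtain ⟨m, rfl⟩ : ∃ m, n = m + 2 := ⟨n - 2, by omega⟩
  have h := CodimOne.exists_surjective (p := p) (m := m) (by omega) (by omega)
  rwa [CodimOne.card_classIndex, CodimOne.numPos_eq (by omega)] at h
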